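/- Let i, j, k ≥ 6. There exists ρ₀ ≥ max(i,j,k) such that for all integers ρ ≥ ρ₀ the following holds: let x = (ab⁻¹)³(a²b⁻¹)³ · (ab⁻¹)³(a²b⁻¹)⁴ ⋯ (ab⁻¹)³(a²b⁻¹)^{ρ+2} (the concatenation of (ab⁻¹)³(a²b⁻¹)^m for m = 3, …, ρ+2) and y = (ab⁻¹)³(a²b⁻¹)^{ρ+3} ⋯ (ab⁻¹)³(a²b⁻¹)^{2ρ+2} (the concatenation of (ab⁻¹)³(a²b⁻¹)^m for m = ρ+3, …, 2ρ+2), words in the free group F(a,b). Then the subgroup M of T_{i,j,k} = ⟨a, b; a^i, b^j, (ab)^k⟩ generated by the images of x and y is a malcharacteristic subgroup of T_{i,j,k} and is free of rank two. -/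

import Mathlib

/-- A subgroup `M ≤ H` is malcharacteristic if for every automorphism `δ` of `H`,
`δ(M) ∩ M ≠ 1` implies that `δ` is conjugation by an element of `M`. -/
def Malcharacteristic {H : Type*} [Group H] (M : Subgroup H) : Prop :=
  ∀ δ : MulAut H, (∃ x ∈ M, x ≠ 1 ∧ δ x ∈ M) →
    ∃ m ∈ M, ∀ h : H, δ h = m⁻¹ * h * m

/-- The relators of the triangle group `T_{i,j,k}`. -/
def triangleRels (i j k : ℕ) : Set (FreeGroup (Fin 2)) :=
  {FreeGroup.of 0 ^ i, FreeGroup.of 1 ^ j, (FreeGroup.of 0 * FreeGroup.of 1) ^ k}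

/-- The triangle group `T_{i,j,k} = ⟨a, b; a^i, b^j, (ab)^k⟩`. -/
abbrev TriangleGroup (i j k : ℕ) := PresentedGroup (triangleRels i j k)

/-- The generator `a` of the free group of rank two. -/
def fa : FreeGroup (Fin 2) := FreeGroup.of 0

/-- The generator `b` of the free group of rank two. -/
def fb : FreeGroup (Fin 2) := FreeGroup.of 1

/-- The word `x = (ab⁻¹)³(a²b⁻¹)³ (ab⁻¹)³(a²b⁻¹)⁴ ⋯ (ab⁻¹)³(a²b⁻¹)^{ρ+2}`. -/
def wordX (ρ : ℕ) : FreeGroup (Fin 2) :=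
  (((List.range ρ).map fun m => (fa * fb⁻¹) ^ 3 * (fa ^ 2 * fb⁻¹) ^ (m + 3))).prod

/-- The word `y = (ab⁻¹)³(a²b⁻¹)^{ρ+3} ⋯ (ab⁻¹)³(a²b⁻¹)^{2ρ+2}`. -/
def wordY (ρ : ℕ) : FreeGroup (Fin 2) :=
  (((List.range ρ).map fun m => (fa * fb⁻¹) ^ 3 * (fa ^ 2 * fb⁻¹) ^ (m + ρ + 3))).prod

namespace Tri
open CoxeterSystem Real

abbrev V := Fin 3 → ℝ

theorem sum3 {x y z : Fin 3} (hxy : x ≠ y) (hxz : x ≠ z) (hyz : y ≠ z) (f : Fin 3 → ℝ) :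
    ∑ l, f l = f x + f y + f z := by
  rw [Fin.sum_univ_three]
  fin_cases x <;> fin_cases y <;> fin_cases z <;> simp_all <;> ring

theorem cases3 {x y z : Fin 3} (hxy : x ≠ y) (hxz : x ≠ z) (hyz : y ≠ z) (l : Fin 3) :
    l = x ∨ l = y ∨ l = z := by
  revert x y z l; decide

theorem exists_third {x y : Fin 3} (hxy : x ≠ y) : ∃ z, x ≠ z ∧ y ≠ z := by
  revert x y; decide

theorem ext3 {x y z : Fin 3} (hxy : x ≠ y) (hxz : x ≠ z) (hyz : y ≠ z) {v w : V}
    (h1 : v x = w x) (h2 : v y = w y) (h3 : v z = w z) : v = w := by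
  funext l
  rcases cases3 hxy hxz hyz l with rfl | rfl | rfl <;> assumption

variable (M : CoxeterMatrix (Fin 3))

/-- All off-diagonal entries are at least six. -/
def Big : Prop := ∀ x y, x ≠ y → 6 ≤ M x y

/-- `2 cos (π / M x y)`; equals `-2` on the diagonal. -/
noncomputable def cc (x y : Fin 3) : ℝ := 2 * Real.cos (π / M x y)

theorem cc_diag (x : Fin 3) : cc M x x = -2 := by simp [cc]

theorem cc_symm (x y : Fin 3) : cc M x y = cc M y x := by simp [cc, M.symmetric x y]

/-- simple root -/
def al (x : Fin 3) : V := Pi.single x 1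

@[simp] theorem al_same (x : Fin 3) : al x x = 1 := by simp [al]
theorem al_ne {x y : Fin 3} (h : y ≠ x) : al x y = 0 := by simp [al, h]

/-- simple reflection -/
noncomputable def sg (x : Fin 3) : Module.End ℝ V where
  toFun v := v + (∑ l, cc M x l * v l) • al x
  map_add' v w := by
    simp only [Pi.add_apply, mul_add, Finset.sum_add_distrib, add_smul]; abel
  map_smul' r v := by
    simp only [Pi.smul_apply, smul_eq_mul, RingHom.id_apply, smul_add, smul_smul, Finset.mul_sum]
    congr 2
    apply Finset.sum_congr rfl; intros; ring

theorem sg_apply (x : Fin 3) (v : V) : sg M x v = v + (∑ l, cc M x l * v l) • al x := rfl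

theorem sg_same {x y z : Fin 3} (hxy : x ≠ y) (hxz : x ≠ z) (hyz : y ≠ z) (v : V) :
    sg M x v x = - v x + cc M x y * v y + cc M x z * v z := by
  rw [sg_apply, sum3 hxy hxz hyz]; simp [cc_diag]; ring

theorem sg_ne {x y : Fin 3} (hxy : y ≠ x) (v : V) : sg M x v y = v y := by
  rw [sg_apply]; simp [al_ne hxy]

theorem sg_sq (x : Fin 3) : sg M x * sg M x = 1 := by
  obtain ⟨y, z, hxy, hxz, hyz⟩ : ∃ y z : Fin 3, x ≠ y ∧ x ≠ z ∧ y ≠ z := by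
    revert x; decide
  ext1; ext1
  simp only [LinearMap.comp_apply, Module.End.mul_apply, Module.End.one_apply]
  apply ext3 hxy hxz hyz
  · rw [sg_same M hxy hxz hyz, sg_same M hxy hxz hyz, sg_ne M hxy.symm, sg_ne M hxz.symm]; ring
  · rw [sg_ne M hxy.symm, sg_ne M hxy.symm]
  · rw [sg_ne M hxz.symm, sg_ne M hxz.symm]

theorem sg_al (u l : Fin 3) : sg M u (al l) = al l + cc M u l • al u := by
  rw [sg_apply]; congr 2
  simp [al, Pi.single_apply]

variable {M}

theorem angle_pos (hM : Big M) {x y : Fin 3} (hxy : x ≠ y) :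
    0 < π / M x y ∧ π / M x y ≤ π / 6 := by
  have h6 := hM x y hxy
  have : (6:ℝ) ≤ M x y := by exact_mod_cast h6
  exact ⟨by positivity, by gcongr⟩

theorem cc_ge (hM : Big M) {x y : Fin 3} (hxy : x ≠ y) : √3 ≤ cc M x y := by
  obtain ⟨h1, h2⟩ := angle_pos hM hxy
  have := Real.cos_le_cos_of_nonneg_of_le_pi h1.le (by linarith [pi_pos]) h2
  rw [cos_pi_div_six] at this
  unfold cc; linarith

theorem cc_le (x y : Fin 3) : cc M x y ≤ 2 := by
  unfold cc; linarith [Real.cos_le_one (π / M x y)]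

theorem cc_lt (hM : Big M) {x y : Fin 3} (hxy : x ≠ y) : cc M x y < 2 := by
  obtain ⟨h1, h2⟩ := angle_pos hM hxy
  have := Real.cos_lt_cos_of_nonneg_of_le_pi le_rfl (by linarith [pi_pos]) h1
  rw [cos_zero] at this
  unfold cc; linarith

theorem sg_plane {x y z : Fin 3} (hxy : x ≠ y) (hxz : x ≠ z) (hyz : y ≠ z) (v : V) (hv : v z = 0) :
    sg M x (sg M y (sg M x (sg M y v))) = (cc M x y ^ 2 - 2) • (sg M x (sg M y v)) - v := by
  have e1 := fun v => sg_same M hxy hxz hyz v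
  have e2 := fun v => sg_same M hxy.symm hyz hxz v
  have e3 := cc_symm M y x
  apply ext3 hxy hxz hyz <;>
  simp only [Pi.sub_apply, Pi.smul_apply, smul_eq_mul, e1, e2, sg_ne M hxy, sg_ne M hxy.symm, sg_ne M hxz.symm, sg_ne M hyz.symm, hv, e3] <;>
  ring

theorem sg_lift_aux (hM : Big M) {x y : Fin 3} (hxy : x ≠ y) : (sg M x * sg M y) ^ M x y = 1 := by
  obtain ⟨z, hxz, hyz⟩ := exists_third hxy
  obtain ⟨h1, h2⟩ := angle_pos hM hxy
  set θ := π / M x y with hθ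
  set T := sg M x * sg M y with hT
  have hm : (M x y : ℝ) ≠ 0 := by
    have := hM x y hxy
    positivity
  have hs : 0 < Real.sin (2 * θ) := Real.sin_pos_of_pos_of_lt_pi (by linarith) (by linarith [pi_pos])
  have hc : Real.cos (2 * θ) < 1 := by
    have := Real.cos_lt_cos_of_nonneg_of_le_pi le_rfl (by linarith [pi_pos]) (by linarith : 0 < 2 * θ)
    simpa using this
  have hcc : cc M x y ^ 2 - 2 = 2 * Real.cos (2 * θ) := by
    rw [Real.cos_two_mul]; unfold cc; rw [← hθ]; ring
  have hz : ∀ v : V, T v z = v z := by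
    intro v; rw [hT, Module.End.mul_apply, sg_ne M hxz.symm, sg_ne M hyz.symm]
  have hpl : ∀ v : V, v z = 0 → T (T v) = (2 * Real.cos (2 * θ)) • T v - v := by
    intro v hv; rw [← hcc]; exact sg_plane hxy hxz hyz v hv
  have hn : ∀ (n : ℕ) (v : V), v z = 0 → Real.sin (2 * θ) • (T ^ n) v =
      Real.sin (2 * n * θ) • T v - Real.sin (2 * n * θ - 2 * θ) • v := by
    intro n v hv
    induction n with
    | zero => simp
    | succ n ih =>
      rw [pow_succ', Module.End.mul_apply, ← map_smul, ih, map_sub, map_smul, map_smul, hpl v hv]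
      rw [show 2 * ((n+1 : ℕ) : ℝ) * θ = 2 * n * θ + 2 * θ by push_cast; ring]
      rw [Real.sin_sub (2 * n * θ), add_sub_cancel_right, Real.sin_add (2 * n * θ)]
      module
  have hfix : ∀ v : V, v z = 0 → (T ^ M x y) v = v := by
    intro v hv
    have := hn (M x y) v hv
    have e : 2 * (M x y : ℝ) * θ = 2 * π := by rw [hθ]; field_simp
    rw [e, Real.sin_two_pi, Real.sin_sub, Real.sin_two_pi, Real.cos_two_pi] at this
    have h3 : Real.sin (2 * θ) • (T ^ M x y) v = Real.sin (2 * θ) • v := by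
      rw [this]; module
    exact smul_right_injective V hs.ne' h3
  have hzn : ∀ (n : ℕ) (v : V), (T ^ n) v z = v z := by
    intro n v
    induction n with
    | zero => simp
    | succ n ih => rw [pow_succ', Module.End.mul_apply, hz, ih]
  apply LinearMap.ext
  intro v
  have hw0 : ((T ^ M x y) v - v) z = 0 := by simp [hzn]
  have hw1 : T ((T ^ M x y) v - v) = (T ^ M x y) v - v := by
    have h4 : (T v - v) z = 0 := by simp [hz]
    have := hfix _ h4
    rw [map_sub, ← Module.End.mul_apply, ← pow_succ, pow_succ', Module.End.mul_apply] at this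
    rw [map_sub]
    rw [sub_eq_sub_iff_add_eq_add] at this ⊢
    rw [this]; abel
  have h5 := hpl _ hw0
  rw [hw1, hw1] at h5
  have h6 : (2 - 2 * Real.cos (2 * θ)) • ((T ^ M x y) v - v) = 0 := by
    rw [sub_smul, sub_eq_zero, two_smul]
    nth_rewrite 1 [h5]; abel
  rcases smul_eq_zero.1 h6 with h7 | h7
  · linarith
  · simpa [sub_eq_zero] using h7

theorem sg_liftable (hM : Big M) : M.IsLiftable (sg M) := by
  intro x y
  by_cases h : x = y
  · subst h; simp [sg_sq]
  · exact sg_lift_aux hM h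

/-- The Tits representation. -/
noncomputable def rep (hM : Big M) : M.Group →* Module.End ℝ V :=
  M.toCoxeterSystem.lift ⟨sg M, sg_liftable hM⟩

/-- simple reflections -/
def sr (x : Fin 3) : M.Group := M.toCoxeterSystem.simple x

@[simp] theorem rep_sr (hM : Big M) (x : Fin 3) : rep hM (sr x) = sg M x :=
  M.toCoxeterSystem.lift_apply_simple (sg_liftable hM) x

@[simp] theorem sr_mul_self (x : Fin 3) : (sr x * sr x : M.Group) = 1 :=
  M.toCoxeterSystem.simple_mul_simple_self x

@[simp] theorem sr_mul_cancel (x : Fin 3) (g : M.Group) : sr x * (sr x * g) = g := by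
  rw [← mul_assoc, sr_mul_self, one_mul]

@[simp] theorem mul_sr_cancel (x : Fin 3) (g : M.Group) : g * sr x * sr x = g := by
  rw [mul_assoc, sr_mul_self, mul_one]

@[simp] theorem sr_inv (x : Fin 3) : (sr x : M.Group)⁻¹ = sr x :=
  M.toCoxeterSystem.inv_simple x

/-- positive vectors -/
def IsPos (v : V) : Prop := ∀ i, v i = 0 ∨ 1 ≤ v i

theorem IsPos.nonneg {v : V} (h : IsPos v) (i : Fin 3) : 0 ≤ v i := by
  rcases h i with h | h <;> linarith

theorem isPos_comb {A B : ℝ} (hA : A = 0 ∨ 1 ≤ A) (hB : B = 0 ∨ 1 ≤ B) {v w : V} (hv : IsPos v)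
    (hw : IsPos w) : IsPos (A • v + B • w) := by
  have key : ∀ A a : ℝ, (A = 0 ∨ 1 ≤ A) → (a = 0 ∨ 1 ≤ a) → A * a = 0 ∨ 1 ≤ A * a := by
    rintro A a (rfl | h) (rfl | h') <;> simp
    right; nlinarith
  intro i
  simp only [Pi.add_apply, Pi.smul_apply, smul_eq_mul]
  rcases key A _ hA (hv i) with h | h <;> rcases key B _ hB (hw i) with h' | h'
  · left; linarith
  all_goals right; linarith

/-- length -/
noncomputable abbrev len (w : M.Group) : ℕ := M.toCoxeterSystem.length w

/-- right descent -/
def Desc (w : M.Group) (s : Fin 3) : Prop := len (w * sr s) < len w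

theorem len_mul_sr (w : M.Group) (s : Fin 3) :
    len (w * sr s) = len w + 1 ∨ len (w * sr s) + 1 = len w :=
  M.toCoxeterSystem.length_mul_simple w s

theorem desc_iff (w : M.Group) (s : Fin 3) : Desc w s ↔ len (w * sr s) + 1 = len w := by
  unfold Desc; rcases len_mul_sr w s with h | h <;> omega

theorem not_desc_iff (w : M.Group) (s : Fin 3) : ¬ Desc w s ↔ len (w * sr s) = len w + 1 := by
  unfold Desc; rcases len_mul_sr w s with h | h <;> omega

theorem not_desc_mul {w : M.Group} {s : Fin 3} (h : Desc w s) : ¬ Desc (w * sr s) s := by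
  rw [not_desc_iff, mul_sr_cancel]; rw [desc_iff] at h; omega

theorem desc_mul {w : M.Group} {s : Fin 3} (h : ¬ Desc w s) : Desc (w * sr s) s := by
  rw [desc_iff, mul_sr_cancel]; rw [not_desc_iff] at h; omega

theorem exists_desc {w : M.Group} (h : w ≠ 1) : ∃ s, Desc w s :=
  M.toCoxeterSystem.exists_rightDescent_of_ne_one h

/-- word product -/
def wp (u : List (Fin 3)) : M.Group := M.toCoxeterSystem.wordProd u

@[simp] theorem wp_nil : wp (M := M) [] = 1 := rfl
@[simp] theorem wp_cons (x : Fin 3) (u : List (Fin 3)) : wp (M := M) (x :: u) = sr x * wp u :=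
  M.toCoxeterSystem.wordProd_cons x u
theorem wp_append (u v : List (Fin 3)) : wp (M := M) (u ++ v) = wp u * wp v :=
  M.toCoxeterSystem.wordProd_append u v

theorem len_wp_le (u : List (Fin 3)) : len (wp (M := M) u) ≤ u.length :=
  M.toCoxeterSystem.length_wordProd_le u

theorem peel (n0 : ℕ) : ∀ (w : M.Group) (s t : Fin 3), len w = n0 → ¬ Desc w s →
    ∃ v n, w = v * wp (alternatingWord s t n) ∧ len w = len v + n ∧ ¬ Desc v s ∧ ¬ Desc v t := by
  induction n0 using Nat.strong_induction_on with
  | _ n0 ih =>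
    intro w s t hl hs
    by_cases ht : Desc w t
    · have h1 := (desc_iff _ _).1 ht
      obtain ⟨v, n, e1, e2, e3, e4⟩ := ih (len (w * sr t)) (by omega) (w * sr t) t s rfl (not_desc_mul ht)
      refine ⟨v, n + 1, ?_, by omega, e4, e3⟩
      rw [alternatingWord_succ, List.concat_eq_append, wp_append, ← mul_assoc, ← e1]
      simp
    · exact ⟨w, 0, by simp [alternatingWord], by simp, hs, ht⟩

theorem dihedral (hM : Big M) {s t : Fin 3} (hst : s ≠ t) (n : ℕ) :
    Real.sin (π / M s t) • rep hM (wp (alternatingWord s t n)) (al s) =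
      if Even n then Real.sin ((n + 1) * (π / M s t)) • al s + Real.sin (n * (π / M s t)) • al t
      else Real.sin (n * (π / M s t)) • al s + Real.sin ((n + 1) * (π / M s t)) • al t := by
  set θ := π / M s t with hθ
  have hcc : cc M s t = 2 * Real.cos θ := rfl
  have hcc' : cc M t s = 2 * Real.cos θ := by rw [cc_symm]; rfl
  induction n with
  | zero => simp [alternatingWord]
  | succ n ih =>
    rw [alternatingWord_succ', wp_cons, map_mul, Module.End.mul_apply, ← map_smul, ih]
    have e0 : Real.sin (((n+1 : ℕ) + 1) * θ) = 2 * Real.cos θ * Real.sin ((n+1) * θ) - Real.sin (n * θ) := by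
      rw [show ((n+1 : ℕ) + 1) * θ = (n + 1) * θ + θ by push_cast; ring,
        show (n * θ) = (n + 1) * θ - θ by ring, Real.sin_add, Real.sin_sub]; ring
    rw [e0]
    by_cases hn : Even n
    · have hn' : ¬ Even (n+1) := by simpa [Nat.even_add_one] using hn
      simp only [hn, hn', if_true, if_false, rep_sr, map_add, map_smul, sg_al, hcc', cc_diag]
      push_cast; module
    · have hn' : Even (n+1) := by simpa [Nat.even_add_one] using hn
      simp only [hn, hn', if_true, if_false, rep_sr, map_add, map_smul, sg_al, hcc, cc_diag]
      push_cast; module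

theorem sin_ratio (hM : Big M) {s t : Fin 3} (hst : s ≠ t) (k : ℕ) (hk : k ≤ M s t) :
    Real.sin (k * (π / M s t)) / Real.sin (π / M s t) = 0 ∨
    1 ≤ Real.sin (k * (π / M s t)) / Real.sin (π / M s t) := by
  obtain ⟨h1, h2⟩ := angle_pos hM hst
  have hm : (M s t : ℝ) ≠ 0 := by
    have := hM s t hst
    positivity
  set θ := π / M s t with hθ
  have hpi : M s t * θ = π := by rw [hθ]; field_simp
  have hs : 0 < Real.sin θ := Real.sin_pos_of_pos_of_lt_pi (by linarith) (by linarith [pi_pos])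
  rcases Nat.eq_zero_or_pos k with rfl | hk0
  · left; simp
  rcases hk.eq_or_lt with rfl | hk1
  · left; rw [hpi]; simp
  right
  rw [le_div_iff₀ hs, one_mul]
  have hk0' : (1:ℝ) ≤ k := by exact_mod_cast hk0
  have hk1' : (k:ℝ) + 1 ≤ M s t := by exact_mod_cast hk1
  have a1 : θ ≤ k * θ := by nlinarith
  have a2 : k * θ ≤ π - θ := by nlinarith
  rcases le_total (k * θ) (π / 2) with h | h
  · exact Real.sin_le_sin_of_le_of_le_pi_div_two (by linarith) h a1
  · rw [← Real.sin_pi_sub (k * θ)]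
    exact Real.sin_le_sin_of_le_of_le_pi_div_two (by linarith) (by linarith) (by linarith)

/-- roots -/
noncomputable def rt (hM : Big M) (w : M.Group) (s : Fin 3) : V := rep hM w (al s)

theorem rt_mul_sr (hM : Big M) (w : M.Group) (u l : Fin 3) :
    rt hM (w * sr u) l = rt hM w l + cc M u l • rt hM w u := by
  simp [rt, sg_al]

theorem rt_mul_sr_self (hM : Big M) (w : M.Group) (u : Fin 3) :
    rt hM (w * sr u) u = - rt hM w u := by
  rw [rt_mul_sr, cc_diag]; module

theorem rt_mul (hM : Big M) (g w : M.Group) (l : Fin 3) :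
    rt hM (g * w) l = rep hM g (rt hM w l) := by
  simp [rt]

theorem rt_pos (hM : Big M) (n0 : ℕ) : ∀ (w : M.Group) (s : Fin 3), len w = n0 → ¬ Desc w s →
    IsPos (rt hM w s) := by
  induction n0 using Nat.strong_induction_on with
  | _ n0 ih =>
    intro w s hl hs
    by_cases hw : w = 1
    · subst hw
      intro i
      by_cases h : i = s
      · subst h; simp [rt]
      · left; simp [rt, al_ne h]
    obtain ⟨t, ht⟩ := exists_desc hw
    have hst : s ≠ t := by rintro rfl; exact hs ht
    obtain ⟨v, n, e1, e2, e3, e4⟩ := peel _ w s t rfl hs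
    have hn : n ≠ 0 := by
      rintro rfl
      simp [alternatingWord] at e1
      exact e4 (e1 ▸ ht)
    have hnm : n + 1 ≤ M s t := by
      by_contra hcon
      push Not at hcon
      have hM6 := hM s t hst
      have h1 : ¬ M.toCoxeterSystem.IsReduced (alternatingWord t s (n+1)) := by
        apply M.toCoxeterSystem.not_isReduced_alternatingWord
        · rw [M.symmetric]; omega
        · rw [M.symmetric]; omega
      have h2 := len_wp_le (M := M) (alternatingWord t s (n+1))
      have h3 : len (wp (M := M) (alternatingWord t s (n+1))) ≠ (alternatingWord t s (n+1)).length := h1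
      have h4 : w * sr s = v * wp (alternatingWord t s (n+1)) := by
        rw [alternatingWord_succ, List.concat_eq_append, wp_append, ← mul_assoc, ← e1]; simp
      have h5 := M.toCoxeterSystem.length_mul_le v (wp (alternatingWord t s (n+1)))
      rw [← h4] at h5
      have h6 := (not_desc_iff _ _).1 hs
      simp only [length_alternatingWord] at h2 h3
      change len (w * sr s) ≤ len v + len (wp (alternatingWord t s (n+1))) at h5
      omega
    have p1 := ih (len v) (by omega) v s rfl e3
    have p2 := ih (len v) (by omega) v t rfl e4
    obtain ⟨h1, h2⟩ := angle_pos hM hst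
    have hsin : 0 < Real.sin (π / M s t) := Real.sin_pos_of_pos_of_lt_pi (by linarith) (by linarith [pi_pos])
    have hd := dihedral hM hst n
    have r1 := sin_ratio hM hst n (by omega)
    have r2 := sin_ratio hM hst (n+1) (by omega)
    push_cast at r2
    have hrt : rt hM w s = (Real.sin (π / M s t))⁻¹ • rep hM v (Real.sin (π / M s t) • rep hM (wp (alternatingWord s t n)) (al s)) := by
      rw [map_smul, smul_smul, inv_mul_cancel₀ hsin.ne', one_smul, rt]
      nth_rewrite 1 [e1]; simp
    rw [hrt, hd]
    split_ifs
    · rw [map_add, map_smul, map_smul, smul_add, smul_smul, smul_smul, inv_mul_eq_div, inv_mul_eq_div]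
      exact isPos_comb r2 r1 p1 p2
    · rw [map_add, map_smul, map_smul, smul_add, smul_smul, smul_smul, inv_mul_eq_div, inv_mul_eq_div]
      exact isPos_comb r1 r2 p1 p2

theorem rt_pos' (hM : Big M) {w : M.Group} {s : Fin 3} (h : ¬ Desc w s) : IsPos (rt hM w s) :=
  rt_pos hM _ w s rfl h

theorem rt_neg (hM : Big M) {w : M.Group} {s : Fin 3} (h : Desc w s) : IsPos (- rt hM w s) := by
  have := rt_pos' hM (not_desc_mul h)
  rwa [rt_mul_sr_self] at this

theorem rt_ne_zero (hM : Big M) (w : M.Group) (s : Fin 3) : rt hM w s ≠ 0 := by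
  intro h
  have : rep hM w⁻¹ (rt hM w s) = al s := by
    rw [rt, ← Module.End.mul_apply, ← map_mul]; simp
  rw [h, map_zero] at this
  have := congrFun this s
  simp at this

/-- height -/
def ht (v : V) : ℝ := ∑ l, v l

theorem ht_add (v w : V) : ht (v + w) = ht v + ht w := by simp [ht, Finset.sum_add_distrib]
theorem ht_smul (r : ℝ) (v : V) : ht (r • v) = r * ht v := by simp [ht, Finset.mul_sum]
theorem ht_neg (v : V) : ht (-v) = - ht v := by simp [ht]

theorem IsPos.ht_ge {v : V} (h : IsPos v) (h0 : v ≠ 0) : 1 ≤ ht v := by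
  by_contra hc
  apply h0
  have hh : ht v = v 0 + v 1 + v 2 := by simp [ht, Fin.sum_univ_three]
  have n0 := h.nonneg 0
  have n1 := h.nonneg 1
  have n2 := h.nonneg 2
  funext i
  rcases h i with h1 | h1
  · exact h1
  · exfalso; fin_cases i <;> simp at h1 <;> linarith

theorem desc_iff_ht (hM : Big M) (w : M.Group) (s : Fin 3) : Desc w s ↔ ht (rt hM w s) < 0 := by
  by_cases h : Desc w s
  · have := (rt_neg hM h).ht_ge (neg_ne_zero.2 (rt_ne_zero hM w s))
    rw [ht_neg] at this
    simp only [h, true_iff]; linarith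
  · have := (rt_pos' hM h).ht_ge (rt_ne_zero hM w s)
    simp only [h, false_iff]; linarith

end Tri

namespace Tri
open CoxeterSystem Real
variable {M : CoxeterMatrix (Fin 3)}

/-- heights of the images of the simple roots -/
noncomputable def hs (hM : Big M) (h : M.Group) (l : Fin 3) : ℝ := ht (rt hM h l)

theorem hs_mul (hM : Big M) (h : M.Group) (u l : Fin 3) :
    hs hM (h * sr u) l = hs hM h l + cc M u l * hs hM h u := by
  unfold hs; rw [rt_mul_sr, ht_add, ht_smul]

theorem hs_mul_self (hM : Big M) (h : M.Group) (u : Fin 3) :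
    hs hM (h * sr u) u = - hs hM h u := by
  rw [hs_mul, cc_diag]; ring

/-- reading the word `u` from `h`, after every letter exactly that letter is a descent, with heights
at least `b` in absolute value -/
def Good (hM : Big M) (b : ℝ) : M.Group → List (Fin 3) → Prop
  | _, [] => True
  | h, l :: u => (hs hM (h * sr l) l ≤ -b ∧ ∀ m, m ≠ l → b ≤ hs hM (h * sr l) m) ∧
      Good hM b (h * sr l) u

theorem Good.mono {hM : Big M} {b b' : ℝ} (hb : b' ≤ b) : ∀ {h : M.Group} {u : List (Fin 3)},
    Good hM b h u → Good hM b' h u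
  | _, [], _ => trivial
  | h, l :: u, ⟨⟨h1, h2⟩, h3⟩ => ⟨⟨by linarith, fun m hm => by linarith [h2 m hm]⟩, h3.mono hb⟩

theorem good_append {hM : Big M} {b : ℝ} : ∀ {h : M.Group} {u v : List (Fin 3)},
    Good hM b h (u ++ v) ↔ Good hM b h u ∧ Good hM b (h * wp u) v
  | h, [], v => by simp [Good]
  | h, l :: u, v => by
    simp only [List.cons_append, Good, wp_cons, ← mul_assoc, good_append (u := u)]
    tauto

/-- The invariant. -/
def Inv (hM : Big M) (x y z : Fin 3) (b : ℝ) (h : M.Group) : Prop :=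
  ∃ τ, b ≤ τ ∧ hs hM h z = -τ ∧ 1.1 * τ ≤ hs hM h y ∧ 1.1 * τ ≤ hs hM h x

theorem sq3 : (1.732:ℝ) ≤ √3 := by
  rw [Real.le_sqrt (by norm_num) (by norm_num)]; norm_num

theorem cc_bd (hM : Big M) {x y : Fin 3} (hxy : x ≠ y) {v : ℝ} (hv : 0 ≤ v) :
    1.732 * v ≤ cc M x y * v ∧ cc M x y * v ≤ 2 * v := by
  have h1 := cc_ge hM hxy
  have h2 := cc_le (M := M) x y
  have := sq3
  constructor
  · gcongr; linarith
  · gcongr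

theorem cc_sq (hM : Big M) {x y : Fin 3} (hxy : x ≠ y) : 3 ≤ cc M x y ^ 2 ∧ cc M x y ^ 2 ≤ 4 := by
  have h1 := cc_ge hM hxy
  have h2 := cc_le (M := M) x y
  have := sq3
  have h3 : √3 ^ 2 = (3:ℝ) := Real.sq_sqrt (by norm_num)
  constructor <;> nlinarith

theorem good_cons_of {hM : Big M} {b : ℝ} {h : M.Group} {l m n : Fin 3} {u : List (Fin 3)}
    (hlm : l ≠ m) (hln : l ≠ n) (hmn : m ≠ n)
    (h1 : b ≤ hs hM h l) (h2 : b ≤ hs hM (h * sr l) m) (h3 : b ≤ hs hM (h * sr l) n)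
    (h4 : Good hM b (h * sr l) u) : Good hM b h (l :: u) := by
  refine ⟨⟨?_, ?_⟩, h4⟩
  · rw [hs_mul_self]; linarith
  · intro k hk
    rcases cases3 hlm hln hmn k with rfl | rfl | rfl
    · exact absurd rfl hk
    · exact h2
    · exact h3

theorem gapX {hM : Big M} {x y z : Fin 3} (hxy : x ≠ y) (hxz : x ≠ z) (hyz : y ≠ z)
    {b : ℝ} (hb : 0 < b) {h : M.Group} (hi : Inv hM x y z b h) : Good hM (b/2) h [y, x, y, z] ∧ Inv hM x y z (2 * b) (h * sr y * sr x * sr y * sr z) := by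
  obtain ⟨τ, h0, h1, h2, h3⟩ := hi
  have s1 := cc_symm M y x
  have s2 := cc_symm M z x
  have s3 := cc_symm M z y
  set ρ := hs hM h x with hρ
  set σ := hs hM h y with hσ
  obtain ⟨n1, e1⟩ : ∃ n1, n1 = ρ + cc M x y * σ := ⟨_, rfl⟩
  obtain ⟨n2, e2⟩ : ∃ n2, n2 = cc M x y * n1 - σ := ⟨_, rfl⟩
  obtain ⟨Q, e3⟩ : ∃ Q, Q = -τ + cc M y z * σ + cc M x z * n1 + cc M y z * n2 := ⟨_, rfl⟩
  have b1 := cc_bd hM hxy (v := σ) (by linarith)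
  have b1' := cc_bd hM hyz (v := σ) (by linarith)
  have b2 := cc_bd hM hxy (v := n1) (by linarith)
  have b2' := cc_bd hM hxz (v := n1) (by linarith)
  have b3 := cc_bd hM hxy (v := n2) (by linarith)
  have b3' := cc_bd hM hyz (v := n2) (by linarith)
  have b4 := cc_bd hM hxz (v := Q) (by linarith)
  have b4' := cc_bd hM hyz (v := Q) (by linarith)
  have a1 : hs hM (h * sr y) x = n1 := by rw [hs_mul, e1, s1]
  have a2 : hs hM (h * sr y) y = -σ := by rw [hs_mul_self]
  have a3 : hs hM (h * sr y) z = -τ + cc M y z * σ := by rw [hs_mul, h1]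
  have a4 : hs hM (h * sr y * sr x) x = -n1 := by rw [hs_mul_self, a1]
  have a5 : hs hM (h * sr y * sr x) y = n2 := by rw [hs_mul, a1, a2, e2]; ring
  have a6 : hs hM (h * sr y * sr x) z = -τ + cc M y z * σ + cc M x z * n1 := by rw [hs_mul, a1, a3]
  have a7 : hs hM (h * sr y * sr x * sr y) x = cc M x y * n2 - n1 := by rw [hs_mul, a4, a5, s1]; ring
  have a8 : hs hM (h * sr y * sr x * sr y) y = -n2 := by rw [hs_mul_self, a5]
  have a9 : hs hM (h * sr y * sr x * sr y) z = Q := by rw [hs_mul, a5, a6, e3]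
  have a10 : hs hM (h * sr y * sr x * sr y * sr z) x = cc M x y * n2 - n1 + cc M x z * Q := by
    rw [hs_mul, a7, a9, s2]
  have a11 : hs hM (h * sr y * sr x * sr y * sr z) y = -n2 + cc M y z * Q := by rw [hs_mul, a8, a9, s3]
  have a12 : hs hM (h * sr y * sr x * sr y * sr z) z = -Q := by rw [hs_mul_self, a9]
  constructor
  · apply good_cons_of hxy.symm hyz hxz
    · linarith
    · linarith
    · linarith
    apply good_cons_of hxy hxz hyz
    · linarith
    · linarith
    · linarith
    apply good_cons_of hxy.symm hyz hxz
    · linarith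
    · linarith
    · linarith
    apply good_cons_of hxz.symm hyz.symm hxy
    · linarith
    · linarith
    · linarith
    trivial
  · refine ⟨Q, ?_, a12, ?_, ?_⟩ <;> linarith

theorem gapY {hM : Big M} {x y z : Fin 3} (hxy : x ≠ y) (hxz : x ≠ z) (hyz : y ≠ z)
    {b : ℝ} (hb : 0 < b) {h : M.Group} (hi : Inv hM x y z b h) : Good hM (b/2) h [y, x, y, x, y, z] ∧
    Inv hM x y z (2 * b) (h * sr y * sr x * sr y * sr x * sr y * sr z) := by
  obtain ⟨τ, h0, h1, h2, h3⟩ := hi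
  have s1 := cc_symm M y x
  have s2 := cc_symm M z x
  have s3 := cc_symm M z y
  set ρ := hs hM h x with hρ
  set σ := hs hM h y with hσ
  obtain ⟨n1, e1⟩ : ∃ n1, n1 = ρ + cc M x y * σ := ⟨_, rfl⟩
  obtain ⟨n2, e2⟩ : ∃ n2, n2 = cc M x y * n1 - σ := ⟨_, rfl⟩
  obtain ⟨n3, e3⟩ : ∃ n3, n3 = cc M x y * n2 - n1 := ⟨_, rfl⟩
  obtain ⟨n4, e4⟩ : ∃ n4, n4 = cc M x y * n3 - n2 := ⟨_, rfl⟩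
  obtain ⟨n5, e5⟩ : ∃ n5, n5 = cc M x y * n4 - n3 := ⟨_, rfl⟩
  obtain ⟨Q, e6⟩ : ∃ Q, Q = -τ + cc M y z * σ + cc M x z * n1 + cc M y z * n2 + cc M x z * n3 +
    cc M y z * n4 := ⟨_, rfl⟩
  have b1 := cc_bd hM hxy (v := σ) (by linarith)
  have b0 := cc_bd hM hxy (v := ρ) (by linarith)
  have b1' := cc_bd hM hyz (v := σ) (by linarith)
  have b2 := cc_bd hM hxy (v := n1) (by linarith)
  have b2' := cc_bd hM hxz (v := n1) (by linarith)
  have b3 := cc_bd hM hxy (v := n2) (by linarith)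
  have b3' := cc_bd hM hyz (v := n2) (by linarith)
  obtain ⟨q1, q2⟩ := cc_sq hM hxy
  have hσ0 : 0 ≤ σ := by linarith
  have hρ0 : 0 ≤ ρ := by linarith
  have f4 : σ ≤ n4 := by
    have : n4 - σ = (cc M x y ^ 2 - 2) * (cc M x y * ρ) + (cc M x y ^ 2 - 3) * cc M x y ^ 2 * σ := by
      subst e4 e3 e2 e1; ring
    have g1 : 0 ≤ (cc M x y ^ 2 - 2) * (cc M x y * ρ) := mul_nonneg (by linarith) (by linarith)
    have g2 : 0 ≤ (cc M x y ^ 2 - 3) * cc M x y ^ 2 * σ :=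
      mul_nonneg (mul_nonneg (by linarith) (by linarith)) hσ0
    linarith
  have f5 : ρ ≤ n5 := by
    have : n5 - ρ = (cc M x y ^ 2 - 3) * cc M x y ^ 2 * ρ +
        (cc M x y ^ 2 - 3) * (cc M x y ^ 2 - 1) * (cc M x y * σ) := by
      subst e5 e4 e3 e2 e1; ring
    have g1 : 0 ≤ (cc M x y ^ 2 - 3) * cc M x y ^ 2 * ρ :=
      mul_nonneg (mul_nonneg (by linarith) (by linarith)) hρ0
    have g2 : 0 ≤ (cc M x y ^ 2 - 3) * (cc M x y ^ 2 - 1) * (cc M x y * σ) :=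
      mul_nonneg (mul_nonneg (by linarith) (by linarith)) (by linarith)
    linarith
  have b5 := cc_bd hM hxy (v := n3) (by linarith)
  have b5' := cc_bd hM hxz (v := n3) (by linarith)
  have b6' := cc_bd hM hyz (v := n4) (by linarith)
  have b4 := cc_bd hM hxz (v := Q) (by linarith)
  have b4' := cc_bd hM hyz (v := Q) (by linarith)
  have a1 : hs hM (h * sr y) x = n1 := by rw [hs_mul, e1, s1]
  have a2 : hs hM (h * sr y) y = -σ := by rw [hs_mul_self]
  have a3 : hs hM (h * sr y) z = -τ + cc M y z * σ := by rw [hs_mul, h1]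
  have a4 : hs hM (h * sr y * sr x) x = -n1 := by rw [hs_mul_self, a1]
  have a5 : hs hM (h * sr y * sr x) y = n2 := by rw [hs_mul, a1, a2, e2]; ring
  have a6 : hs hM (h * sr y * sr x) z = -τ + cc M y z * σ + cc M x z * n1 := by rw [hs_mul, a1, a3]
  have a7 : hs hM (h * sr y * sr x * sr y) x = n3 := by rw [hs_mul, a4, a5, s1, e3]; ring
  have a8 : hs hM (h * sr y * sr x * sr y) y = -n2 := by rw [hs_mul_self, a5]
  have a9 : hs hM (h * sr y * sr x * sr y) z = -τ + cc M y z * σ + cc M x z * n1 + cc M y z * n2 := by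
    rw [hs_mul, a5, a6]
  have c4 : hs hM (h * sr y * sr x * sr y * sr x) x = -n3 := by rw [hs_mul_self, a7]
  have c5 : hs hM (h * sr y * sr x * sr y * sr x) y = n4 := by rw [hs_mul, a7, a8, e4]; ring
  have c6 : hs hM (h * sr y * sr x * sr y * sr x) z =
      -τ + cc M y z * σ + cc M x z * n1 + cc M y z * n2 + cc M x z * n3 := by rw [hs_mul, a7, a9]
  have c7 : hs hM (h * sr y * sr x * sr y * sr x * sr y) x = n5 := by rw [hs_mul, c4, c5, s1, e5]; ring
  have c8 : hs hM (h * sr y * sr x * sr y * sr x * sr y) y = -n4 := by rw [hs_mul_self, c5]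
  have c9 : hs hM (h * sr y * sr x * sr y * sr x * sr y) z = Q := by rw [hs_mul, c5, c6, e6]
  have a10 : hs hM (h * sr y * sr x * sr y * sr x * sr y * sr z) x = n5 + cc M x z * Q := by
    rw [hs_mul, c7, c9, s2]
  have a11 : hs hM (h * sr y * sr x * sr y * sr x * sr y * sr z) y = -n4 + cc M y z * Q := by
    rw [hs_mul, c8, c9, s3]
  have a12 : hs hM (h * sr y * sr x * sr y * sr x * sr y * sr z) z = -Q := by rw [hs_mul_self, c9]
  constructor
  · apply good_cons_of hxy.symm hyz hxz
    · linarith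
    · linarith
    · linarith
    apply good_cons_of hxy hxz hyz
    · linarith
    · linarith
    · linarith
    apply good_cons_of hxy.symm hyz hxz
    · linarith
    · linarith
    · linarith
    apply good_cons_of hxy hxz hyz
    · linarith
    · linarith
    · linarith
    apply good_cons_of hxy.symm hyz hxz
    · linarith
    · linarith
    · linarith
    apply good_cons_of hxz.symm hyz.symm hxy
    · linarith
    · linarith
    · linarith
    trivial
  · refine ⟨Q, ?_, a12, ?_, ?_⟩ <;> linarith

theorem gapJ {hM : Big M} {x y z : Fin 3} (hxy : x ≠ y) (hxz : x ≠ z) (hyz : y ≠ z)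
    {b : ℝ} (hb : 0 < b) {h : M.Group} (hi : Inv hM x y z b h) : Good hM (b/2) h [x, y, z] ∧ Inv hM x y z (2 * b) (h * sr x * sr y * sr z) := by
  obtain ⟨τ, h0, h1, h2, h3⟩ := hi
  have s1 := cc_symm M y x
  have s2 := cc_symm M z x
  have s3 := cc_symm M z y
  set ρ := hs hM h x with hρ
  set σ := hs hM h y with hσ
  obtain ⟨n1, e1⟩ : ∃ n1, n1 = σ + cc M x y * ρ := ⟨_, rfl⟩
  obtain ⟨Q, e3⟩ : ∃ Q, Q = -τ + cc M x z * ρ + cc M y z * n1 := ⟨_, rfl⟩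
  have b1 := cc_bd hM hxy (v := ρ) (by linarith)
  have b1' := cc_bd hM hxz (v := ρ) (by linarith)
  have b2 := cc_bd hM hxy (v := n1) (by linarith)
  have b2' := cc_bd hM hyz (v := n1) (by linarith)
  have b4 := cc_bd hM hxz (v := Q) (by linarith)
  have b4' := cc_bd hM hyz (v := Q) (by linarith)
  have a1 : hs hM (h * sr x) y = n1 := by rw [hs_mul, e1]
  have a2 : hs hM (h * sr x) x = -ρ := by rw [hs_mul_self]
  have a3 : hs hM (h * sr x) z = -τ + cc M x z * ρ := by rw [hs_mul, h1]
  have a4 : hs hM (h * sr x * sr y) y = -n1 := by rw [hs_mul_self, a1]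
  have a5 : hs hM (h * sr x * sr y) x = cc M x y * n1 - ρ := by rw [hs_mul, a1, a2, s1]; ring
  have a6 : hs hM (h * sr x * sr y) z = Q := by rw [hs_mul, a1, a3, e3]
  have a10 : hs hM (h * sr x * sr y * sr z) x = cc M x y * n1 - ρ + cc M x z * Q := by
    rw [hs_mul, a5, a6, s2]
  have a11 : hs hM (h * sr x * sr y * sr z) y = -n1 + cc M y z * Q := by rw [hs_mul, a4, a6, s3]
  have a12 : hs hM (h * sr x * sr y * sr z) z = -Q := by rw [hs_mul_self, a6]
  constructor
  · apply good_cons_of hxy hxz hyz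
    · linarith
    · linarith
    · linarith
    apply good_cons_of hxy.symm hyz hxz
    · linarith
    · linarith
    · linarith
    apply good_cons_of hxz.symm hyz.symm hxy
    · linarith
    · linarith
    · linarith
    trivial
  · refine ⟨Q, ?_, a12, ?_, ?_⟩ <;> linarith

theorem gapJ' {hM : Big M} {x y z : Fin 3} (hxy : x ≠ y) (hxz : x ≠ z) (hyz : y ≠ z)
    {b : ℝ} (hb : 0 < b) {h : M.Group} (hi : Inv hM x y z b h) : Good hM (b/2) h [y, x, z] ∧ Inv hM x y z (2 * b) (h * sr y * sr x * sr z) := by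
  have := gapJ hxy.symm hyz hxz hb (h := h) (hM := hM) (by
    obtain ⟨τ, h0, h1, h2, h3⟩ := hi
    exact ⟨τ, h0, h1, h3, h2⟩)
  refine ⟨this.1, ?_⟩
  obtain ⟨τ, h0, h1, h2, h3⟩ := this.2
  exact ⟨τ, h0, h1, h3, h2⟩

/-- gaps -/
inductive Gap | X | Y | J | K
  deriving DecidableEq

/-- the words of gaps, `0, 1, 2` standing for `r, s, t` -/
def Gap.u : Gap → List (Fin 3)
  | .X => [1, 0, 1]
  | .Y => [1, 0, 1, 0, 1]
  | .J => [0, 1]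
  | .K => [1, 0]

/-- words of gaps, with terminator -/
def Gap.w (g : Gap) : List (Fin 3) := g.u ++ [2]

/-- words of gap lists -/
def fl (G : List Gap) : List (Fin 3) := G.flatMap Gap.w

@[simp] theorem fl_nil : fl [] = [] := rfl
@[simp] theorem fl_cons (g : Gap) (G : List Gap) : fl (g :: G) = g.w ++ fl G := rfl
theorem fl_append (G H : List Gap) : fl (G ++ H) = fl G ++ fl H := by simp [fl]

theorem gap_one {hM : Big M} (p : Equiv.Perm (Fin 3)) {b : ℝ} (hb : 0 < b) {h : M.Group}
    (hi : Inv hM (p 0) (p 1) (p 2) b h) (g : Gap) :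
    Good hM (b/2) h (g.w.map p) ∧ Inv hM (p 0) (p 1) (p 2) (2 * b) (h * wp (g.w.map p)) := by
  have h01 : p 0 ≠ p 1 := by simp
  have h02 : p 0 ≠ p 2 := by simp
  have h12 : p 1 ≠ p 2 := by simp
  cases g
  · simpa [Gap.w, Gap.u, mul_assoc] using gapX h01 h02 h12 hb hi
  · simpa [Gap.w, Gap.u, mul_assoc] using gapY h01 h02 h12 hb hi
  · simpa [Gap.w, Gap.u, mul_assoc] using gapJ h01 h02 h12 hb hi
  · simpa [Gap.w, Gap.u, mul_assoc] using gapJ' h01 h02 h12 hb hi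

theorem gap_list {hM : Big M} (p : Equiv.Perm (Fin 3)) (G : List Gap) : ∀ {b : ℝ} (_ : 0 < b) {h : M.Group}
    (_ : Inv hM (p 0) (p 1) (p 2) b h),
    Good hM (b/2) h ((fl G).map p) ∧ Inv hM (p 0) (p 1) (p 2) (2 ^ G.length * b) (h * wp ((fl G).map p)) := by
  induction G with
  | nil => intro b hb h hi; simpa [Good] using hi
  | cons g G ih =>
    intro b hb h hi
    obtain ⟨h1, h2⟩ := gap_one p hb hi g
    obtain ⟨h3, h4⟩ := ih (by positivity) h2
    constructor
    · rw [fl_cons, List.map_append, good_append]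
      exact ⟨h1, h3.mono (by linarith)⟩
    · rw [fl_cons, List.map_append, wp_append, ← mul_assoc, List.length_cons, pow_succ]
      convert h4 using 1; ring

theorem inv_start (hM : Big M) (p : Equiv.Perm (Fin 3)) : Inv hM (p 0) (p 1) (p 2) 1 (sr (p 2)) := by
  have h02 : p 2 ≠ p 0 := by simp
  have h12 : p 2 ≠ p 1 := by simp
  have key : ∀ l, hs hM (1 : M.Group) l = 1 := by
    intro l; simp [hs, ht, rt, al]
  have b1 := cc_ge hM h02
  have b2 := cc_ge hM h12
  have := sq3
  refine ⟨1, le_rfl, ?_, ?_, ?_⟩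
  · rw [← one_mul (sr _), hs_mul_self, key]
  · rw [← one_mul (sr _), hs_mul, key, key]; linarith
  · rw [← one_mul (sr _), hs_mul, key, key]; linarith

end Tri

namespace Tri
open CoxeterSystem
variable {M : CoxeterMatrix (Fin 3)}

theorem ht_sg_le {v : V} (h : IsPos v) (s : Fin 3) : ht (sg M s v) ≤ 3 * ht v := by
  rw [sg_apply, ht_add, ht_smul]
  have h1 : ht (al s) = 1 := by simp [ht, al]
  have h2 : ∑ l, cc M s l * v l ≤ 2 * ht v := by
    rw [ht, Finset.mul_sum]
    apply Finset.sum_le_sum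
    intro i _
    exact mul_le_mul_of_nonneg_right (cc_le s i) (h.nonneg i)
  rw [h1]; linarith

theorem hs_abs (hM : Big M) (h : M.Group) (l : Fin 3) : 1 ≤ |hs hM h l| := by
  by_cases hd : Desc h l
  · have := (rt_neg hM hd).ht_ge (neg_ne_zero.2 (rt_ne_zero hM h l))
    rw [ht_neg] at this
    unfold hs; rw [abs_of_nonpos] <;> linarith
  · have := (rt_pos' hM hd).ht_ge (rt_ne_zero hM h l)
    unfold hs; rw [abs_of_nonneg] <;> linarith

theorem rt_isPos (hM : Big M) {h : M.Group} {l : Fin 3} (h0 : 0 < hs hM h l) : IsPos (rt hM h l) := by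
  apply rt_pos' hM
  rw [desc_iff_ht hM]; unfold hs at h0; linarith

theorem rt_isNeg (hM : Big M) {h : M.Group} {l : Fin 3} (h0 : hs hM h l < 0) : IsPos (- rt hM h l) := by
  apply rt_neg hM
  rwa [desc_iff_ht hM]

/-- a positive root other than `α_s` stays positive under `s` -/
theorem sr_keeps_pos (hM : Big M) {h : M.Group} {l s : Fin 3} (h0 : 1 < hs hM h l) :
    0 < hs hM (sr s * h) l := by
  by_contra hc
  have h1 : hs hM (sr s * h) l < 0 := by
    have := hs_abs hM (sr s * h) l
    rcases (abs_cases (hs hM (sr s * h) l)) with h | h <;> linarith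
  have hp := rt_isPos hM (show 0 < hs hM h l by linarith)
  have hn := rt_isNeg hM h1
  rw [rt_mul, rep_sr] at hn
  have hz : ∀ m, m ≠ s → rt hM h l m = 0 := by
    intro m hm
    have := hn.nonneg m
    rw [Pi.neg_apply, sg_ne M hm] at this
    have := hp.nonneg m
    linarith
  set c := rt hM h l s with hcdef
  have hv : rt hM h l = c • al s := by
    funext m
    by_cases hm : m = s
    · subst hm; simp [hcdef]
    · simp [hz m hm, al_ne hm]
  have hc1 : 1 < c := by
    have : hs hM h l = c := by unfold hs; rw [hv, ht_smul]; simp [ht, al]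
    linarith
  have h2 : al l = c • rt hM h⁻¹ s := by
    rw [rt, ← map_smul, ← hv, rt, ← Module.End.mul_apply, ← map_mul]; simp
  have h3 : hs hM h⁻¹ s * c = 1 := by
    have : ht (al l) = 1 := by simp [ht, al]
    rw [h2, ht_smul] at this
    unfold hs; linarith
  have h4 := hs_abs hM h⁻¹ s
  have h5 : 0 < hs hM h⁻¹ s := by
    by_contra h6; nlinarith
  rw [abs_of_pos h5] at h4
  nlinarith

theorem far_pos (hM : Big M) (g : M.Group) : ∃ K : ℝ, 1 ≤ K ∧ ∀ (h : M.Group) (l : Fin 3),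
    K < hs hM h l → 0 < hs hM (g * h) l := by
  induction g using M.toCoxeterSystem.simple_induction_right with
  | one => exact ⟨1, le_rfl, fun h l hl => by rw [one_mul]; linarith⟩
  | mul_simple_right g s ih =>
    obtain ⟨K, hK, ih⟩ := ih
    refine ⟨3 * K, by linarith, fun h l hl => ?_⟩
    change 0 < hs hM (g * sr s * h) l
    rw [mul_assoc]
    apply ih
    have h1 := sr_keeps_pos hM (s := s) (show 1 < hs hM h l by linarith)
    have h2 := ht_sg_le (M := M) (rt_isPos hM h1) s
    rw [rt_mul, ← Module.End.mul_apply, rep_sr, sg_sq, Module.End.one_apply] at h2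
    unfold hs at hl ⊢
    rw [rt_mul, rep_sr]
    linarith

theorem far_neg (hM : Big M) (g : M.Group) : ∃ K : ℝ, 1 ≤ K ∧ ∀ (h : M.Group) (l : Fin 3),
    (K < hs hM h l → 0 < hs hM (g * h) l) ∧ (hs hM h l < - K → hs hM (g * h) l < 0) := by
  obtain ⟨K, hK, h1⟩ := far_pos hM g
  refine ⟨K, hK, fun h l => ⟨h1 h l, fun h2 => ?_⟩⟩
  have := h1 (h * sr l) l (by rw [hs_mul_self]; linarith)
  rw [← mul_assoc, hs_mul_self] at this
  linarith

/-- unique descents -/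
def UD : M.Group → List (Fin 3) → Prop
  | _, [] => True
  | h, l :: u => (∀ m, Desc (h * sr l) m ↔ m = l) ∧ UD (h * sr l) u

theorem ud_append : ∀ {h : M.Group} {u v : List (Fin 3)},
    UD h (u ++ v) ↔ UD h u ∧ UD (h * wp u) v
  | h, [], v => by simp [UD]
  | h, l :: u, v => by
    simp only [List.cons_append, UD, wp_cons, ← mul_assoc, ud_append (u := u)]
    tauto

theorem Good.ud {hM : Big M} {g : M.Group} {K : ℝ} (hK : ∀ (h : M.Group) (l : Fin 3),
    (K < hs hM h l → 0 < hs hM (g * h) l) ∧ (hs hM h l < - K → hs hM (g * h) l < 0)) {b : ℝ}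
    (hb : K < b) : ∀ {h : M.Group} {u : List (Fin 3)}, Good hM b h u → UD (g * h) u
  | _, [], _ => trivial
  | h, l :: u, ⟨⟨h1, h2⟩, h3⟩ => by
    refine ⟨fun m => ?_, ?_⟩
    · rw [mul_assoc, desc_iff_ht hM]
      constructor
      · intro h4
        by_contra hm
        have := (hK _ _).1 (hb.trans_le (h2 m hm))
        unfold hs at this; linarith
      · rintro rfl
        exact (hK (h * sr m) m).2 (by linarith)
    · rw [mul_assoc]; exact h3.ud hK hb

/-- reduced words -/
def Red (M : CoxeterMatrix (Fin 3)) (U : List (Fin 3)) : Prop := len (wp (M := M) U) = U.length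

theorem exists_red (h : M.Group) : ∃ U, Red M U ∧ wp U = h := by
  obtain ⟨U, h1, h2⟩ := M.toCoxeterSystem.exists_isReduced h
  exact ⟨U, h1, h2.symm⟩

theorem Red.append_left {U V : List (Fin 3)} (h : Red M (U ++ V)) : Red M U := by
  have h1 := len_wp_le (M := M) U
  have h2 := len_wp_le (M := M) V
  have h3 : len (wp U * wp V : M.Group) ≤ len (wp U) + len (wp V) :=
    M.toCoxeterSystem.length_mul_le (wp U) (wp V)
  unfold Red at *
  rw [wp_append, List.length_append] at h
  omega

theorem UD.suffix {h : M.Group} {u : List (Fin 3)} : UD h u → ∀ {U : List (Fin 3)}, Red M U →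
    wp U = h * wp u → ∃ U', U = U' ++ u ∧ wp U' = h := by
  induction u using List.reverseRecOn with
  | nil => intro _ U _ h2; exact ⟨U, by simp, by simpa using h2⟩
  | append_singleton u l ih =>
    intro hu U hU h2
    rw [ud_append] at hu
    have hd := hu.2.1
    rw [wp_append, ← mul_assoc] at h2
    simp only [wp_cons, wp_nil, mul_one] at h2
    rw [← h2] at hd
    have hne : U ≠ [] := by
      rintro rfl
      have h5 := (hd l).2 rfl
      unfold Desc at h5
      have h6 : len (1 : M.Group) = 0 := M.toCoxeterSystem.length_one
      rw [wp_nil, h6] at h5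
      omega
    obtain ⟨U', m, rfl⟩ := List.eq_nil_or_concat'  U |>.resolve_left hne
    have hm : m = l := by
      rw [← hd]
      unfold Desc
      have h5 : wp (U' ++ [m]) * sr m = (wp U' : M.Group) := by simp [wp_append]
      have h6 := hU
      unfold Red at h6
      rw [h5, h6]
      have := len_wp_le (M := M) U'
      simp; omega
    subst hm
    have h3 : wp U' = h * wp u := by
      have : wp (U' ++ [m]) * sr m = (wp U' : M.Group) := by simp [wp_append]
      rw [← this, h2, mul_sr_cancel]
    obtain ⟨U'', rfl, h4⟩ := ih hu.1 hU.append_left h3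
    exact ⟨U'', by simp, h4⟩

theorem ud_one (hM : Big M) {b : ℝ} (hb : 0 < b) {h : M.Group} {u : List (Fin 3)} (hg : Good hM b h u) :
    UD h u := by
  have := hg.ud (g := 1) (K := 0) (fun h l => by simp) hb
  simpa using this

theorem ud_start (hM : Big M) (p : Equiv.Perm (Fin 3)) (G : List Gap) :
    UD (M := M) (sr (p 2)) ((fl G).map p) :=
  ud_one hM (by norm_num) (gap_list p G one_pos (inv_start hM p)).1

theorem length_fl (G : List Gap) : G.length ≤ (fl G).length ∧ (fl G).length ≤ 6 * G.length := by
  induction G with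
  | nil => simp
  | cons g G ih =>
    rw [fl_cons, List.length_append, List.length_cons]
    cases g <;> simp [Gap.w, Gap.u] <;> omega

theorem wp_fl_ne_one (hM : Big M) (p : Equiv.Perm (Fin 3)) {G : List Gap} (hG : G ≠ []) :
    wp (M := M) ((fl G).map p) ≠ 1 := by
  intro h
  have h1 := ud_start hM p G
  have hr : Red M [p 2] := by
    have : len (sr (p 2) : M.Group) = 1 := M.toCoxeterSystem.length_simple (p 2)
    simp [Red, this]
  obtain ⟨U', h2, h3⟩ := h1.suffix hr (by simp [h])
  have h4 := (length_fl G).1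
  have h5 : 0 < G.length := List.length_pos_iff.2 hG
  have h6 := congrArg List.length h2
  simp at h6
  have h7 : U' = [] := List.length_eq_zero_iff.1 (by omega)
  subst h7
  have h8 : len (sr (p 2) : M.Group) = 1 := M.toCoxeterSystem.length_simple (p 2)
  have h9 : len (1 : M.Group) = 0 := M.toCoxeterSystem.length_one
  rw [← h3, wp_nil, h9] at h8
  omega

theorem rightE (hM : Big M) (p : Equiv.Perm (Fin 3)) (g : M.Group) : ∃ k0 : ℕ, ∀ G0 G1 : List Gap,
    k0 ≤ G0.length → UD (g * wp ((fl G0).map p)) ((fl G1).map p) := by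
  obtain ⟨K, hK, h1⟩ := far_neg hM (g * sr (p 2))
  obtain ⟨k, hk⟩ := pow_unbounded_of_one_lt (2 * K) (by norm_num : (1:ℝ) < 2)
  refine ⟨k, fun G0 G1 h0 => ?_⟩
  have h2 := (gap_list p G0 one_pos (inv_start hM p)).2
  have h3 := (gap_list p G1 (by positivity) h2).1
  have h4 : (2:ℝ) ^ k ≤ 2 ^ G0.length := pow_le_pow_right₀ (by norm_num) h0
  have h5 := h3.ud h1 (by linarith)
  rwa [← mul_assoc, mul_sr_cancel] at h5

/-- reversal of gaps -/
def Gap.rev : Gap → Gap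
  | .X => .X
  | .Y => .Y
  | .J => .K
  | .K => .J

/-- reversal of gap lists -/
def gr (G : List Gap) : List Gap := (G.map Gap.rev).reverse

theorem fl_gr (G : List Gap) : 2 :: fl (gr G) = (fl G).reverse ++ [2] := by
  induction G with
  | nil => simp [gr]
  | cons g G ih =>
    have : gr (g :: G) = gr G ++ [g.rev] := by simp [gr]
    rw [this, fl_append, ← List.cons_append, ih, fl_cons g G, List.reverse_append, List.append_assoc, List.append_assoc]
    congr 1
    cases g <;> simp [Gap.w, Gap.u, Gap.rev]

theorem wp_reverse (u : List (Fin 3)) : wp (M := M) u.reverse = (wp u)⁻¹ :=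
  M.toCoxeterSystem.wordProd_reverse u

theorem leftE (hM : Big M) (g : M.Group) : ∃ k0 : ℕ, ∀ G2 G3 : List Gap,
    k0 ≤ G3.length → ∀ {U : List (Fin 3)}, Red M U → wp U = wp (fl (G2 ++ G3)) * g →
    ∃ B, U = (fl G2).dropLast ++ B := by
  obtain ⟨k0, h0⟩ := rightE hM 1 (g⁻¹ * sr 2)
  refine ⟨k0, fun G2 G3 h3 U hU h4 => ?_⟩
  rcases List.eq_nil_or_concat' G2 with rfl | ⟨G2', x, rfl⟩
  · exact ⟨U, by simp⟩
  have h1 := h0 (gr G3) (gr (G2' ++ [x])) (by simpa [gr] using h3)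
  simp only [Equiv.Perm.coe_one, List.map_id] at h1
  have hrev : fl (gr (G2' ++ [x])) = ((fl (G2' ++ [x])).dropLast).reverse ++ [2] := by
    have h5 := fl_gr (G2' ++ [x])
    have h6 : fl (G2' ++ [x]) = (fl (G2' ++ [x])).dropLast ++ [2] := by
      rw [fl_append, fl_cons, Gap.w]
      simp
    rw [h6, List.reverse_append] at h5
    simpa using h5
  rw [hrev, ud_append] at h1
  have hUr : Red M U.reverse := by
    unfold Red
    have : len (wp U : M.Group)⁻¹ = len (wp U) := M.toCoxeterSystem.length_inv (wp U)
    rw [wp_reverse, this, List.length_reverse]; exact hU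
  obtain ⟨U', h7, -⟩ := h1.1.suffix hUr (by
    have h6 : fl (G2' ++ [x]) = (fl (G2' ++ [x])).dropLast ++ [2] := by
      rw [fl_append, fl_cons, Gap.w]
      simp
    have h8 := congrArg (wp (M := M)) (fl_gr G3)
    rw [wp_cons, wp_append, wp_reverse] at h8
    rw [wp_reverse, h4, fl_append]
    nth_rewrite 1 [h6]
    rw [wp_append, wp_append, wp_reverse, mul_assoc g⁻¹, h8]
    simp [mul_assoc])
  exact ⟨U'.reverse, by simpa using congrArg List.reverse h7⟩

/-! ### codes -/

theorem codeA {α ι : Type*} (u : ι → List α) (τ : α) (hτ : ∀ i, τ ∉ u i) (L : List ι) :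
    ∀ {A R : List α}, A ++ τ :: R = L.flatMap (fun i => u i ++ [τ]) →
    ∃ P S, L = P ++ S ∧ P.flatMap (fun i => u i ++ [τ]) = A ++ [τ] ∧
      S.flatMap (fun i => u i ++ [τ]) = R := by
  induction L with
  | nil => intro A R h; simp at h
  | cons i L ih =>
    intro A R h
    rw [List.flatMap_cons, List.append_assoc, List.singleton_append, List.append_eq_append_iff] at h
    rcases h with ⟨a', h1, h2⟩ | ⟨c', h1, h2⟩
    · rcases a' with _ | ⟨x, a'⟩
      · simp only [List.nil_append, List.cons.injEq, true_and] at h2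
        exact ⟨[i], L, rfl, by simp [h1], h2.symm⟩
      · simp only [List.cons_append, List.cons.injEq] at h2
        exfalso; apply hτ i; rw [h1, h2.1]; simp
    · rcases c' with _ | ⟨x, c'⟩
      · simp only [List.nil_append, List.cons.injEq, true_and] at h2
        exact ⟨[i], L, rfl, by simp [h1], h2⟩
      · simp only [List.cons_append, List.cons.injEq] at h2
        obtain ⟨P, S, e1, e2, e3⟩ := ih h2.2.symm
        refine ⟨i :: P, S, by simp [e1], ?_, e3⟩
        rw [List.flatMap_cons, e2, h1, ← h2.1]; simp

theorem codeB {α ι : Type*} (u : ι → List α) (τ : α) (hτ : ∀ i, τ ∉ u i) (hu : Function.Injective u)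
    (L1 : List ι) : ∀ {L2 : List ι} {R : List α},
    L1.flatMap (fun i => u i ++ [τ]) ++ R = L2.flatMap (fun i => u i ++ [τ]) →
    ∃ S, L2 = L1 ++ S ∧ S.flatMap (fun i => u i ++ [τ]) = R := by
  induction L1 with
  | nil => intro L2 R h; exact ⟨L2, rfl, by simpa using h.symm⟩
  | cons i L1 ih =>
    intro L2 R h
    rcases L2 with _ | ⟨j, L2⟩
    · simp at h
    rw [List.flatMap_cons, List.flatMap_cons, List.append_assoc, List.append_assoc, List.append_assoc,
      List.singleton_append, List.singleton_append, List.append_eq_append_iff] at h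
    have key : u i = u j ∧ L1.flatMap (fun i => u i ++ [τ]) ++ R = L2.flatMap (fun i => u i ++ [τ]) := by
      rcases h with ⟨a', h1, h2⟩ | ⟨a', h1, h2⟩
      · rcases a' with _ | ⟨x, a'⟩
        · simp at h2; exact ⟨by simp [h1], h2⟩
        · simp only [List.cons_append, List.cons.injEq] at h2
          exfalso; apply hτ j; rw [h1, h2.1]; simp
      · rcases a' with _ | ⟨x, a'⟩
        · simp at h2; exact ⟨by simp [h1], h2.symm⟩
        · simp only [List.cons_append, List.cons.injEq] at h2
          exfalso; apply hτ i; rw [h1, h2.1]; simp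
    obtain ⟨S, e1, e2⟩ := ih key.2
    exact ⟨S, by rw [hu key.1, e1]; rfl, e2⟩

end Tri

namespace Tri
open CoxeterSystem
variable {M : CoxeterMatrix (Fin 3)}

theorem alt5_window : ∀ g g2 g3 : Gap, ∀ k : Fin 7, ∀ a b : Fin 3, a ≠ b →
    [b, a, b, a, b] = ((g.w.drop k) ++ (g2.w ++ g3.w)).take 5 → a = 0 ∧ b = 1 := by
  intro g g2 g3
  cases g <;> cases g2 <;> cases g3 <;> decide

theorem alt5_aux {a b : Fin 3} (hab : a ≠ b) (G : List Gap) : ∀ {A R : List (Fin 3)},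
    A ++ ([b, a, b, a, b] ++ R) = fl (G ++ [.X, .X]) → a = 0 ∧ b = 1 := by
  induction G with
  | nil =>
    intro A R h
    have h1 : ∀ a b : Fin 3, a ≠ b → ¬ ([b, a, b, a, b] <:+: fl [.X, .X]) := by decide
    exact absurd ⟨A, R, by simpa using h⟩ (h1 a b hab)
  | cons g G ih =>
    intro A R h
    obtain ⟨g2, g3, G', hG⟩ : ∃ g2 g3 G', G ++ [Gap.X, Gap.X] = g2 :: g3 :: G' := by
      rcases G with _ | ⟨x, _ | ⟨y, G⟩⟩
      · exact ⟨_, _, _, rfl⟩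
      · exact ⟨_, _, _, rfl⟩
      · exact ⟨_, _, _, rfl⟩
    rw [List.cons_append (a := g), fl_cons, List.append_eq_append_iff] at h
    rcases h with ⟨a', h1, h2⟩ | ⟨c', h1, h2⟩
    · have hk : A.length < 7 := by
        have : g.w.length ≤ 6 := by cases g <;> simp [Gap.w, Gap.u]
        rw [h1] at this
        simp at this; omega
      have ha : a' = g.w.drop A.length := by rw [h1]; simp
      apply alt5_window g g2 g3 ⟨A.length, hk⟩ a b hab
      have h3 : ([b, a, b, a, b] ++ R).take 5 = [b, a, b, a, b] := rfl
      rw [← h3, h2, hG, fl_cons, fl_cons, ← ha, ← List.append_assoc g2.w, ← List.append_assoc a',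
        List.take_append_of_le_length]
      cases g2 <;> cases g3 <;> simp [Gap.w, Gap.u]
    · exact ih h2.symm

theorem alt5 {a b : Fin 3} (hab : a ≠ b) (G : List Gap) {A R : List (Fin 3)}
    (h : A ++ ([b, a, b, a, b] ++ R) = fl G) : a = 0 ∧ b = 1 := by
  apply alt5_aux hab G (A := A) (R := R ++ fl [.X, .X])
  rw [fl_append, ← h]; simp

/-- powers of lists -/
def pw {α : Type*} (n : ℕ) (W : List α) : List α := (List.replicate n W).flatten

theorem pw_succ {α : Type*} (n : ℕ) (W : List α) : pw (n + 1) W = W ++ pw n W := by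
  simp [pw, List.replicate_succ]

@[simp] theorem pw_zero {α : Type*} (W : List α) : pw 0 W = [] := rfl

@[simp] theorem pw_one {α : Type*} (W : List α) : pw 1 W = W := by simp [pw]

theorem pw_add {α : Type*} (m n : ℕ) (W : List α) : pw (m + n) W = pw m W ++ pw n W := by
  unfold pw; rw [List.replicate_add, List.flatten_append]

@[simp] theorem length_pw {α : Type*} (n : ℕ) (W : List α) : (pw n W).length = n * W.length := by
  simp [pw]

theorem wp_pw (p : Fin 3 → Fin 3) (n : ℕ) (W : List Gap) :
    wp (M := M) ((fl (pw n W)).map p) = wp ((fl W).map p) ^ n := by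
  induction n with
  | zero => simp
  | succ n ih => rw [pw_succ, fl_append, List.map_append, wp_append, ih, pow_succ']

theorem gap_u_inj : Function.Injective Gap.u := by
  intro g h; cases g <;> cases h <;> simp [Gap.u]

theorem gap_u_two (g : Gap) : (2 : Fin 3) ∉ g.u := by cases g <;> simp [Gap.u]

theorem fl_eq (G : List Gap) : fl G = G.flatMap (fun i => i.u ++ [2]) := rfl

theorem rigidity (hM : Big M) (p : Equiv.Perm (Fin 3)) (g : M.Group) (W1 W2 : List Gap)
    (hY : Gap.Y ∈ W1) (hW2 : W2 ≠ []) (hg : g * wp ((fl W1).map p) = wp (fl W2) * g) :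
    p = 1 ∧ ∃ n q P R x W', W1 = W' ++ [x] ∧ pw n W2 = P ++ [x] ++ W1 ++ R ∧
      g * wp (fl W1) ^ q = wp (fl (P ++ [x])) := by
  obtain ⟨k0, hk0⟩ := rightE hM p g
  obtain ⟨k1, hk1⟩ := leftE hM g
  have hW1 : 1 ≤ W1.length := List.length_pos_iff.2 (List.ne_nil_of_mem hY)
  have hW2' : 1 ≤ W2.length := List.length_pos_iff.2 hW2
  -- parameters
  set q := k0 + 2 with hq
  set a := len g + 6 * k0 with ha
  set b := 6 * k1 + 1 + len g with hb
  set n := q + 1 + b + k1 with hn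
  -- first decomposition
  set G0 := (pw q W1).take k0 with hG0
  set D := (pw q W1).drop k0 with hD
  have hlq : q ≤ (pw q W1).length := by rw [length_pw]; nlinarith
  have hG0l : G0.length = k0 := by rw [hG0, List.length_take]; omega
  have hDl : 2 ≤ D.length := by rw [hD, List.length_drop]; omega
  have hGD : pw q W1 = G0 ++ D := (List.take_append_drop _ _).symm
  set E := pw (b + k1) W1 with hE
  have hEl : b ≤ E.length := by rw [hE, length_pw]; nlinarith
  have dec1 : pw n W1 = G0 ++ (D ++ (W1 ++ E)) := by
    rw [hn, show q + 1 + b + k1 = q + (1 + (b + k1)) by ring, pw_add, hGD, pw_add, pw_one,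
      List.append_assoc]
  -- second decomposition
  set N2 := (pw n W2).length - k1 with hN2
  set G2 := (pw n W2).take N2 with hG2
  set G3 := (pw n W2).drop N2 with hG3
  have hln : n ≤ (pw n W2).length := by rw [length_pw]; nlinarith
  have hG3l : G3.length = k1 := by rw [hG3, List.length_drop]; omega
  have dec2 : pw n W2 = G2 ++ G3 := (List.take_append_drop _ _).symm
  have hG2ne : G2 ≠ [] := by
    apply List.length_pos_iff.1
    rw [hG2, List.length_take]; omega
  obtain ⟨G2', y, hG2'⟩ := (List.eq_nil_or_concat' G2).resolve_left hG2ne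
  have hlast : fl G2 = (fl G2).dropLast ++ [2] := by
    rw [hG2', fl_append, fl_cons, Gap.w]; simp
  -- the element
  have hpow : g * wp ((fl (pw n W1)).map p) = wp (fl (pw n W2)) * g := by
    have h1 := wp_pw (M := M) id n W2
    simp only [List.map_id] at h1
    rw [wp_pw, h1]
    have : SemiconjBy g (wp ((fl W1).map p)) (wp (fl W2)) := hg
    exact (this.pow_right n)
  obtain ⟨U, hU, hUe⟩ := exists_red (g * wp ((fl (pw n W1)).map p))
  have ud := hk0 G0 (D ++ (W1 ++ E)) hG0l.ge
  obtain ⟨A, hA, hA2⟩ := ud.suffix hU (by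
    rw [hUe, dec1, fl_append, List.map_append, wp_append, mul_assoc])
  obtain ⟨B, hB⟩ := hk1 G2 G3 hG3l.ge hU (by rw [hUe, hpow, dec2])
  -- lengths
  have hUlen : U.length ≤ (fl G2).length + 6 * k1 + len g := by
    have h1 : wp U = wp (fl (G2 ++ G3)) * g := by rw [hUe, hpow, dec2]
    have h2 : len (wp (fl (G2 ++ G3)) * g : M.Group) ≤ len (wp (fl (G2 ++ G3))) + len g :=
      M.toCoxeterSystem.length_mul_le _ _
    have h3 := len_wp_le (M := M) (fl (G2 ++ G3))
    have h4 := (length_fl G3).2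
    have h5 := hU
    unfold Red at h5
    rw [h1] at h5
    rw [fl_append, List.length_append] at h3
    rw [fl_append] at h2 h5
    omega
  have hBl : B.length ≤ b := by
    have h1 := congrArg List.length hB
    have h2 := congrArg List.length hlast
    simp only [List.length_append, List.length_singleton] at h1 h2
    omega
  -- match
  have hEl2 : b ≤ ((fl E).map p).length := by
    have := (length_fl E).1
    rw [List.length_map]; omega
  obtain ⟨C, hC⟩ : ∃ C, (fl G2).dropLast = A ++ ((fl (D ++ W1)).map p ++ C) := by
    rw [hA] at hB
    rw [← List.append_assoc D, fl_append _ E, List.map_append, ← List.append_assoc] at hB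
    rw [List.append_eq_append_iff] at hB
    rcases hB with ⟨a', h1, h2⟩ | ⟨c', h1, h2⟩
    · exact ⟨a', by rw [h1, List.append_assoc]⟩
    · have h3 := congrArg List.length h2
      simp only [List.length_append] at h3
      have : c' = [] := List.length_eq_zero_iff.1 (by omega)
      exact ⟨[], by rw [this] at h1; simpa using h1.symm⟩
  -- the permutation is trivial
  have hp : p = 1 := by
    obtain ⟨Wa, Wb, hWab⟩ := List.append_of_mem hY
    have h1 : p 0 = 0 ∧ p 1 = 1 := by
      apply alt5 (a := p 0) (b := p 1) (by simp) G2
        (A := A ++ (fl (D ++ Wa)).map p) (R := [p 2] ++ ((fl Wb).map p ++ (C ++ [2])))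
      rw [hlast, hC, hWab]
      simp [fl_append, Gap.w, Gap.u]
    ext i
    have h2 : p 2 = 2 := by
      have e1 : p 2 ≠ p 0 := by simp
      have e2 : p 2 ≠ p 1 := by simp
      rw [h1.1] at e1; rw [h1.2] at e2
      generalize p 2 = v at *
      revert v; decide
    fin_cases i <;> simp [h1.1, h1.2, h2]
  refine ⟨hp, ?_⟩
  subst hp
  simp only [Equiv.Perm.coe_one, List.map_id] at *
  -- last gaps
  obtain ⟨W', x, hW'⟩ := (List.eq_nil_or_concat' W1).resolve_left (List.ne_nil_of_mem hY)
  obtain ⟨D', x', hD'⟩ := (List.eq_nil_or_concat' D).resolve_left (by rintro h; rw [h] at hDl; simp at hDl)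
  have hxx : x' = x := by
    have h1 : pw q W1 = pw (k0 + 1) W1 ++ W' ++ [x] := by
      rw [hq, show k0 + 2 = k0 + 1 + 1 by ring, pw_add, pw_one, List.append_assoc, ← hW']
    rw [hGD, hD', ← List.append_assoc] at h1
    have := congrArg List.getLast? h1
    simpa using this
  subst hxx
  obtain ⟨D'', y', hD''⟩ := (List.eq_nil_or_concat' D').resolve_left (by
    rintro h; rw [hD', h] at hDl; simp at hDl)
  have full : fl (pw n W2) = (A ++ fl D') ++ (fl ([x'] ++ W1) ++ (C ++ [2] ++ fl G3)) := by
    rw [dec2, fl_append, hlast, hC, hD']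
    simp [fl_append]
  have hend : A ++ fl D' = (A ++ fl D'' ++ y'.u) ++ [2] := by
    rw [hD'', fl_append, fl_cons, Gap.w]; simp
  obtain ⟨P, S, e1, e2, e3⟩ := codeA Gap.u 2 gap_u_two (pw n W2)
    (A := A ++ fl D'' ++ y'.u) (R := fl ([x'] ++ W1) ++ (C ++ [2] ++ fl G3)) (by
      rw [← fl_eq, full, hend]; simp)
  obtain ⟨S', e4, e5⟩ := codeB Gap.u 2 gap_u_two gap_u_inj ([x'] ++ W1) (L2 := S)
    (R := C ++ [2] ++ fl G3) (by rw [e3]; rfl)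
  refine ⟨n, q, P, S', x', W', hW', ?_, ?_⟩
  · rw [e1, e4]; simp
  · rw [← fl_eq, ← hend] at e2
    have h1 := wp_pw (M := M) id q W1
    simp only [List.map_id] at h1
    rw [← h1, hGD, fl_append, wp_append, ← mul_assoc, ← hA2, hD', fl_append, wp_append,
      fl_append, wp_append, e2, wp_append, mul_assoc]

end Tri

namespace Tri
open CoxeterSystem
variable {M : CoxeterMatrix (Fin 3)}

/-- tokens: `pl n = Yⁿ X`, `kl = J Y^{ρ-1} X`, `kr = Y^{ρ-1} J' X`, where `ρ = d + 8` -/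
inductive Tok | pl (n : ℕ) | kl | kr
  deriving DecidableEq

/-- token words without terminator -/
def Tok.u (d : ℕ) : Tok → List Gap
  | .pl n => List.replicate n .Y
  | .kl => .J :: List.replicate (d + 7) .Y
  | .kr => List.replicate (d + 7) .Y ++ [.K]

/-- gap lists of token lists -/
def gf (d : ℕ) (T : List Tok) : List Gap := T.flatMap (fun i => i.u d ++ [.X])

theorem gf_append (d : ℕ) (S T : List Tok) : gf d (S ++ T) = gf d S ++ gf d T := by simp [gf]
theorem gf_cons (d : ℕ) (a : Tok) (T : List Tok) : gf d (a :: T) = (a.u d ++ [.X]) ++ gf d T := by simp [gf]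
@[simp] theorem gf_nil (d : ℕ) : gf d [] = [] := rfl

theorem tok_X (d : ℕ) (a : Tok) : Gap.X ∉ a.u d := by
  cases a <;> simp [Tok.u, List.mem_replicate]

theorem tok_inj (d : ℕ) : Function.Injective (Tok.u d) := by
  intro a b h
  rcases a with n | _ | _ <;> rcases b with m | _ | _
  · have := congrArg List.length h
    simp [Tok.u] at this
    rw [this]
  · exfalso
    have : Gap.J ∈ Tok.u d (.pl n) := by rw [h]; simp [Tok.u]
    simp [Tok.u, List.mem_replicate] at this
  · exfalso
    have : Gap.K ∈ Tok.u d (.pl n) := by rw [h]; simp [Tok.u]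
    simp [Tok.u, List.mem_replicate] at this
  · exfalso
    have : Gap.J ∈ Tok.u d (.pl m) := by rw [← h]; simp [Tok.u]
    simp [Tok.u, List.mem_replicate] at this
  · rfl
  · exfalso
    have : Gap.J ∈ Tok.u d .kr := by rw [← h]; simp [Tok.u]
    simp [Tok.u, List.mem_replicate] at this
  · exfalso
    have : Gap.K ∈ Tok.u d (.pl m) := by rw [← h]; simp [Tok.u]
    simp [Tok.u, List.mem_replicate] at this
  · exfalso
    have : Gap.J ∈ Tok.u d .kr := by rw [h]; simp [Tok.u]
    simp [Tok.u, List.mem_replicate] at this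
  · rfl

/-- evaluation of gap lists -/
def ev (G : List Gap) : M.Group := wp (fl G)

theorem ev_append (G H : List Gap) : (ev (G ++ H) : M.Group) = ev G * ev H := by
  unfold ev; rw [fl_append, wp_append]
@[simp] theorem ev_nil : (ev [] : M.Group) = 1 := rfl
theorem ev_cons (g : Gap) (H : List Gap) : (ev (g :: H) : M.Group) = ev [g] * ev H := by
  rw [← ev_append]; rfl

theorem ev_replicate (g : Gap) (n : ℕ) : (ev (List.replicate n g) : M.Group) = ev [g] ^ n := by
  induction n with
  | zero => simp
  | succ n ih => rw [List.replicate_succ, ev_cons, ih, pow_succ']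

/-- evaluation of token lists -/
def et (d : ℕ) (T : List Tok) : M.Group := ev (gf d T)

theorem et_append (d : ℕ) (G H : List Tok) : (et d (G ++ H) : M.Group) = et d G * et d H := by
  unfold et; rw [gf_append, ev_append]
@[simp] theorem et_nil (d : ℕ) : (et d [] : M.Group) = 1 := rfl

theorem ev_gr (G : List Gap) : (ev (gr G) : M.Group) = sr 2 * (ev G)⁻¹ * sr 2 := by
  have h8 := congrArg (wp (M := M)) (fl_gr G)
  rw [wp_cons, wp_append, wp_reverse] at h8
  unfold ev
  rw [mul_assoc, show (wp (fl G) : M.Group)⁻¹ * sr 2 = (wp (fl G))⁻¹ * wp [2] by simp, ← h8]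
  simp

/-- shorthand -/
abbrev eX : M.Group := ev [.X]
/-- shorthand -/
abbrev eY : M.Group := ev [.Y]

theorem t_eX : (sr 2 * eX : M.Group) = eX⁻¹ * sr 2 := by
  have := ev_gr (M := M) [.X]
  simp only [gr, Gap.rev, List.map_cons, List.map_nil, List.reverse_singleton] at this
  unfold eX
  nth_rewrite 1 [this]
  simp [mul_assoc]

theorem t_eY : (sr 2 * eY : M.Group) = eY⁻¹ * sr 2 := by
  have := ev_gr (M := M) [.Y]
  simp only [gr, Gap.rev, List.map_cons, List.map_nil, List.reverse_singleton] at this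
  unfold eY
  nth_rewrite 1 [this]
  simp [mul_assoc]

theorem XtY : (eX * sr 2 * eY : M.Group) = ev [.J] := by
  simp [eX, eY, ev, Gap.w, Gap.u, mul_assoc]

theorem YtX : (eY * sr 2 * eX : M.Group) = ev [.K] := by
  simp [eX, eY, ev, Gap.w, Gap.u, mul_assoc]

theorem t_powX (n : ℕ) : (sr 2 * eX ^ n : M.Group) = (eX ^ n)⁻¹ * sr 2 := by
  have : SemiconjBy (sr 2 : M.Group) eX eX⁻¹ := t_eX
  rw [← inv_pow]; exact this.pow_right n

theorem t_powY (n : ℕ) : (sr 2 * eY ^ n : M.Group) = (eY ^ n)⁻¹ * sr 2 := by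
  have : SemiconjBy (sr 2 : M.Group) eY eY⁻¹ := t_eY
  rw [← inv_pow]; exact this.pow_right n

theorem et_pl (d n : ℕ) : (et d [.pl n] : M.Group) = eY ^ n * eX := by
  simp [et, gf, Tok.u, ev_append, ev_replicate]

theorem et_kl (d : ℕ) : (eX * et d [.kl] : M.Group) = eX ^ 2 * sr 2 * eY ^ (d + 8) * eX := by
  have : (et d [.kl] : M.Group) = ev [.J] * eY ^ (d + 7) * eX := by
    simp [et, gf, Tok.u, ev_append, ev_replicate, ev_cons .J (List.replicate _ _ ++ _), mul_assoc]
  rw [this, ← XtY, pow_succ' eY (d + 7)]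
  simp only [pow_two, mul_assoc]

theorem et_kr (d : ℕ) : (et d [.kr] : M.Group) = eY ^ (d + 8) * sr 2 * eX ^ 2 := by
  have : (et d [.kr] : M.Group) = eY ^ (d + 7) * ev [.K] * eX := by
    simp [et, gf, Tok.u, ev_append, ev_replicate, ev_cons .K [.X], mul_assoc]
  rw [this, ← YtX, pow_succ eY (d + 7)]
  simp only [pow_two, mul_assoc]

theorem et_cons (d : ℕ) (a : Tok) (T : List Tok) : (et d (a :: T) : M.Group) = et d [a] * et d T := by
  rw [← et_append]; rfl

/-- lower exponents -/
def lo (d : ℕ) (i : Fin 2) : ℕ := if i = 0 then 3 else d + 11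
/-- higher exponents -/
def hi (d : ℕ) (i : Fin 2) : ℕ := lo d i + (d + 7)

/-- core tokens -/
def cr : ℕ → ℕ → List Tok
  | b, 0 => [.pl b]
  | b, k + 1 => .pl b :: .pl 0 :: .pl 0 :: cr (b + 1) k

/-- letters -/
abbrev Z := Fin 2 × Bool

/-- core of a letter -/
def core (d : ℕ) (z : Z) : List Tok :=
  if z.2 then cr (lo d z.1 + 1) (d + 5) else (cr (lo d z.1 + 1) (d + 5)).reverse

/-- connectors -/
def conn (d : ℕ) (z z' : Z) : List Tok :=
  if z.2 = z'.2 then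
    if z.2 then [.pl 0, .pl 0, .pl (hi d z.1), .pl 0, .pl 0, .pl (lo d z'.1), .pl 0, .pl 0]
    else [.pl 0, .pl 0, .pl (lo d z.1), .pl 0, .pl 0, .pl (hi d z'.1), .pl 0, .pl 0]
  else if z.1 = 0 then [.pl 0, .kl, .pl 0, .pl 0] else [.pl 0, .pl 0, .kr, .pl 0]

/-- left part -/
def Lz (d : ℕ) (z : Z) : M.Group :=
  if z.2 then eY ^ lo d z.1 * eX ^ 3 else (eX ^ 3)⁻¹ * sr 2 * eY ^ hi d z.1 * eX ^ 3
/-- right part -/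
def Rz (d : ℕ) (z : Z) : M.Group :=
  if z.2 then eX ^ 2 * eY ^ hi d z.1 * eX ^ 3 else eX ^ 2 * eY ^ lo d z.1 * sr 2

theorem conn_eval (d : ℕ) (z z' : Z) (h : z.1 = z'.1 → z.2 = z'.2) :
    (et d (conn d z z') : M.Group) = Rz d z * Lz d z' := by
  obtain ⟨i, e⟩ := z
  obtain ⟨i', e'⟩ := z'
  have hmix : ∀ a b : ℕ, (eY ^ a * sr 2 * eY ^ (a + b) : M.Group) = sr 2 * eY ^ b := by
    intro a b
    rw [pow_add, ← mul_assoc, mul_assoc (eY ^ a) (sr 2), t_powY]; simp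
  have hmix2 : ∀ a b : ℕ, (eY ^ (b + a) * sr 2 * eY ^ a : M.Group) = eY ^ b * sr 2 := by
    intro a b
    rw [pow_add, mul_assoc, t_powY]; simp [mul_assoc]
  have hX : (eX ^ 3 : M.Group) = eX * eX * eX := by rw [pow_succ, pow_two]
  have hXi : (sr 2 * (eX ^ 3)⁻¹ * sr 2 : M.Group) = eX ^ 3 := by
    rw [mul_assoc, ← t_powX]; simp
  by_cases hee : e = e'
  · subst hee
    cases e
    · simp only [conn, Lz, Rz, if_true, Bool.false_eq_true, if_false]
      rw [show (eX ^ 2 * eY ^ lo d i * sr 2 * ((eX ^ 3)⁻¹ * sr 2 * eY ^ hi d i' * eX ^ 3) : M.Group) =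
        eX ^ 2 * eY ^ lo d i * (sr 2 * (eX ^ 3)⁻¹ * sr 2) * eY ^ hi d i' * eX ^ 3 by
          simp only [mul_assoc], hXi]
      simp [et_cons d (.pl _) (_ :: _), et_pl, hX, pow_two, mul_assoc]
    · simp only [conn, Lz, Rz, if_true]
      simp [et_cons d (.pl _) (_ :: _), et_pl, hX, pow_two, mul_assoc]
  · have hii : i ≠ i' := fun h0 => hee (h h0)
    have hcases : (i = 0 ∧ i' = 1) ∨ (i = 1 ∧ i' = 0) := by
      clear h hee; revert i i'; decide
    have hab : (conn d (i, e) (i', e')) = if i = 0 then [.pl 0, .kl, .pl 0, .pl 0] else [.pl 0, .pl 0, .kr, .pl 0] := by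
      simp only [conn, hee, if_false]
    have hR : (Rz d (i, e) * Lz d (i', e') : M.Group) = eX ^ 2 * (eY ^ (if e then hi d i else lo d i) * sr 2 *
        eY ^ (if e then hi d i' else lo d i')) * eX ^ 3 := by
      cases e
      · have : e' = true := by simpa using hee
        subst this
        simp [Lz, Rz, mul_assoc]
      · have : e' = false := by simpa using hee
        subst this
        simp [Lz, Rz, mul_assoc]
    rw [hR, hab]
    rcases hcases with ⟨rfl, rfl⟩ | ⟨rfl, rfl⟩
    · have h1 : (if e then hi d 1 else lo d 1) = (if e then hi d 0 else lo d 0) + (d + 8) := by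
        cases e <;> simp [hi, lo] <;> omega
      rw [h1, hmix]
      simp only [if_true]
      rw [et_cons d (.pl 0), et_cons d .kl, et_pl, pow_zero, one_mul, ← mul_assoc, et_kl]
      simp [et_cons d (.pl _) (_ :: _), et_pl, hX, pow_two, mul_assoc]
    · have h1 : (if e then hi d 1 else lo d 1) = (d + 8) + (if e then hi d 0 else lo d 0) := by
        cases e <;> simp [hi, lo] <;> omega
      rw [h1, hmix2]
      rw [if_neg (by decide), et_cons d (.pl 0) [_, _, _], et_cons d (.pl 0) [_, _],
        et_cons d .kr, et_pl, et_kr]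
      simp [hX, pow_two, mul_assoc]

/-- The elements `x̂`, `ŷ`. -/
def hat (d : ℕ) (i : Fin 2) : M.Group :=
  ((List.range (d + 8)).map fun m => eY ^ (m + lo d i) * eX ^ 3).prod

theorem cr_eval (d k : ℕ) : ∀ b : ℕ, (((List.range (k + 1)).map fun m => eY ^ (m + b) * eX ^ 3).prod : M.Group) =
    et d (cr b k) * eX ^ 2 := by
  induction k with
  | zero => intro b; simp [cr, et_pl, pow_succ, mul_assoc]
  | succ k ih =>
    intro b
    rw [List.range_succ_eq_map, List.map_cons, List.map_map, List.prod_cons]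
    have h1 := ih (b + 1)
    have h2 : ((fun m => eY ^ (m + b) * eX ^ 3 : ℕ → M.Group) ∘ Nat.succ) = fun m => eY ^ (m + (b + 1)) * eX ^ 3 := by
      funext m; simp only [Function.comp]; rw [show m.succ + b = m + (b + 1) by omega]
    rw [h2, h1, cr, et_cons, et_cons d (.pl 0) (.pl 0 :: _), et_cons d (.pl 0) (cr _ _)]
    simp [et_pl, pow_succ, mul_assoc]

theorem hat_eq (d : ℕ) (i : Fin 2) : (hat d i : M.Group) = Lz d (i, true) * et d (core d (i, true)) * Rz d (i, true) := by
  unfold hat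
  rw [List.range_succ_eq_map, List.map_cons, List.map_map, List.prod_cons]
  have h2 : ((fun m => eY ^ (m + lo d i) * eX ^ 3 : ℕ → M.Group) ∘ Nat.succ) = fun m => eY ^ (m + (lo d i + 1)) * eX ^ 3 := by
    funext m; simp only [Function.comp]; rw [show m.succ + lo d i = m + (lo d i + 1) by omega]
  rw [h2, List.range_succ, List.map_append, List.prod_append, cr_eval d]
  have h3 : d + 6 + (lo d i + 1) = hi d i := by unfold hi; omega
  simp [Lz, Rz, core, h3, mul_assoc]

theorem cr_plain (k : ℕ) : ∀ b a, a ∈ cr b k → a = .pl 0 ∨ ∃ n, b ≤ n ∧ n ≤ b + k ∧ a = .pl n := by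
  induction k with
  | zero => intro b a h; simp [cr] at h; exact Or.inr ⟨b, le_rfl, by omega, h⟩
  | succ k ih =>
    intro b a h
    simp only [cr, List.mem_cons] at h
    rcases h with h | h | h | h
    · exact Or.inr ⟨b, le_rfl, by omega, h⟩
    · exact Or.inl h
    · exact Or.inl h
    · rcases ih _ _ h with h | ⟨n, h1, h2, h3⟩
      · exact Or.inl h
      · exact Or.inr ⟨n, by omega, by omega, h3⟩

theorem et_reverse (d : ℕ) (T : List Tok) (hT : ∀ a ∈ T, ∃ n, a = .pl n) :
    (eX * et d T.reverse : M.Group) = sr 2 * (et d T)⁻¹ * sr 2 * eX := by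
  induction T with
  | nil => simp
  | cons a T ih =>
    obtain ⟨n, rfl⟩ := hT a (by simp)
    have ih' := ih (fun a h => hT a (by simp [h]))
    rw [List.reverse_cons, et_append, ← mul_assoc, ih', et_cons d _ T, et_pl, mul_inv_rev, mul_inv_rev]
    have h1 : (sr 2 * eX * eY ^ n : M.Group) = eX⁻¹ * (eY ^ n)⁻¹ * sr 2 := by
      rw [t_eX, mul_assoc, t_powY, mul_assoc]
    calc (sr 2 * (et d T)⁻¹ * sr 2 * eX * (eY ^ n * eX) : M.Group) =
        sr 2 * (et d T)⁻¹ * (sr 2 * eX * eY ^ n) * eX := by simp only [mul_assoc]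
      _ = _ := by rw [h1]; simp only [mul_assoc]

/-- evaluation of letters -/
def zh (d : ℕ) (z : Z) : M.Group := if z.2 then hat d z.1 else (hat d z.1)⁻¹

theorem zh_eq (d : ℕ) (z : Z) : (zh d z : M.Group) = Lz d z * et d (core d z) * Rz d z := by
  obtain ⟨i, e⟩ := z
  cases e
  · have h0 : ∀ a ∈ cr (lo d i + 1) (d + 5), ∃ n, a = Tok.pl n := by
      intro a ha
      rcases cr_plain _ _ _ ha with h | ⟨n, -, -, h⟩
      · exact ⟨0, h⟩
      · exact ⟨n, h⟩
    have h1 := et_reverse (M := M) d _ h0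
    have h2 : (et d (core d (i, false)) : M.Group) =
        eX⁻¹ * (sr 2 * (et d (cr (lo d i + 1) (d + 5)))⁻¹ * sr 2 * eX) := by
      rw [← h1]; simp [core]
    rw [h2]
    simp only [zh, Bool.false_eq_true, if_false, hat_eq, Lz, Rz, core, if_true, mul_inv_rev]
    have e1 : ((eY ^ lo d i)⁻¹ : M.Group) = sr 2 * eY ^ lo d i * sr 2 := by rw [t_powY]; simp
    have e2 : ((eY ^ hi d i)⁻¹ : M.Group) = sr 2 * eY ^ hi d i * sr 2 := by rw [t_powY]; simp
    have e3 : ((eX ^ 2)⁻¹ : M.Group) = sr 2 * eX ^ 2 * sr 2 := by rw [t_powX]; simp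
    have e4 : ((eX ^ 3)⁻¹ : M.Group) = sr 2 * eX ^ 3 * sr 2 := by rw [t_powX]; simp
    have e5 : (eX ⁻¹ : M.Group) = sr 2 * eX * sr 2 := by rw [t_eX]; simp
    rw [e1, e2, e3, e4, e5]
    simp only [mul_assoc, sr_mul_cancel]
    have f1 : ∀ u : M.Group, eX ^ 3 * (sr 2 * (eX * u)) = eX ^ 2 * (sr 2 * u) := by
      intro u
      rw [← mul_assoc (sr 2), t_eX]; simp [pow_succ, mul_assoc]
    have f2 : ∀ u : M.Group, eX * (eX ^ 2 * u) = eX ^ 3 * u := by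
      intro u; simp [pow_succ, mul_assoc]
    rw [f1, f2]
  · simp only [zh, if_true, hat_eq]

end Tri

namespace Tri
open CoxeterSystem
variable {M : CoxeterMatrix (Fin 3)}

theorem notMem_split {α : Type*} {μ : α} {L : List α} (h : μ ∉ L) {R A B : List α}
    (e : L ++ R = A ++ μ :: B) : ∃ A', A = L ++ A' ∧ R = A' ++ μ :: B := by
  rcases List.append_eq_append_iff.1 e with ⟨C, h1, h2⟩ | ⟨C, h1, h2⟩
  · exact ⟨C, h1, h2⟩
  · rcases C with _ | ⟨c, C⟩
    · exact ⟨[], by simpa using h1.symm, by simpa using h2.symm⟩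
    · simp only [List.cons_append, List.cons.injEq] at h2
      exfalso; apply h; rw [h1, h2.1]; simp

/-- the next letter -/
def hd (Zs : List Z) (e : Z) : Z := Zs.headD e

/-- token list of a word -/
def tkA (d : ℕ) : List Z → Z → List Tok
  | [], _ => []
  | z :: Zs, e => core d z ++ conn d z (hd Zs e) ++ tkA d Zs e

theorem hd_append (A B : List Z) (e : Z) : hd (A ++ B) e = hd A (hd B e) := by
  cases A <;> rfl

theorem tkA_append (d : ℕ) (A B : List Z) (e : Z) : tkA d (A ++ B) e = tkA d A (hd B e) ++ tkA d B e := by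
  induction A with
  | nil => rfl
  | cons z A ih => simp only [List.cons_append, tkA, ih, hd_append, List.append_assoc]

theorem tkA_pw (d n : ℕ) (z : Z) (Zs : List Z) : tkA d (pw n (z :: Zs)) z = pw n (tkA d (z :: Zs) z) := by
  induction n with
  | zero => rfl
  | succ n ih =>
    rw [pw_succ, pw_succ, tkA_append, ih]
    congr 2
    cases n
    · rfl
    · rw [pw_succ]; rfl

theorem et_tkA (d : ℕ) (Zs : List Z) (e : Z) (h : FreeGroup.IsReduced (Zs ++ [e])) :
    (et d (tkA d Zs e) : M.Group) = (Lz d (hd Zs e))⁻¹ * (Zs.map (zh d)).prod * Lz d e := by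
  induction Zs with
  | nil => simp [tkA, hd]
  | cons z Zs ih =>
    have h2 : FreeGroup.IsReduced (Zs ++ [e]) := by
      simp only [FreeGroup.IsReduced] at h ⊢
      exact h.tail
    have h3 : z.1 = (hd Zs e).1 → z.2 = (hd Zs e).2 := by
      simp only [FreeGroup.IsReduced] at h
      cases Zs with
      | nil => simpa [hd] using h
      | cons y Zs => exact (List.isChain_cons_cons.1 h).1
    rw [tkA, et_append, et_append, ih h2, conn_eval d _ _ h3, List.map_cons, List.prod_cons, zh_eq]
    simp [hd, mul_assoc]

/-- marker token -/
def mk5 (d : ℕ) (i : Fin 2) : Tok := .pl (lo d i + 4)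

/-- part of the core before the marker -/
def c1 (d : ℕ) (z : Z) : List Tok :=
  if z.2 then [.pl (lo d z.1 + 1), .pl 0, .pl 0, .pl (lo d z.1 + 2), .pl 0, .pl 0, .pl (lo d z.1 + 3), .pl 0, .pl 0]
  else (cr (lo d z.1 + 6) d).reverse ++ [.pl 0, .pl 0, .pl (lo d z.1 + 5), .pl 0, .pl 0]

/-- part of the core after the marker -/
def c2 (d : ℕ) (z : Z) : List Tok :=
  if z.2 then [.pl (lo d z.1 + 5), .pl 0, .pl 0] ++ cr (lo d z.1 + 6) d
  else [.pl (lo d z.1 + 3), .pl 0, .pl 0, .pl (lo d z.1 + 2), .pl 0, .pl 0, .pl (lo d z.1 + 1)]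

theorem core_eq (d : ℕ) (z : Z) : core d z = c1 d z ++ mk5 d z.1 :: (.pl 0 :: .pl 0 :: c2 d z) := by
  obtain ⟨i, e⟩ := z
  cases e <;> simp [core, c1, c2, mk5, cr]

theorem mk5_conn (d : ℕ) (i : Fin 2) (z z' : Z) : mk5 d i ∉ conn d z z' := by
  obtain ⟨j, e⟩ := z
  obtain ⟨j', e'⟩ := z'
  unfold conn
  fin_cases i <;> fin_cases j <;> fin_cases j' <;> cases e <;> cases e' <;>
    simp [mk5, lo, hi] <;> omega

theorem mk5_core (d : ℕ) (i : Fin 2) (z : Z) (h : z.1 ≠ i) : mk5 d i ∉ core d z := by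
  intro h1
  have h2 : mk5 d i ∈ cr (lo d z.1 + 1) (d + 5) := by
    unfold core at h1; split_ifs at h1 <;> simpa using h1
  obtain ⟨j, e⟩ := z
  rcases cr_plain _ _ _ h2 with h3 | ⟨n, h3, h4, h5⟩
  · simp [mk5] at h3
  · simp only [mk5, Tok.pl.injEq] at h5
    subst h5
    fin_cases i <;> fin_cases j <;> simp [lo] at * <;> omega

theorem mk5_c1 (d : ℕ) (z : Z) : mk5 d z.1 ∉ c1 d z := by
  obtain ⟨j, e⟩ := z
  intro h
  cases e
  · simp only [c1, Bool.false_eq_true, if_false, List.mem_append, List.mem_reverse] at h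
    rcases h with h | h
    · rcases cr_plain _ _ _ h with h3 | ⟨n, h3, h4, h5⟩
      · simp [mk5] at h3
      · simp only [mk5, Tok.pl.injEq] at h5; omega
    · simp [mk5] at h
  · simp [c1, mk5] at h

theorem mk5_c2 (d : ℕ) (z : Z) : mk5 d z.1 ∉ c2 d z := by
  obtain ⟨j, e⟩ := z
  intro h
  cases e
  · simp [c2, mk5] at h
  · simp only [c2, if_true, List.mem_append] at h
    rcases h with h | h
    · simp [mk5] at h
    · rcases cr_plain _ _ _ h with h3 | ⟨n, h3, h4, h5⟩
      · simp [mk5] at h3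
      · simp only [mk5, Tok.pl.injEq] at h5; omega

theorem marker (d : ℕ) (i : Fin 2) (e : Z) (Zs : List Z) : ∀ {A B : List Tok},
    tkA d Zs e = A ++ mk5 d i :: B → ∃ Q z S B', Zs = Q ++ z :: S ∧ z.1 = i ∧ A = tkA d Q z ++ c1 d z ∧
      B = .pl 0 :: .pl 0 :: c2 d z ++ B' := by
  induction Zs with
  | nil => intro A B h; simp [tkA] at h
  | cons z Zs ih =>
    intro A B h
    rw [tkA] at h
    by_cases hz : z.1 = i
    · rw [core_eq, List.append_assoc, List.append_assoc] at h
      rw [← hz] at h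
      obtain ⟨A1, rfl, h1⟩ := notMem_split (mk5_c1 d z) h
      rcases A1 with _ | ⟨m, A1⟩
      · simp only [List.nil_append, List.cons_append, List.cons.injEq, true_and] at h1
        refine ⟨[], z, Zs, conn d z (hd Zs e) ++ tkA d Zs e, rfl, hz, by simp [tkA], ?_⟩
        rw [← h1]; rfl
      · simp only [List.cons_append, List.cons.injEq] at h1
        obtain ⟨rfl, h1⟩ := h1
        have h2 : mk5 d z.1 ∉ Tok.pl 0 :: Tok.pl 0 :: (c2 d z ++ conn d z (hd Zs e)) := by
          simp only [List.mem_cons, List.mem_append, not_or]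
          exact ⟨by simp [mk5], by simp [mk5], mk5_c2 d z, mk5_conn _ _ _ _⟩
        obtain ⟨A2, rfl, h3⟩ := notMem_split h2 (R := tkA d Zs e) (A := A1) (B := B) (by simpa using h1)
        rw [hz] at h3
        obtain ⟨Q, z', S, B', rfl, h4, rfl, rfl⟩ := ih h3
        refine ⟨z :: Q, z', S, B', rfl, h4, ?_, rfl⟩
        rw [tkA, core_eq, hd_append]
        simp [hd]
    · have h2 : mk5 d i ∉ core d z ++ conn d z (hd Zs e) := by
        simp only [List.mem_append, not_or]
        exact ⟨mk5_core _ _ _ hz, mk5_conn _ _ _ _⟩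
      obtain ⟨A2, rfl, h3⟩ := notMem_split h2 h
      obtain ⟨Q, z', S, B', rfl, h4, rfl, rfl⟩ := ih h3
      refine ⟨z :: Q, z', S, B', rfl, h4, ?_, rfl⟩
      rw [tkA, hd_append]
      simp [hd]

theorem marker' (d : ℕ) (e z1 : Z) (Zs : List Z) {A B : List Tok}
    (h : tkA d Zs e = A ++ core d z1 ++ B) : ∃ Q S, Zs = Q ++ z1 :: S ∧ A = tkA d Q z1 := by
  rw [core_eq] at h
  obtain ⟨Q, z, S, B', h1, h2, h3, h4⟩ := marker d z1.1 e Zs (A := A ++ c1 d z1) (by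
    rw [h, List.append_assoc, List.append_assoc, List.append_assoc, List.cons_append])
  have hz : z = z1 := by
    obtain ⟨i, s⟩ := z
    obtain ⟨j, t⟩ := z1
    simp only at h2
    subst h2
    cases s <;> cases t <;> simp [c2] at h4 <;> rfl
  subst hz
  exact ⟨Q, S, h1, List.append_cancel_right h3⟩

end Tri

namespace Tri
open CoxeterSystem
variable {M : CoxeterMatrix (Fin 3)}

/-- the map from the free group -/
def Ph (d : ℕ) : FreeGroup (Fin 2) →* M.Group := FreeGroup.lift (hat d)

theorem Ph_mk (d : ℕ) (L : List Z) : (Ph d (FreeGroup.mk L) : M.Group) = (L.map (zh d)).prod := by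
  unfold Ph
  rw [FreeGroup.lift_mk]
  congr 1
  apply List.map_congr_left
  rintro ⟨i, e⟩ -
  cases e <;> simp [zh]

theorem cyc (f : FreeGroup (Fin 2)) (hf : f ≠ 1) : ∃ (c : FreeGroup (Fin 2)) (z : Z) (L : List Z),
    f = c * FreeGroup.mk (z :: L) * c⁻¹ ∧ FreeGroup.IsCyclicallyReduced (z :: L) := by
  have h1 := FreeGroup.reduceCyclically.conj_conjugator_reduceCyclically f.toWord
  have h2 := FreeGroup.reduceCyclically.isCyclicallyReduced (FreeGroup.isReduced_toWord (x := f))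
  have h3 : f = FreeGroup.mk (FreeGroup.reduceCyclically.conjugator f.toWord) *
      FreeGroup.mk (FreeGroup.reduceCyclically f.toWord) *
      (FreeGroup.mk (FreeGroup.reduceCyclically.conjugator f.toWord))⁻¹ := by
    rw [FreeGroup.inv_mk, FreeGroup.mul_mk, FreeGroup.mul_mk, h1, FreeGroup.mk_toWord]
  generalize FreeGroup.reduceCyclically f.toWord = L at *
  rcases L with _ | ⟨z, L⟩
  · exfalso; apply hf; rw [h3, ← FreeGroup.one_eq_mk, mul_one, mul_inv_cancel]
  · exact ⟨_, z, L, h3, h2⟩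

theorem cyc_red {z : Z} {L : List Z} (h : FreeGroup.IsCyclicallyReduced (z :: L)) :
    FreeGroup.IsReduced ((z :: L) ++ [z]) := by
  obtain ⟨h1, h2⟩ := h
  unfold FreeGroup.IsReduced at *
  refine List.IsChain.append h1 (by simp) ?_
  intro x hx y hy
  exact h2 x hx y (by simpa using hy)

theorem core_ne (d : ℕ) (z : Z) : core d z ≠ [] := by rw [core_eq]; simp

theorem gf_tkA (d : ℕ) (z : Z) (L : List Z) (e : Z) : Gap.Y ∈ gf d (tkA d (z :: L) e) := by
  unfold gf
  rw [List.mem_flatMap]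
  refine ⟨mk5 d z.1, ?_, ?_⟩
  · rw [tkA, core_eq]; simp
  · simp [mk5, Tok.u, List.mem_replicate]

theorem gf_last (d : ℕ) {T : List Tok} (h : T ≠ []) {W : List Gap} {x : Gap} (h1 : gf d T = W ++ [x]) : x = .X := by
  obtain ⟨T', a, rfl⟩ := List.eq_nil_or_concat T |>.resolve_left h
  rw [List.concat_eq_append, gf_append, gf_cons, gf_nil, List.append_nil, ← List.append_assoc] at h1
  have := (List.append_inj' h1 rfl).2
  simpa using this.symm

theorem ev_tkA (d : ℕ) {z : Z} {L : List Z} (h : FreeGroup.IsCyclicallyReduced (z :: L)) :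
    (ev (gf d (tkA d (z :: L) z)) : M.Group) = (Lz d z)⁻¹ * Ph d (FreeGroup.mk (z :: L)) * Lz d z := by
  rw [Ph_mk]
  exact et_tkA d (z :: L) z (cyc_red h)

theorem Ph_inj (hM : Big M) (d : ℕ) : Function.Injective (Ph d : FreeGroup (Fin 2) →* M.Group) := by
  rw [injective_iff_map_eq_one]
  intro f h
  by_contra hf
  obtain ⟨c, z, L, rfl, h1⟩ := cyc f hf
  have h2 : (Ph d (FreeGroup.mk (z :: L)) : M.Group) = 1 := by
    rw [map_mul, map_mul, map_inv] at h
    have := mul_inv_eq_one.1 h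
    simpa using this
  have h3 := ev_tkA (M := M) d h1
  rw [h2] at h3
  have h4 : gf d (tkA d (z :: L) z) ≠ [] := List.ne_nil_of_mem (gf_tkA d z L z)
  have h5 := wp_fl_ne_one hM 1 h4
  apply h5
  simpa [ev] using h3

theorem main5 (hM : Big M) (d : ℕ) (p : Equiv.Perm (Fin 3)) (Pi : M.Group →* M.Group)
    (hPi : ∀ l, Pi (sr l) = sr (p l)) (g : M.Group) (f1 f2 : FreeGroup (Fin 2)) (hf1 : f1 ≠ 1) (hf2 : f2 ≠ 1)
    (h : g * Pi (Ph d f1) = Ph d f2 * g) : p = 1 ∧ ∃ f, Ph d f = g := by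
  obtain ⟨c1, z1, Z1, rfl, hc1⟩ := cyc f1 hf1
  obtain ⟨c2, z2, Z2, rfl, hc2⟩ := cyc f2 hf2
  have hw : ∀ u : List (Fin 3), Pi (wp u) = wp (u.map p) := by
    intro u
    induction u with
    | nil => simp
    | cons a u ih => simp [ih, hPi]
  set m1 := FreeGroup.mk (z1 :: Z1) with hm1
  set m2 := FreeGroup.mk (z2 :: Z2) with hm2
  set g' : M.Group := (Ph d c2)⁻¹ * g * Pi (Ph d c1) with hg'
  have hh : g' * Pi (Ph d m1) = Ph d m2 * g' := by
    simp only [map_mul, map_inv] at h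
    have h0 : g * Pi (Ph d c1) * Pi (Ph d m1) = Ph d c2 * Ph d m2 * (Ph d c2)⁻¹ * g * Pi (Ph d c1) := by
      rw [← h]; group
    calc g' * Pi (Ph d m1) = (Ph d c2)⁻¹ * (g * Pi (Ph d c1) * Pi (Ph d m1)) := by rw [hg']; group
      _ = _ := by rw [h0, hg']; group
  have e1 := ev_tkA (M := M) d hc1
  have e2 := ev_tkA (M := M) d hc2
  rw [← hm1] at e1
  rw [← hm2] at e2
  set T1 := tkA d (z1 :: Z1) z1 with hT1
  set T2 := tkA d (z2 :: Z2) z2 with hT2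
  set k : M.Group := (Lz d z2)⁻¹ * g' * Pi (Lz d z1) with hk
  have hkk : k * wp ((fl (gf d T1)).map p) = wp (fl (gf d T2)) * k := by
    rw [← hw]
    change k * Pi (ev (gf d T1)) = ev (gf d T2) * k
    rw [e1, e2]
    simp only [map_mul, map_inv]
    calc k * ((Pi (Lz d z1))⁻¹ * Pi (Ph d m1) * Pi (Lz d z1)) =
        (Lz d z2)⁻¹ * (g' * Pi (Ph d m1)) * Pi (Lz d z1) := by rw [hk]; group
      _ = _ := by rw [hh, hk]; group
  have hT1n : T1 ≠ [] := by
    rw [hT1, tkA, core_eq]; simp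
  obtain ⟨hp, n, q, P, R, x, W', h1, h2, h3⟩ := rigidity hM p k (gf d T1) (gf d T2) (gf_tkA d _ _ _)
    (List.ne_nil_of_mem (gf_tkA d z2 Z2 z2)) hkk
  refine ⟨hp, ?_⟩
  have hx := gf_last d hT1n h1
  subst hx
  have hPid : Pi = MonoidHom.id _ := by
    apply M.toCoxeterSystem.ext_simple
    intro i
    have := hPi i
    rw [hp] at this
    exact this
  have hpw : pw n (gf d T2) = gf d (pw n T2) := by
    clear h2
    induction n with
    | zero => rfl
    | succ n ih => rw [pw_succ, pw_succ, gf_append, ih]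
  rw [hpw] at h2
  obtain ⟨Pt, S, h4, h5, h6⟩ := codeA (Tok.u d) .X (tok_X d) (pw n T2) (A := P) (R := gf d T1 ++ R) (by
    change _ = gf d (pw n T2)
    rw [h2]; simp)
  obtain ⟨St, h7, h8⟩ := codeB (Tok.u d) .X (tok_X d) (tok_inj d) T1 h6.symm
  have h9 : tkA d (pw n (z2 :: Z2)) z2 = Pt ++ core d z1 ++ (conn d z1 (hd Z1 z1) ++ tkA d Z1 z1 ++ St) := by
    rw [tkA_pw, ← hT2, h4, h7, hT1, tkA]; simp
  obtain ⟨Q, S', h10, h11⟩ := marker' d z2 z1 _ h9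
  have hred : FreeGroup.IsReduced (Q ++ [z1]) := by
    have := (hc2.flatten_replicate n).1
    change FreeGroup.IsReduced (pw n (z2 :: Z2)) at this
    rw [h10, show Q ++ z1 :: S' = (Q ++ [z1]) ++ S' by simp] at this
    unfold FreeGroup.IsReduced at *
    exact this.left_of_append
  have hhd : hd Q z1 = z2 := by
    have : hd (pw n (z2 :: Z2)) z2 = z2 := by
      cases n
      · rfl
      · rw [pw_succ]; rfl
    rw [h10, hd_append] at this
    exact this
  have h12 : k * ev (gf d T1) ^ q = (Lz d z2)⁻¹ * Ph d (FreeGroup.mk Q) * Lz d z1 := by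
    have := et_tkA (M := M) d Q z1 hred
    rw [hhd, ← Ph_mk, ← h11] at this
    rw [← this]
    change k * wp (fl (gf d T1)) ^ q = wp (fl (gf d Pt))
    rw [h3, ← h5]; rfl
  have h13 : (ev (gf d T1) : M.Group) ^ q = (Lz d z1)⁻¹ * Ph d m1 ^ q * Lz d z1 := by
    rw [e1]
    have := conj_pow (a := (Lz d z1 : M.Group)⁻¹) (b := Ph d m1) (i := q)
    simpa using this
  have h14 : g' * Ph d m1 ^ q = Ph d (FreeGroup.mk Q) := by
    rw [h13, hk, hPid] at h12
    simp only [MonoidHom.id_apply] at h12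
    have h15 : (Lz d z2)⁻¹ * (g' * Ph d m1 ^ q) * Lz d z1 = (Lz d z2)⁻¹ * Ph d (FreeGroup.mk Q) * Lz d z1 := by
      rw [← h12]; group
    exact mul_left_cancel (mul_right_cancel h15)
  refine ⟨c2 * (FreeGroup.mk Q * (m1 ^ q)⁻¹) * c1⁻¹, ?_⟩
  rw [map_mul, map_mul, map_mul, map_inv, map_inv, map_pow, ← h14, hg', hPid]
  simp only [MonoidHom.id_apply]
  group

end Tri

namespace Tri
open CoxeterSystem
variable {M : CoxeterMatrix (Fin 3)}

theorem exists_weyl (hM : Big M) : ∃ x : V, ∀ s, sg M s x = x + al s := by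
  let A : Matrix (Fin 3) (Fin 3) ℝ := Matrix.of (cc M)
  have hdet : A.det ≠ 0 := by
    rw [Matrix.det_fin_three]
    simp only [A, Matrix.of_apply, cc_diag, cc_symm M 1 0, cc_symm M 2 0, cc_symm M 2 1]
    have h1 := cc_sq hM (show (0 : Fin 3) ≠ 1 by decide)
    have h2 := cc_sq hM (show (0 : Fin 3) ≠ 2 by decide)
    have h3 := cc_sq hM (show (1 : Fin 3) ≠ 2 by decide)
    have g1 := (Real.sqrt_nonneg 3).trans (cc_ge hM (show (0 : Fin 3) ≠ 1 by decide))
    have g2 := (Real.sqrt_nonneg 3).trans (cc_ge hM (show (0 : Fin 3) ≠ 2 by decide))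
    have g3 := (Real.sqrt_nonneg 3).trans (cc_ge hM (show (1 : Fin 3) ≠ 2 by decide))
    have := mul_nonneg (mul_nonneg g1 g2) g3
    apply ne_of_gt
    nlinarith
  have hu : IsUnit A := (Matrix.isUnit_iff_isUnit_det A).2 (isUnit_iff_ne_zero.2 hdet)
  obtain ⟨x, hx⟩ := (Matrix.mulVec_surjective_iff_isUnit.2 hu) (fun _ => 1)
  refine ⟨x, fun s => ?_⟩
  rw [sg_apply]
  have := congrFun hx s
  simp only [Matrix.mulVec, dotProduct, A, Matrix.of_apply] at this
  rw [this, one_smul]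

/-- height as linear map -/
def hL : V →ₗ[ℝ] ℝ := ∑ l, LinearMap.proj l

theorem hL_apply (v : V) : hL v = ht v := by simp [hL, ht]

theorem fin_len (N : ℕ) : {w : M.Group | len w ≤ N}.Finite := by
  apply ((List.finite_length_le (Fin 3) N).image (wp (M := M))).subset
  intro w hw
  obtain ⟨U, h1, h2⟩ := exists_red w
  refine ⟨U, ?_, h2⟩
  unfold Red at h1
  rw [h2] at h1
  simpa [← h1] using hw

theorem infinite (hM : Big M) : Infinite M.Group := by
  by_contra h
  rw [not_infinite_iff_finite] at h
  obtain ⟨n, hn, h1⟩ := isOfFinOrder_iff_pow_eq_one.1 (isOfFinOrder_of_finite (wp (M := M) (fl [.X])))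
  have h2 := wp_pw (M := M) id n [.X]
  simp only [List.map_id] at h2
  rw [h1] at h2
  have h3 : pw n [Gap.X] ≠ [] := by
    intro h; have := congrArg List.length h; simp at this; omega
  have := wp_fl_ne_one hM 1 h3
  simp at this
  exact this h2

theorem weyl_len (hM : Big M) {x : V} (hx : ∀ s, sg M s x = x + al s) (w : M.Group) :
    ht x + len w ≤ ht (rep hM w x) := by
  induction hn : len w generalizing w with
  | zero =>
    have : w = 1 := by
      by_contra h
      obtain ⟨s, hs⟩ := exists_desc h
      unfold Desc at hs; omega
    subst this; simp
  | succ n ih =>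
    have h1 : w ≠ 1 := by rintro rfl; simp [len] at hn
    obtain ⟨s, hs⟩ := exists_desc h1
    have h2 := (desc_iff w s).1 hs
    have h3 := ih (w * sr s) (by omega)
    have h4 : rep hM w x = rep hM (w * sr s) x + rt hM (w * sr s) s := by
      have : rep hM w x = rep hM (w * sr s) (sg M s x) := by
        rw [← rep_sr hM, ← Module.End.mul_apply, ← map_mul]; simp
      rw [this, hx, map_add]; rfl
    have h5 := (rt_pos' hM (not_desc_mul hs)).ht_ge (rt_ne_zero hM _ _)
    rw [h4, ht_add]; push_cast; linarith

/-- stabilizers of dominant functionals are parabolic -/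
theorem stab (hM : Big M) (f : V →ₗ[ℝ] ℝ) (hf : ∀ s, 0 ≤ f (al s)) (w : M.Group)
    (hw : ∀ v, f (rep hM w v) = f v) : w ∈ Subgroup.closure {g : M.Group | ∃ s, f (al s) = 0 ∧ g = sr s} := by
  induction hn : len w generalizing w with
  | zero =>
    have : w = 1 := by
      by_contra h
      obtain ⟨s, hs⟩ := exists_desc h
      unfold Desc at hs; omega
    subst this; exact one_mem _
  | succ n ih =>
    have h1 : w ≠ 1 := by rintro rfl; simp [len] at hn
    obtain ⟨s, hs⟩ := exists_desc h1
    have h2 := (desc_iff w s).1 hs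
    have hpos : ∀ v : V, (∀ i, 0 ≤ v i) → 0 ≤ f v := by
      intro v hv
      have : v = ∑ i, v i • al i := by
        ext j; simp [al, Pi.single_apply]
      rw [this, map_sum]
      apply Finset.sum_nonneg
      intro i _
      rw [map_smul]
      exact mul_nonneg (hv i) (hf i)
    have h3 := hpos _ (rt_neg hM hs).nonneg
    rw [map_neg] at h3
    have h4 : f (rt hM w s) = f (al s) := hw _
    have h5 : f (al s) = 0 := le_antisymm (by linarith) (hf s)
    have h6 : ∀ v, f (sg M s v) = f v := by
      intro v; rw [sg_apply, map_add, map_smul, h5]; simp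
    have h7 := ih (w * sr s) (fun v => by
      rw [map_mul, Module.End.mul_apply, hw, rep_sr, h6]) (by omega)
    have h8 := mul_mem h7 (Subgroup.subset_closure ⟨s, h5, rfl⟩)
    simpa using h8

theorem dihedral_form (x y : Fin 3) (w : M.Group) (h : w ∈ Subgroup.closure {sr x, (sr y : M.Group)}) :
    ∃ m : ℤ, w = (sr x * sr y) ^ m ∨ w = (sr x * sr y) ^ m * sr x := by
  have key : ∀ m : ℤ, (sr x * (sr x * sr y) ^ m : M.Group) = (sr x * sr y) ^ (-m) * sr x := by
    intro m
    have : SemiconjBy (sr x : M.Group) (sr x * sr y) (sr x * sr y)⁻¹ := by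
      simp [SemiconjBy]
    have := this.zpow_right m
    rw [inv_zpow'] at this
    exact this
  have hy : ∀ m : ℤ, (sr y * (sr x * sr y) ^ m : M.Group) = (sr x * sr y) ^ (-1 - m) * sr x := by
    intro m
    have : (sr y : M.Group) = (sr x * sr y)⁻¹ * sr x := by simp
    nth_rewrite 1 [this]
    rw [mul_assoc, key, ← mul_assoc, sub_eq_add_neg, zpow_add]; simp
  induction h using Subgroup.closure_induction_left with
  | one => exact ⟨0, Or.inl (by simp)⟩
  | mul_left g hg w hw ih =>
    obtain ⟨m, ih⟩ := ih
    rcases hg with rfl | rfl <;> rcases ih with rfl | rfl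
    · exact ⟨-m, Or.inr (key m)⟩
    · exact ⟨-m, Or.inl (by rw [← mul_assoc, key]; simp)⟩
    · exact ⟨-1 - m, Or.inr (hy m)⟩
    · exact ⟨-1 - m, Or.inl (by rw [← mul_assoc, hy]; simp)⟩
  | inv_mul_cancel g hg w hw ih =>
    obtain ⟨m, ih⟩ := ih
    rcases hg with rfl | rfl <;> rcases ih with rfl | rfl <;> rw [sr_inv]
    · exact ⟨-m, Or.inr (key m)⟩
    · exact ⟨-m, Or.inl (by rw [← mul_assoc, key]; simp)⟩
    · exact ⟨-1 - m, Or.inr (hy m)⟩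
    · exact ⟨-1 - m, Or.inl (by rw [← mul_assoc, hy]; simp)⟩

/-- parity -/
def par : M.Group →* Multiplicative (ZMod 2) := M.toCoxeterSystem.lengthParity

theorem par_sr (s : Fin 3) : par (sr s : M.Group) = Multiplicative.ofAdd 1 :=
  M.toCoxeterSystem.lengthParity_simple s

theorem par_sq (g : Multiplicative (ZMod 2)) : g * g = 1 := by
  revert g; decide

theorem torsion (hM : Big M) (h : M.Group) (hh : IsOfFinOrder h) (hp : par h = 1) :
    ∃ (g : M.Group) (x y : Fin 3) (m : ℤ), x ≠ y ∧ h = g * (sr x * sr y) ^ m * g⁻¹ := by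
  obtain ⟨n, hn, h1⟩ := isOfFinOrder_iff_pow_eq_one.1 hh
  obtain ⟨x, hx⟩ := exists_weyl hM
  let f : V →ₗ[ℝ] ℝ := ∑ k ∈ Finset.range n, hL ∘ₗ rep hM (h ^ k)
  have hf : ∀ v, f v = ∑ k ∈ Finset.range n, ht (rep hM (h ^ k) v) := by
    intro v; simp [f, hL_apply]
  have finv : ∀ v, f (rep hM h v) = f v := by
    intro v
    rw [hf, hf]
    have e1 : ∀ k, ht (rep hM (h ^ k) (rep hM h v)) = ht (rep hM (h ^ (k + 1)) v) := by
      intro k; rw [pow_succ, map_mul]; rfl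
    simp only [e1]
    have e2 := Finset.sum_range_succ (fun k => ht (rep hM (h ^ k) v)) n
    have e3 := Finset.sum_range_succ' (fun k => ht (rep hM (h ^ k) v)) n
    rw [h1] at e2
    rw [pow_zero] at e3
    linarith
  have hlow : ∀ g : M.Group, (n : ℝ) * ht x + len g ≤ f (rep hM g x) := by
    intro g
    rw [hf]
    have e1 : ∀ k ∈ Finset.range n, ht x + (if k = 0 then (len g : ℝ) else 0) ≤ ht (rep hM (h ^ k) (rep hM g x)) := by
      intro k _
      have := weyl_len hM hx (h ^ k * g)
      rw [map_mul] at this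
      refine le_trans ?_ this
      split_ifs with hk
      · subst hk; simp
      · have : (0:ℝ) ≤ len (h ^ k * g) := Nat.cast_nonneg _
        linarith
    have e2 := Finset.sum_le_sum e1
    rw [Finset.sum_add_distrib, Finset.sum_ite_eq' (Finset.range n) 0] at e2
    simpa [hn] using e2
  -- minimizer
  obtain ⟨g, hg⟩ : ∃ g : M.Group, ∀ g', f (rep hM g x) ≤ f (rep hM g' x) := by
    obtain ⟨N, hN⟩ := exists_nat_gt (f (rep hM (1 : M.Group) x) - n * ht x)
    have hne : (fin_len (M := M) N).toFinset.Nonempty := ⟨1, by simp [len]⟩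
    obtain ⟨g, hg1, hg2⟩ := Finset.exists_min_image _ (fun g => f (rep hM g x)) hne
    refine ⟨g, fun g' => ?_⟩
    by_cases hg' : len g' ≤ N
    · exact hg2 g' (by simpa using hg')
    · have i1 := hlow g'
      have i2 := hg2 1 (by simp [len])
      have i3 : (N : ℝ) < len g' := by exact_mod_cast not_le.1 hg'
      linarith
  let f' : V →ₗ[ℝ] ℝ := f ∘ₗ rep hM g
  have hf' : ∀ s, 0 ≤ f' (al s) := by
    intro s
    have i1 := hg (g * sr s)
    rw [map_mul, Module.End.mul_apply, rep_sr, hx, map_add, map_add] at i1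
    change 0 ≤ f (rep hM g (al s))
    linarith
  have hst := stab hM f' hf' (g⁻¹ * h * g) (fun v => by
    change f (rep hM g (rep hM (g⁻¹ * h * g) v)) = f (rep hM g v)
    rw [← Module.End.mul_apply, ← map_mul, show g * (g⁻¹ * h * g) = h * g by group, map_mul,
      Module.End.mul_apply, finv])
  have hne : ∃ z, f' (al z) ≠ 0 := by
    by_contra hc
    push Not at hc
    have hz : ∀ v, f' v = 0 := by
      intro v
      have : v = ∑ i, v i • al i := by
        ext j; simp [al, Pi.single_apply]
      rw [this, map_sum]
      simp [hc]
    have i1 : ∀ u : M.Group, (len u : ℝ) ≤ - (n * ht x) := by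
      intro u
      have := hlow u
      have i2 := hz (rep hM (g⁻¹ * u) x)
      change f (rep hM g (rep hM (g⁻¹ * u) x)) = 0 at i2
      rw [← Module.End.mul_apply, ← map_mul, mul_inv_cancel_left] at i2
      linarith
    obtain ⟨N, hN⟩ := exists_nat_gt (-(n * ht x))
    have i3 := fin_len (M := M) N
    have i4 : {w : M.Group | len w ≤ N} = Set.univ := by
      ext u; simp only [Set.mem_ofPred_eq, Set.mem_univ, iff_true]
      have := (i1 u).trans_lt hN
      exact_mod_cast this.le
    rw [i4, Set.finite_univ_iff] at i3
    exact (infinite hM).not_finite i3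
  obtain ⟨z, hz⟩ := hne
  obtain ⟨x', y', hxy, hzx⟩ : ∃ x' y' : Fin 3, x' ≠ y' ∧ ∀ s, s ≠ z → s = x' ∨ s = y' := by
    clear hz; revert z; decide
  have hst2 : g⁻¹ * h * g ∈ Subgroup.closure {sr x', (sr y' : M.Group)} := by
    refine Subgroup.closure_mono ?_ hst
    rintro w ⟨s, hs, rfl⟩
    have : s ≠ z := by rintro rfl; exact hz hs
    rcases hzx s this with rfl | rfl <;> simp
  obtain ⟨m, hm⟩ := dihedral_form x' y' _ hst2
  refine ⟨g, x', y', m, hxy, ?_⟩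
  have hm' : g⁻¹ * h * g = (sr x' * sr y') ^ m := by
    rcases hm with hm | hm
    · exact hm
    · exfalso
      have := congrArg par hm
      simp only [map_mul, map_inv, hp, map_zpow, par_sr, par_sq, one_zpow, one_mul, mul_one] at this
      rw [inv_mul_cancel] at this
      revert this; decide
  rw [← hm']; group

end Tri

namespace Tri
open CoxeterSystem
variable {M : CoxeterMatrix (Fin 3)}

/-- the functional `-2 B(α_l, ·)` -/
noncomputable def bd (M : CoxeterMatrix (Fin 3)) (l : Fin 3) : V →ₗ[ℝ] ℝ := ∑ k, cc M l k • LinearMap.proj k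

theorem bd_apply (l : Fin 3) (v : V) : bd M l v = ∑ k, cc M l k * v k := by
  simp [bd]

theorem bd_al (l k : Fin 3) : bd M l (al k) = cc M l k := by
  simp [bd_apply, al, Pi.single_apply]

theorem sg_bd (s : Fin 3) (v : V) : sg M s v = v + bd M s v • al s := by
  rw [sg_apply, bd_apply]

/-- the bilinear form -/
noncomputable def bil (M : CoxeterMatrix (Fin 3)) (v w : V) : ℝ := ∑ l, v l * bd M l w

theorem bil_symm (v w : V) : bil M v w = bil M w v := by
  unfold bil
  simp only [bd_apply, Finset.mul_sum]
  rw [Finset.sum_comm]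
  refine Finset.sum_congr rfl fun i _ => Finset.sum_congr rfl fun j _ => ?_
  rw [cc_symm M i j]; ring

theorem bil_add (u v w : V) : bil M (u + v) w = bil M u w + bil M v w := by
  simp [bil, add_mul, Finset.sum_add_distrib]

theorem bil_smul (a : ℝ) (v w : V) : bil M (a • v) w = a * bil M v w := by
  simp [bil, Finset.mul_sum, mul_assoc]

theorem bil_al (l : Fin 3) (w : V) : bil M (al l) w = bd M l w := by
  simp [bil, al, Pi.single_apply]

theorem bil_sg (s : Fin 3) (v w : V) : bil M (sg M s v) (sg M s w) = bil M v w := by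
  rw [sg_bd, sg_bd, bil_add, bil_smul, bil_al, bil_symm v, bil_add, bil_smul, bil_al, map_add, map_smul, bd_al,
    cc_diag, bil_symm w, smul_eq_mul]
  ring

theorem bil_rep (hM : Big M) (g : M.Group) (v w : V) : bil M (rep hM g v) (rep hM g w) = bil M v w := by
  induction g using M.toCoxeterSystem.simple_induction_left with
  | one => simp
  | mul_simple_left g s ih =>
    rw [map_mul, Module.End.mul_apply, Module.End.mul_apply]
    change bil M (rep hM (sr s) _) (rep hM (sr s) _) = _
    rw [rep_sr, bil_sg, ih]

theorem rep_inv_left (hM : Big M) (g : M.Group) (v : V) : rep hM g⁻¹ (rep hM g v) = v := by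
  rw [← Module.End.mul_apply, ← map_mul]; simp

theorem rep_inv_right (hM : Big M) (g : M.Group) (v : V) : rep hM g (rep hM g⁻¹ v) = v := by
  rw [← Module.End.mul_apply, ← map_mul]; simp

theorem bil_rep_inv (hM : Big M) (g : M.Group) (v w : V) : bil M (rep hM g⁻¹ v) w = bil M v (rep hM g w) := by
  rw [← bil_rep hM g, rep_inv_right]

/-- fixed vectors (scaled) -/
noncomputable def om (M : CoxeterMatrix (Fin 3)) (x y z : Fin 3) : V :=
  (4 - cc M x y ^ 2) • al z + (cc M x y * cc M y z + 2 * cc M x z) • al x +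
    (cc M x y * cc M x z + 2 * cc M y z) • al y

/-- the determinant constant -/
noncomputable def dE (M : CoxeterMatrix (Fin 3)) (x y z : Fin 3) : ℝ :=
  2 * (cc M x y * cc M x z * cc M y z) + 2 * (cc M x y ^ 2 + cc M x z ^ 2 + cc M y z ^ 2) - 8

theorem dE_eq {x y z : Fin 3} (hxy : x ≠ y) (hxz : x ≠ z) (hyz : y ≠ z) : dE M x y z = dE M 0 1 2 := by
  unfold dE
  have h1 := cc_symm M 1 0
  have h2 := cc_symm M 2 0
  have h3 := cc_symm M 2 1
  fin_cases x <;> fin_cases y <;> fin_cases z <;> simp at hxy hxz hyz <;> simp [h1, h2, h3] <;> ring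

theorem dE_pos (hM : Big M) : 20 ≤ dE M 0 1 2 := by
  unfold dE
  have h1 := cc_sq hM (show (0 : Fin 3) ≠ 1 by decide)
  have h2 := cc_sq hM (show (0 : Fin 3) ≠ 2 by decide)
  have h3 := cc_sq hM (show (1 : Fin 3) ≠ 2 by decide)
  have g1 := sq3.trans (cc_ge hM (show (0 : Fin 3) ≠ 1 by decide))
  have g2 := sq3.trans (cc_ge hM (show (0 : Fin 3) ≠ 2 by decide))
  have g3 := sq3.trans (cc_ge hM (show (1 : Fin 3) ≠ 2 by decide))
  have k1 : (1.732 : ℝ) * 1.732 ≤ cc M 0 1 * cc M 0 2 := by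
    apply mul_le_mul g1 g2 <;> linarith
  have k2 : (1.732 : ℝ) * 1.732 * 1.732 ≤ cc M 0 1 * cc M 0 2 * cc M 1 2 := by
    apply mul_le_mul k1 g3 <;> nlinarith
  norm_num at k2
  linarith

theorem bd_om {x y z : Fin 3} (hxy : x ≠ y) (hxz : x ≠ z) (hyz : y ≠ z) (l : Fin 3) :
    bd M l (om M x y z) = dE M 0 1 2 * al z l := by
  rw [← dE_eq hxy hxz hyz]
  unfold om dE
  simp only [map_add, map_smul, bd_al, smul_eq_mul]
  have h1 := cc_symm M y x
  have h2 := cc_symm M z x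
  have h3 := cc_symm M z y
  rcases cases3 hxy hxz hyz l with rfl | rfl | rfl
  · rw [al_ne hxz, cc_diag]; ring
  · rw [al_ne hyz, cc_diag, h1]; ring
  · rw [al_same, cc_diag, h2, h3]; ring

theorem bil_om {x y z : Fin 3} (hxy : x ≠ y) (hxz : x ≠ z) (hyz : y ≠ z) (v : V) :
    bil M v (om M x y z) = dE M 0 1 2 * v z := by
  simp only [bil, bd_om hxy hxz hyz]
  simp [al, Pi.single_apply, mul_comm]

theorem om_apply {x y z : Fin 3} (hxy : x ≠ y) (hxz : x ≠ z) (hyz : y ≠ z) :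
    om M x y z z = 4 - cc M x y ^ 2 ∧ om M x y z x = cc M x y * cc M y z + 2 * cc M x z ∧
    om M x y z y = cc M x y * cc M x z + 2 * cc M y z := by
  unfold om
  simp only [Pi.add_apply, Pi.smul_apply, smul_eq_mul, al_same, al_ne hxy, al_ne hxz, al_ne hyz, al_ne hxy.symm,
    al_ne hxz.symm, al_ne hyz.symm]
  refine ⟨?_, ?_, ?_⟩ <;> ring

/-- rank two skew operator -/
noncomputable def Nn (M : CoxeterMatrix (Fin 3)) (x y : Fin 3) : Module.End ℝ V :=
  (bd M y).smulRight (al x) - (bd M x).smulRight (al y)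

theorem Nn_apply (x y : Fin 3) (v : V) : Nn M x y v = bd M y v • al x - bd M x v • al y := rfl

theorem Nn_sq_apply (x y : Fin 3) (v : V) : (Nn M x y * Nn M x y) v =
    (cc M x y * bd M y v + 2 * bd M x v) • al x + (2 * bd M y v + cc M x y * bd M x v) • al y := by
  rw [Module.End.mul_apply, Nn_apply, Nn_apply]
  simp only [map_sub, map_smul, bd_al, cc_diag, smul_eq_mul, cc_symm M y x]
  module

theorem Nn_sq {x y z : Fin 3} (hxy : x ≠ y) (hxz : x ≠ z) (hyz : y ≠ z) :
    Nn M x y * Nn M x y = (cc M x y ^ 2 - 4) • 1 + (LinearMap.proj z : V →ₗ[ℝ] ℝ).smulRight (om M x y z) := by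
  apply LinearMap.ext
  intro v
  rw [Nn_sq_apply]
  have h1 : bd M x v = -2 * v x + cc M x y * v y + cc M x z * v z := by
    rw [bd_apply, sum3 hxy hxz hyz, cc_diag]
  have h2 : bd M y v = cc M x y * v x + -2 * v y + cc M y z * v z := by
    rw [bd_apply, sum3 hxy hxz hyz, cc_diag, cc_symm M y x]
  obtain ⟨o1, o2, o3⟩ := om_apply (M := M) hxy hxz hyz
  apply ext3 hxy hxz hyz <;>
  simp only [Pi.add_apply, Pi.smul_apply, smul_eq_mul, al_same, al_ne hxy, al_ne hxz, al_ne hyz, al_ne hxy.symm,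
    al_ne hxz.symm, al_ne hyz.symm, LinearMap.add_apply, LinearMap.smul_apply, Module.End.one_apply,
    LinearMap.smulRight_apply, LinearMap.proj_apply, h1, h2, o1, o2, o3] <;> ring

theorem rot (hM : Big M) {x y : Fin 3} (hxy : x ≠ y) (p : ℕ) :
    rep hM ((sr x * sr y) ^ p) = 1 +
      (Real.sin (p * (Real.pi / M x y)) * Real.cos (p * (Real.pi / M x y)) / Real.sin (Real.pi / M x y)) • Nn M x y +
      (Real.sin (p * (Real.pi / M x y)) ^ 2 / (2 * Real.sin (Real.pi / M x y) ^ 2)) • (Nn M x y * Nn M x y) := by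
  have hth := angle_pos hM hxy
  have hcc : cc M x y = 2 * Real.cos (Real.pi / M x y) := rfl
  set θ := Real.pi / (M x y : ℝ) with hθ
  have hs : 0 < Real.sin θ := Real.sin_pos_of_pos_of_lt_pi hth.1 (by linarith [Real.pi_pos])
  have hsc := Real.sin_sq_add_cos_sq θ
  apply LinearMap.ext
  intro v
  induction p generalizing v with
  | zero => simp
  | succ p ih =>
    rw [pow_succ, map_mul, map_mul, rep_sr, rep_sr, Module.End.mul_apply, Module.End.mul_apply, ih]
    have e0 : sg M x (sg M y v) = v + (bd M x v + cc M x y * bd M y v) • al x + bd M y v • al y := by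
      rw [sg_bd x, sg_bd y, map_add, map_smul, bd_al, smul_eq_mul]; module
    have e1 : bd M x (sg M x (sg M y v)) = - bd M x v - cc M x y * bd M y v := by
      rw [e0]; simp only [map_add, map_smul, bd_al, cc_diag, smul_eq_mul]; ring
    have e2 : bd M y (sg M x (sg M y v)) = cc M x y * bd M x v + (cc M x y ^ 2 - 1) * bd M y v := by
      rw [e0]; simp only [map_add, map_smul, bd_al, cc_diag, smul_eq_mul, cc_symm M y x]; ring
    simp only [LinearMap.add_apply, LinearMap.smul_apply, Nn_sq_apply, Nn_apply, Module.End.one_apply, e1, e2]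
    rw [e0, hcc]
    have a1 : ((p + 1 : ℕ) : ℝ) * θ = p * θ + θ := by push_cast; ring
    rw [a1, Real.sin_add, Real.cos_add]
    have hSK := Real.sin_sq_add_cos_sq (p * θ)
    generalize Real.sin (p * θ) = S at *
    generalize Real.cos (p * θ) = K at *
    generalize Real.sin θ = s at *
    generalize Real.cos θ = c at *
    generalize bd M x v = a
    generalize bd M y v = b
    have hc : c ^ 2 = 1 - s ^ 2 := by linarith
    have hK : K ^ 2 = 1 - S ^ 2 := by linarith
    have hs0 : s ≠ 0 := hs.ne'
    match_scalars
    · ring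
    · field_simp
      grind
    · field_simp
      grind

end Tri

namespace Tri
open CoxeterSystem
variable {M : CoxeterMatrix (Fin 3)}

/-- cross product -/
noncomputable def cx (M : CoxeterMatrix (Fin 3)) (S T : V) : V :=
  ![bd M 1 S * bd M 2 T - bd M 2 S * bd M 1 T, bd M 2 S * bd M 0 T - bd M 0 S * bd M 2 T,
    bd M 0 S * bd M 1 T - bd M 1 S * bd M 0 T]

theorem cx_form {x y z : Fin 3} (hxy : x ≠ y) (hxz : x ≠ z) (hyz : y ≠ z) : ∃ ε : ℝ, (ε = 1 ∨ ε = -1) ∧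
    ∀ S T : V, cx M S T z = ε * (bd M x S * bd M y T - bd M y S * bd M x T) ∧
      cx M S T x = ε * (bd M y S * bd M z T - bd M z S * bd M y T) ∧
      cx M S T y = ε * (bd M z S * bd M x T - bd M x S * bd M z T) := by
  by_cases h : y = x + 1
  · refine ⟨1, Or.inl rfl, fun S T => ?_⟩
    fin_cases x <;> fin_cases y <;> fin_cases z <;> simp at hxy hxz hyz h <;> simp [cx]
  · refine ⟨-1, Or.inr rfl, fun S T => ?_⟩
    fin_cases x <;> fin_cases y <;> fin_cases z <;> simp at hxy hxz hyz h <;> simp [cx]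

theorem cx_sg (s : Fin 3) (S T : V) : cx M (sg M s S) (sg M s T) = - sg M s (cx M S T) := by
  obtain ⟨y, z, h1, h2, h3⟩ : ∃ y z : Fin 3, s ≠ y ∧ s ≠ z ∧ y ≠ z := by revert s; decide
  obtain ⟨ε, -, hε⟩ := cx_form (M := M) h1 h2 h3
  obtain ⟨a1, a2, a3⟩ := hε (sg M s S) (sg M s T)
  obtain ⟨b1, b2, b3⟩ := hε S T
  have e : ∀ v : V, bd M s (sg M s v) = - bd M s v ∧ bd M y (sg M s v) = bd M y v + cc M s y * bd M s v ∧
      bd M z (sg M s v) = bd M z v + cc M s z * bd M s v := by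
    intro v
    rw [sg_bd]
    simp only [map_add, map_smul, bd_al, cc_diag, smul_eq_mul, cc_symm M y s, cc_symm M z s]
    refine ⟨?_, ?_, ?_⟩ <;> ring
  have f : bd M s (cx M S T) = -2 * cx M S T s + cc M s y * cx M S T y + cc M s z * cx M S T z := by
    rw [bd_apply, sum3 h1 h2 h3, cc_diag]
  obtain ⟨eS1, eS2, eS3⟩ := e S
  obtain ⟨eT1, eT2, eT3⟩ := e T
  rw [sg_bd s (cx M S T), f]
  apply ext3 h1 h2 h3
  · rw [a2]
    simp only [Pi.neg_apply, Pi.add_apply, Pi.smul_apply, smul_eq_mul, al_same, eS1, eS2, eS3, eT1, eT2, eT3, b1, b2, b3]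
    ring
  · rw [a3]
    simp only [Pi.neg_apply, Pi.add_apply, Pi.smul_apply, smul_eq_mul, al_ne h1.symm, eS1, eS2, eS3, eT1, eT2, eT3, b1, b2, b3]
    ring
  · rw [a1]
    simp only [Pi.neg_apply, Pi.add_apply, Pi.smul_apply, smul_eq_mul, al_ne h2.symm, eS1, eS2, eS3, eT1, eT2, eT3, b1, b2, b3]
    ring

theorem cx_rep (hM : Big M) (g : M.Group) (S T : V) : cx M (rep hM g S) (rep hM g T) = rep hM g (cx M S T) ∨
    cx M (rep hM g S) (rep hM g T) = - rep hM g (cx M S T) := by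
  induction g using M.toCoxeterSystem.simple_induction_left with
  | one => simp
  | mul_simple_left g s ih =>
    have e : ∀ v, rep hM (M.toCoxeterSystem.simple s * g) v = sg M s (rep hM g v) := by
      intro v
      rw [← rep_sr hM, map_mul]; rfl
    rw [e, e, e, cx_sg]
    rcases ih with h | h <;> rw [h]
    · exact Or.inr rfl
    · left; rw [map_neg, neg_neg]

theorem cx_al {x y z : Fin 3} (hxy : x ≠ y) (hxz : x ≠ z) (hyz : y ≠ z) :
    cx M (al x) (al y) = om M x y z ∨ cx M (al x) (al y) = - om M x y z := by
  obtain ⟨ε, h1, hε⟩ := cx_form (M := M) hxy hxz hyz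
  obtain ⟨a1, a2, a3⟩ := hε (al x) (al y)
  obtain ⟨o1, o2, o3⟩ := om_apply (M := M) hxy hxz hyz
  have e : cx M (al x) (al y) = ε • om M x y z := by
    simp only [bd_al, cc_diag, cc_symm M y x, cc_symm M z x, cc_symm M z y] at a1 a2 a3
    apply ext3 hxy hxz hyz <;> simp only [Pi.smul_apply, smul_eq_mul, o1, o2, o3, a1, a2, a3] <;> ring
  rw [e]
  rcases h1 with rfl | rfl <;> simp

/-- minor -/
noncomputable def dD (hM : Big M) (x1 y1 x2 y2 : Fin 3) (g : M.Group) : ℝ :=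
  bd M x1 (rep hM g (al x2)) * bd M y1 (rep hM g (al y2)) - bd M y1 (rep hM g (al x2)) * bd M x1 (rep hM g (al y2))

theorem dD_eq (hM : Big M) {x1 y1 z1 x2 y2 z2 : Fin 3} (hxy : x1 ≠ y1) (hxz : x1 ≠ z1) (hyz : y1 ≠ z1)
    (hxy2 : x2 ≠ y2) (hxz2 : x2 ≠ z2) (hyz2 : y2 ≠ z2) (g : M.Group) :
    |dD hM x1 y1 x2 y2 g| = |rep hM g (om M x2 y2 z2) z1| := by
  obtain ⟨ε, h1, hε⟩ := cx_form (M := M) hxy hxz hyz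
  obtain ⟨a1, -, -⟩ := hε (rep hM g (al x2)) (rep hM g (al y2))
  have a2 : |dD hM x1 y1 x2 y2 g| = |cx M (rep hM g (al x2)) (rep hM g (al y2)) z1| := by
    rw [a1]; unfold dD
    rcases h1 with rfl | rfl
    · rw [one_mul]
    · rw [neg_one_mul, abs_neg]
  rw [a2]
  rcases cx_rep hM g (al x2) (al y2) with h | h <;> rcases cx_al (M := M) hxy2 hxz2 hyz2 with h' | h' <;>
    rw [h, h'] <;> simp

/-- trace -/
noncomputable def tr : Module.End ℝ V →ₗ[ℝ] ℝ := LinearMap.trace ℝ V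

theorem tr_comm (A B : Module.End ℝ V) : tr (A * B) = tr (B * A) := LinearMap.trace_mul_comm ℝ A B
theorem tr_rank (f : V →ₗ[ℝ] ℝ) (v : V) : tr (f.smulRight v) = f v := LinearMap.trace_smulRight f v
theorem tr_one : tr 1 = 3 := by
  unfold tr
  rw [LinearMap.trace_one]; simp

theorem rank_mul (f : V →ₗ[ℝ] ℝ) (v : V) (A : Module.End ℝ V) : (A * f.smulRight v : Module.End ℝ V) = f.smulRight (A v) := by
  apply LinearMap.ext; intro w; simp

theorem tr_Nn (x y : Fin 3) : tr (Nn M x y) = 0 := by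
  unfold Nn; rw [map_sub, tr_rank, tr_rank, bd_al, bd_al, cc_symm M y x, sub_self]

theorem tr_Nn_sq {x y z : Fin 3} (hxy : x ≠ y) (hxz : x ≠ z) (hyz : y ≠ z) :
    tr (Nn M x y * Nn M x y) = - 2 * (4 - cc M x y ^ 2) := by
  rw [Nn_sq hxy hxz hyz, map_add, map_smul, tr_one, tr_rank, LinearMap.proj_apply, (om_apply hxy hxz hyz).1, smul_eq_mul]
  ring

theorem tr_conj (hM : Big M) (g : M.Group) (A : Module.End ℝ V) : tr (rep hM g * A * rep hM g⁻¹) = tr A := by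
  rw [tr_comm, ← mul_assoc, ← map_mul]; simp

theorem t3 (hM : Big M) (x1 y1 x2 y2 : Fin 3) (g : M.Group) :
    tr (Nn M x1 y1 * (rep hM g * Nn M x2 y2 * rep hM g⁻¹)) = -2 * dD hM x1 y1 x2 y2 g := by
  have e : ∀ k l, bd M k (rep hM g⁻¹ (al l)) = bd M l (rep hM g (al k)) := by
    intro k l
    rw [← bil_al, bil_symm, bil_rep_inv, bil_al]
  have e2 : tr (Nn M x1 y1 * (rep hM g * Nn M x2 y2 * rep hM g⁻¹)) = tr ((rep hM g * Nn M x2 y2 * rep hM g⁻¹) * Nn M x1 y1) :=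
    tr_comm _ _
  rw [e2, Nn.eq_def M x1 y1, mul_sub, map_sub, rank_mul, rank_mul, tr_rank, tr_rank]
  simp only [Module.End.mul_apply, Nn_apply, map_sub, map_smul, e, smul_eq_mul]
  unfold dD
  ring

theorem t5 (hM : Big M) {x1 y1 z1 : Fin 3} (hxy : x1 ≠ y1) (hxz : x1 ≠ z1) (hyz : y1 ≠ z1) (x2 y2 : Fin 3) (g : M.Group) :
    tr (Nn M x1 y1 * Nn M x1 y1 * (rep hM g * Nn M x2 y2 * rep hM g⁻¹)) = 0 := by
  have e : ∀ k, bd M k (rep hM g⁻¹ (om M x1 y1 z1)) = dE M 0 1 2 * rep hM g (al k) z1 := by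
    intro k
    rw [← bil_al, bil_symm, bil_rep_inv, bil_symm, bil_om hxy hxz hyz]
  rw [tr_comm, Nn_sq hxy hxz hyz, mul_add, map_add, rank_mul, tr_rank, mul_smul_comm, map_smul, mul_one, tr_conj, tr_Nn]
  simp only [Module.End.mul_apply, Nn_apply, map_sub, map_smul, e, LinearMap.proj_apply, Pi.sub_apply, Pi.smul_apply, smul_eq_mul]
  ring

theorem om_pair (hM : Big M) {x1 y1 z1 x2 y2 z2 : Fin 3} (hxy : x1 ≠ y1) (hxz : x1 ≠ z1) (hyz : y1 ≠ z1)
    (hxy2 : x2 ≠ y2) (hxz2 : x2 ≠ z2) (hyz2 : y2 ≠ z2) (g : M.Group) :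
    rep hM g⁻¹ (om M x1 y1 z1) z2 = rep hM g (om M x2 y2 z2) z1 := by
  have h1 := bil_om (M := M) hxy2 hxz2 hyz2 (rep hM g⁻¹ (om M x1 y1 z1))
  rw [bil_rep_inv, bil_symm, bil_om hxy hxz hyz] at h1
  exact (mul_left_cancel₀ (by linarith [dE_pos hM]) h1).symm

theorem t4 (hM : Big M) {x1 y1 z1 x2 y2 z2 : Fin 3} (hxy : x1 ≠ y1) (hxz : x1 ≠ z1) (hyz : y1 ≠ z1)
    (hxy2 : x2 ≠ y2) (hxz2 : x2 ≠ z2) (hyz2 : y2 ≠ z2) (g : M.Group) :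
    tr (Nn M x1 y1 * Nn M x1 y1 * (rep hM g * (Nn M x2 y2 * Nn M x2 y2) * rep hM g⁻¹)) =
      (4 - cc M x1 y1 ^ 2) * (4 - cc M x2 y2 ^ 2) + (rep hM g (om M x2 y2 z2) z1) ^ 2 := by
  rw [tr_comm, Nn_sq hxy hxz hyz, mul_add, map_add, rank_mul, tr_rank, mul_smul_comm, map_smul, mul_one, tr_conj,
    tr_Nn_sq hxy2 hxz2 hyz2, Nn_sq hxy2 hxz2 hyz2]
  simp only [Module.End.mul_apply, LinearMap.add_apply, LinearMap.smul_apply, Module.End.one_apply,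
    LinearMap.smulRight_apply, LinearMap.proj_apply, map_add, map_smul, Pi.add_apply, Pi.smul_apply, smul_eq_mul,
    om_pair hM hxy hxz hyz hxy2 hxz2 hyz2, rep_inv_right, (om_apply hxy hxz hyz).1]
  ring

theorem sin_cc (x y : Fin 3) : 4 - cc M x y ^ 2 = 4 * Real.sin (Real.pi / M x y) ^ 2 := by
  have := Real.sin_sq_add_cos_sq (Real.pi / M x y)
  unfold cc
  linear_combination (-4) * this

theorem sin_th_pos (hM : Big M) {x y : Fin 3} (hxy : x ≠ y) : 0 < Real.sin (Real.pi / M x y) := by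
  have hth := angle_pos hM hxy
  exact Real.sin_pos_of_pos_of_lt_pi hth.1 (by linarith [Real.pi_pos])

theorem tr_rot (hM : Big M) {x y : Fin 3} (hxy : x ≠ y) (p : ℕ) (g : M.Group) :
    tr (rep hM (g * (sr x * sr y) ^ p * g⁻¹)) ≤ 3 := by
  obtain ⟨z, hxz, hyz⟩ := exists_third hxy
  rw [map_mul (rep hM), map_mul (rep hM), tr_conj, rot hM hxy, map_add, map_add, map_smul, map_smul, tr_one, tr_Nn, tr_Nn_sq hxy hxz hyz,
    sin_cc]
  have := sin_th_pos hM hxy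
  have h2 : 0 ≤ Real.sin (p * (Real.pi / M x y)) ^ 2 / (2 * Real.sin (Real.pi / M x y) ^ 2) := by positivity
  simp only [smul_eq_mul]
  nlinarith [mul_nonneg h2 (sq_nonneg (Real.sin (Real.pi / M x y)))]

theorem tr_prod (hM : Big M) {x1 y1 z1 x2 y2 z2 : Fin 3} (hxy : x1 ≠ y1) (hxz : x1 ≠ z1) (hyz : y1 ≠ z1)
    (hxy2 : x2 ≠ y2) (hxz2 : x2 ≠ z2) (hyz2 : y2 ≠ z2) (g : M.Group) (p q : ℕ) :
    tr (rep hM ((sr x1 * sr y1) ^ p * (g * (sr x2 * sr y2) ^ q * g⁻¹))) =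
    4 * (Real.cos (p * (Real.pi / M x1 y1)) * Real.cos (q * (Real.pi / M x2 y2)) -
      dD hM x1 y1 x2 y2 g / (4 * Real.sin (Real.pi / M x1 y1) * Real.sin (Real.pi / M x2 y2)) *
      (Real.sin (p * (Real.pi / M x1 y1)) * Real.sin (q * (Real.pi / M x2 y2)))) ^ 2 - 1 := by
  have hD : dD hM x1 y1 x2 y2 g ^ 2 = (rep hM g (om M x2 y2 z2) z1) ^ 2 := by
    rw [← sq_abs, dD_eq hM hxy hxz hyz hxy2 hxz2 hyz2, sq_abs]
  have f3 := t3 hM x1 y1 x2 y2 g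
  have f4 := t4 hM hxy hxz hyz hxy2 hxz2 hyz2 g
  rw [← hD] at f4
  have f5 := t5 hM hxy hxz hyz x2 y2 g
  have f6 : tr (Nn M x1 y1 * (rep hM g * (Nn M x2 y2 * Nn M x2 y2) * rep hM g⁻¹)) = 0 := by
    have := t5 hM hxy2 hxz2 hyz2 x1 y1 g⁻¹
    rw [inv_inv] at this
    rw [← this, tr_comm]
    rw [show rep hM g * (Nn M x2 y2 * Nn M x2 y2) * rep hM g⁻¹ * Nn M x1 y1 =
      rep hM g * ((Nn M x2 y2 * Nn M x2 y2) * rep hM g⁻¹ * Nn M x1 y1) by simp only [mul_assoc], tr_comm]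
    simp only [mul_assoc]
  have f7 : tr (rep hM g * Nn M x2 y2 * rep hM g⁻¹) = 0 := by rw [tr_conj, tr_Nn]
  have f8 : tr (rep hM g * (Nn M x2 y2 * Nn M x2 y2) * rep hM g⁻¹) = - 2 * (4 - cc M x2 y2 ^ 2) := by
    rw [tr_conj, tr_Nn_sq hxy2 hxz2 hyz2]
  have f9 := tr_Nn (M := M) x1 y1
  have f10 := tr_Nn_sq (M := M) hxy hxz hyz
  have gg : rep hM g * rep hM g⁻¹ = 1 := by rw [← map_mul]; simp
  rw [map_mul (rep hM), map_mul (rep hM), map_mul (rep hM), rot hM hxy, rot hM hxy2]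
  have g1 := sin_th_pos hM hxy
  have g2 := sin_th_pos hM hxy2
  rw [sin_cc, sin_cc] at f4
  rw [sin_cc] at f8 f10
  have k1 := Real.sin_sq_add_cos_sq (p * (Real.pi / M x1 y1))
  have k2 := Real.sin_sq_add_cos_sq (q * (Real.pi / M x2 y2))
  generalize Real.sin (p * (Real.pi / M x1 y1)) = S1 at *
  generalize Real.cos (p * (Real.pi / M x1 y1)) = K1 at *
  generalize Real.sin (q * (Real.pi / M x2 y2)) = S2 at *
  generalize Real.cos (q * (Real.pi / M x2 y2)) = K2 at *
  generalize Real.sin (Real.pi / M x1 y1) = s1 at *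
  generalize Real.sin (Real.pi / M x2 y2) = s2 at *
  generalize dD hM x1 y1 x2 y2 g = D at *
  generalize Nn M x1 y1 * Nn M x1 y1 = Q1 at *
  generalize Nn M x2 y2 * Nn M x2 y2 = Q2 at *
  generalize Nn M x1 y1 = N1 at *
  generalize Nn M x2 y2 = N2 at *
  generalize rep hM g = G at *
  generalize rep hM g⁻¹ = G' at *
  simp only [mul_add, add_mul, mul_smul_comm, smul_mul_assoc, mul_one, one_mul, gg, map_add, map_smul,
    f3, f4, f5, f6, f7, f8, f9, f10, tr_one, smul_eq_mul]
  have hK1 : K1 ^ 2 = 1 - S1 ^ 2 := by linarith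
  have hK2 : K2 ^ 2 = 1 - S2 ^ 2 := by linarith
  field_simp
  grind

end Tri

namespace Tri
open CoxeterSystem
variable {M : CoxeterMatrix (Fin 3)}

theorem xy_pow (x y : Fin 3) : (sr x * sr y : M.Group) ^ (M x y) = 1 :=
  M.toCoxeterSystem.simple_mul_simple_pow x y

theorem par_xy (x y : Fin 3) : par (sr x * sr y : M.Group) = 1 := by
  rw [map_mul, par_sr, par_sr, par_sq]

theorem fin_conj {G : Type*} [Group G] (g h : G) (hh : IsOfFinOrder h) : IsOfFinOrder (g * h * g⁻¹) :=
  (MulAut.conj g).toMonoidHom.isOfFinOrder hh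

theorem torsionN (hM : Big M) (h : M.Group) (hh : IsOfFinOrder h) (hp : par h = 1) (h1 : h ≠ 1) :
    ∃ (g : M.Group) (x y : Fin 3) (p : ℕ), x ≠ y ∧ (1 ≤ p ∧ 2 * p ≤ M x y) ∧ h = g * (sr x * sr y) ^ p * g⁻¹ := by
  obtain ⟨g, x, y, m, hxy, e⟩ := torsion hM h hh hp
  have hm := hM x y hxy
  obtain ⟨r, hr⟩ : ∃ r : ℕ, (r : ℤ) = m % (M x y : ℤ) :=
    ⟨(m % (M x y : ℤ)).toNat, Int.toNat_of_nonneg (Int.emod_nonneg _ (by omega))⟩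
  have hlt : r < M x y := by
    have := Int.emod_lt_of_pos m (show (0 : ℤ) < M x y by omega)
    omega
  have e2 : (sr x * sr y : M.Group) ^ m = (sr x * sr y) ^ r := by
    rw [← zpow_natCast, hr, ← Int.mul_ediv_add_emod m (M x y), zpow_add, zpow_mul, zpow_natCast, xy_pow]
    simp
  rw [e2] at e
  have hr0 : r ≠ 0 := by
    rintro rfl
    exact h1 (by rw [e]; simp)
  by_cases h2 : 2 * r ≤ M x y
  · exact ⟨g, x, y, r, hxy, ⟨by omega, h2⟩, e⟩
  · refine ⟨g, y, x, M x y - r, hxy.symm, ⟨by omega, by rw [M.symmetric y x]; omega⟩, ?_⟩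
    rw [e]
    have : (sr y * sr x : M.Group) = (sr x * sr y)⁻¹ := by simp
    rw [this, inv_pow]
    have : (sr x * sr y : M.Group) ^ r * (sr x * sr y) ^ (M x y - r) = 1 := by
      rw [← pow_add, Nat.add_sub_cancel' hlt.le, xy_pow]
    rw [eq_inv_of_mul_eq_one_left this]

theorem tr_tors (hM : Big M) (h : M.Group) (hh : IsOfFinOrder h) (hp : par h = 1) : tr (rep hM h) ≤ 3 := by
  by_cases h1 : h = 1
  · rw [h1, map_one (rep hM), tr_one]
  · obtain ⟨g, x, y, p, hxy, -, rfl⟩ := torsionN hM h hh hp h1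
    exact tr_rot hM hxy p g

theorem sin_ge1 (hM : Big M) {x y : Fin 3} (hxy : x ≠ y) {p : ℕ} (hp : 1 ≤ p ∧ 2 * p ≤ M x y) :
    Real.sin (Real.pi / M x y) ≤ Real.sin (p * (Real.pi / M x y)) := by
  have hm := hM x y hxy
  have hth := (angle_pos hM hxy).1
  have h1 : (1 : ℝ) ≤ p := by exact_mod_cast hp.1
  have h2 : (2 : ℝ) * p ≤ M x y := by exact_mod_cast hp.2
  have h3 : (0 : ℝ) < M x y := by positivity
  apply Real.sin_le_sin_of_le_of_le_pi_div_two
  · linarith [Real.pi_pos]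
  · rw [← mul_div_assoc, div_le_div_iff₀ h3 (by norm_num)]
    nlinarith [Real.pi_pos]
  · nlinarith

theorem sin_ge2 (hM : Big M) {x y : Fin 3} (hxy : x ≠ y) {p : ℕ} (hp : 2 ≤ p ∧ 2 * p ≤ M x y) :
    √3 * Real.sin (Real.pi / M x y) ≤ Real.sin (p * (Real.pi / M x y)) := by
  have hm := hM x y hxy
  have hth := (angle_pos hM hxy).1
  have h1 : (2 : ℝ) ≤ p := by exact_mod_cast hp.1
  have h2 : (2 : ℝ) * p ≤ M x y := by exact_mod_cast hp.2
  have h3 : (0 : ℝ) < M x y := by positivity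
  have h4 : Real.sin (2 * (Real.pi / M x y)) ≤ Real.sin (p * (Real.pi / M x y)) := by
    apply Real.sin_le_sin_of_le_of_le_pi_div_two
    · linarith [Real.pi_pos]
    · rw [← mul_div_assoc, div_le_div_iff₀ h3 (by norm_num)]
      nlinarith [Real.pi_pos]
    · nlinarith
  have h5 := cc_ge hM hxy
  unfold cc at h5
  rw [Real.sin_two_mul] at h4
  nlinarith [sin_th_pos hM hxy]

theorem ineq (hM : Big M) {x1 y1 z1 x2 y2 z2 : Fin 3} (hxy : x1 ≠ y1) (hxz : x1 ≠ z1) (hyz : y1 ≠ z1)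
    (hxy2 : x2 ≠ y2) (hxz2 : x2 ≠ z2) (hyz2 : y2 ≠ z2) (g : M.Group) {p q : ℕ} (hp : 1 ≤ p ∧ 2 * p ≤ M x1 y1)
    (hq : 1 ≤ q ∧ 2 * q ≤ M x2 y2)
    (ht : IsOfFinOrder ((sr x1 * sr y1) ^ p * (g * (sr x2 * sr y2) ^ q * g⁻¹))) :
    rep hM g (om M x2 y2 z2) z1 ≤ 8 ∧ ((2 ≤ p ∨ 2 ≤ q) → √3 * rep hM g (om M x2 y2 z2) z1 ≤ 8) := by
  have h1 := tr_tors hM _ ht (by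
    simp only [map_mul, map_pow, par_sr, par_sq, one_pow, mul_one, one_mul, ← map_mul par g, mul_inv_cancel, map_one])
  rw [tr_prod hM hxy hxz hyz hxy2 hxz2 hyz2] at h1
  have hD := dD_eq hM hxy hxz hyz hxy2 hxz2 hyz2 g
  have a1 := sin_th_pos hM hxy
  have a2 := sin_th_pos hM hxy2
  have b1 := sin_ge1 hM hxy hp
  have b2 := sin_ge1 hM hxy2 hq
  have k1 := abs_le.1 (Real.abs_cos_le_one (p * (Real.pi / M x1 y1)))
  have k2 := abs_le.1 (Real.abs_cos_le_one (q * (Real.pi / M x2 y2)))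
  have key : |rep hM g (om M x2 y2 z2) z1| * (Real.sin (p * (Real.pi / M x1 y1)) * Real.sin (q * (Real.pi / M x2 y2))) ≤
      8 * (Real.sin (Real.pi / M x1 y1) * Real.sin (Real.pi / M x2 y2)) := by
    rw [← hD]
    generalize dD hM x1 y1 x2 y2 g = D at *
    have c1 : |Real.cos (p * (Real.pi / M x1 y1)) * Real.cos (q * (Real.pi / M x2 y2)) -
      D / (4 * Real.sin (Real.pi / M x1 y1) * Real.sin (Real.pi / M x2 y2)) *
      (Real.sin (p * (Real.pi / M x1 y1)) * Real.sin (q * (Real.pi / M x2 y2)))| ≤ 1 := by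
      rw [← sq_le_one_iff_abs_le_one]; linarith
    have c2 : |Real.cos (p * (Real.pi / M x1 y1)) * Real.cos (q * (Real.pi / M x2 y2))| ≤ 1 := by
      rw [abs_mul]
      exact mul_le_one₀ (Real.abs_cos_le_one _) (abs_nonneg _) (Real.abs_cos_le_one _)
    have c3 : |D / (4 * Real.sin (Real.pi / M x1 y1) * Real.sin (Real.pi / M x2 y2)) *
      (Real.sin (p * (Real.pi / M x1 y1)) * Real.sin (q * (Real.pi / M x2 y2)))| ≤ 2 := by
      rw [abs_le] at *
      constructor <;> linarith [c1.1, c1.2, c2.1, c2.2]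
    generalize Real.sin (p * (Real.pi / M x1 y1)) = S1 at *
    generalize Real.sin (q * (Real.pi / M x2 y2)) = S2 at *
    generalize Real.sin (Real.pi / M x1 y1) = s1 at *
    generalize Real.sin (Real.pi / M x2 y2) = s2 at *
    have p1 : 0 < S1 := by linarith
    have p2 : 0 < S2 := by linarith
    rw [abs_mul, abs_div, abs_of_pos (show 0 < 4 * s1 * s2 by positivity), abs_of_pos (show 0 < S1 * S2 by positivity),
      div_mul_eq_mul_div, div_le_iff₀ (by positivity)] at c3
    linarith
  have le := le_abs_self (rep hM g (om M x2 y2 z2) z1)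
  have ge := abs_nonneg (rep hM g (om M x2 y2 z2) z1)
  have hs3 : 0 ≤ √3 := Real.sqrt_nonneg 3
  have fin : ∀ t : ℝ, 0 ≤ t → t * (Real.sin (Real.pi / M x1 y1) * Real.sin (Real.pi / M x2 y2)) ≤
      Real.sin (p * (Real.pi / M x1 y1)) * Real.sin (q * (Real.pi / M x2 y2)) →
      t * rep hM g (om M x2 y2 z2) z1 ≤ 8 := by
    intro t ht0 h
    have hpos : 0 < Real.sin (Real.pi / M x1 y1) * Real.sin (Real.pi / M x2 y2) := by positivity
    have : t * |rep hM g (om M x2 y2 z2) z1| ≤ 8 := by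
      refine le_of_mul_le_mul_right ?_ hpos
      calc _ = |rep hM g (om M x2 y2 z2) z1| * (t * (Real.sin (Real.pi / M x1 y1) * Real.sin (Real.pi / M x2 y2))) := by ring
        _ ≤ _ := mul_le_mul_of_nonneg_left h ge
        _ ≤ _ := key
    exact (mul_le_mul_of_nonneg_left le ht0).trans this
  constructor
  · have := fin 1 (by norm_num) (by rw [one_mul]; exact mul_le_mul b1 b2 a2.le (a1.le.trans b1))
    linarith
  · rintro (h | h)
    · apply fin _ hs3
      rw [← mul_assoc]
      exact mul_le_mul (sin_ge2 hM hxy ⟨h, hp.2⟩) b2 a2.le (a1.le.trans b1)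
    · apply fin _ hs3
      rw [mul_left_comm]
      exact mul_le_mul b1 (sin_ge2 hM hxy2 ⟨h, hq.2⟩) (by positivity) (a1.le.trans b1)

theorem om_sg {x y z : Fin 3} (hxy : x ≠ y) (hxz : x ≠ z) (hyz : y ≠ z) (s : Fin 3) :
    sg M s (om M x y z) = om M x y z + (dE M 0 1 2 * al z s) • al s := by
  rw [sg_bd, bd_om hxy hxz hyz]

theorem rep_mul_sr (hM : Big M) (w : M.Group) (s : Fin 3) (v : V) : rep hM w v = rep hM (w * sr s) (sg M s v) := by
  rw [← rep_sr hM, ← Module.End.mul_apply, ← map_mul (rep hM)]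
  simp

theorem om_nonneg (hM : Big M) {x y z : Fin 3} (hxy : x ≠ y) (hxz : x ≠ z) (hyz : y ≠ z) (w : M.Group) :
    ∀ l, 0 ≤ rep hM w (om M x y z) l := by
  have hE := dE_pos hM
  induction hn : len w using Nat.strong_induction_on generalizing w with
  | _ n ih =>
    by_cases h : w = 1
    · subst h
      have c1 := cc_ge hM hxy
      have c2 := cc_ge hM hxz
      have c3 := cc_ge hM hyz
      have c4 := cc_le (M := M) x y
      have c5 := sq3
      have e := om_apply (M := M) hxy hxz hyz
      intro l
      rw [map_one (rep hM), Module.End.one_apply]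
      rcases cases3 hxy hxz hyz l with rfl | rfl | rfl
      · rw [e.2.1]; nlinarith
      · rw [e.2.2]; nlinarith
      · rw [e.1]; nlinarith
    · obtain ⟨s, hs⟩ := exists_desc h
      intro l
      have i1 := ih (len (w * sr s)) (by rw [← hn]; exact hs) (w * sr s) rfl l
      have i2 := (rt_pos' hM (not_desc_mul hs)).nonneg l
      rw [rep_mul_sr hM w s, om_sg hxy hxz hyz, map_add, map_smul]
      have i3 : 0 ≤ (al z s : ℝ) := by
        by_cases hz : s = z
        · subst hz; simp
        · rw [al_ne hz]
      have : 0 ≤ dE M 0 1 2 * al z s * rt hM (w * sr s) s l := by positivity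
      simp only [Pi.add_apply, Pi.smul_apply, smul_eq_mul]
      unfold rt at this
      linarith

theorem H_ge (hM : Big M) {x1 y1 z1 x2 y2 z2 : Fin 3} (hxy : x1 ≠ y1) (hxz : x1 ≠ z1) (hyz : y1 ≠ z1)
    (hxy2 : x2 ≠ y2) (hxz2 : x2 ≠ z2) (hyz2 : y2 ≠ z2) (g : M.Group) (h1 : ¬ Desc g x2) (h2 : ¬ Desc g y2)
    (h3 : Desc g⁻¹ z1) : 20 ≤ rep hM g (om M x2 y2 z2) z1 := by
  have hE := dE_pos hM
  rw [← om_pair hM hxy hxz hyz hxy2 hxz2 hyz2, rep_mul_sr hM g⁻¹ z1, om_sg hxy hxz hyz, map_add, map_smul]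
  have a := om_nonneg hM hxy hxz hyz (g⁻¹ * sr z1) z2
  have b := rt_pos' hM (not_desc_mul h3)
  simp only [Pi.add_apply, Pi.smul_apply, smul_eq_mul, al_same]
  rcases b z2 with h | h
  · exfalso
    have e1 : rep hM g (rt hM (g⁻¹ * sr z1) z1) = - al z1 := by
      unfold rt
      rw [← Module.End.mul_apply, ← map_mul (rep hM), mul_inv_cancel_left, rep_sr, sg_al, cc_diag]
      module
    have e2 : rt hM (g⁻¹ * sr z1) z1 = rt hM (g⁻¹ * sr z1) z1 x2 • al x2 + rt hM (g⁻¹ * sr z1) z1 y2 • al y2 := by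
      apply ext3 hxy2 hxz2 hyz2 <;>
        simp [al_ne, hxy2, hxy2.symm, hxz2.symm, hyz2.symm, h]
    rw [e2, map_add, map_smul, map_smul] at e1
    have e3 := congrFun e1 z1
    have c1 := (rt_pos' hM h1).nonneg z1
    have c2 := (rt_pos' hM h2).nonneg z1
    have c3 := mul_nonneg (b.nonneg x2) c1
    have c4 := mul_nonneg (b.nonneg y2) c2
    simp only [Pi.add_apply, Pi.smul_apply, smul_eq_mul, al_same, Pi.neg_apply] at e3
    unfold rt at c3 c4 e3
    linarith
  · unfold rt at h
    nlinarith

end Tri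

namespace Tri
open CoxeterSystem
variable {M : CoxeterMatrix (Fin 3)}

theorem swapX (x y : Fin 3) (p : ℕ) (g : M.Group) :
    g * (sr x * sr y) ^ p * g⁻¹ = (g * sr x) * (sr y * sr x) ^ p * (g * sr x)⁻¹ := by
  have h : SemiconjBy (sr x : M.Group) (sr y * sr x) (sr x * sr y) := by simp [SemiconjBy, mul_assoc]
  have h2 := (h.pow_right p).eq
  rw [mul_assoc g (sr x), h2]
  simp [mul_assoc]

theorem swapY (x y : Fin 3) (p : ℕ) (g : M.Group) :
    g * (sr x * sr y) ^ p * g⁻¹ = (g * sr y) * (sr y * sr x) ^ p * (g * sr y)⁻¹ := by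
  have h : SemiconjBy (sr y : M.Group) (sr y * sr x) (sr x * sr y) := by simp [SemiconjBy]
  have h2 := (h.pow_right p).eq
  rw [mul_assoc g (sr y), h2]
  simp [mul_assoc]

theorem exists_perm {x y z : Fin 3} (hxy : x ≠ y) (hxz : x ≠ z) (hyz : y ≠ z) :
    ∃ p : Equiv.Perm (Fin 3), p 0 = x ∧ p 1 = y ∧ p 2 = z := by
  revert x y z; decide

theorem inf_yxyz (hM : Big M) {x y z : Fin 3} (hxy : x ≠ y) (hxz : x ≠ z) (hyz : y ≠ z) :
    ¬ IsOfFinOrder (sr y * sr x * sr y * sr z : M.Group) := by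
  obtain ⟨p, rfl, rfl, rfl⟩ := exists_perm hxy hxz hyz
  intro h
  obtain ⟨n, hn, h1⟩ := isOfFinOrder_iff_pow_eq_one.1 h
  have h2 := wp_pw (M := M) p n [Gap.X]
  have h3 : wp (M := M) ((fl [Gap.X]).map p) = sr (p 1) * sr (p 0) * sr (p 1) * sr (p 2) := by
    simp [fl, Gap.w, Gap.u, mul_assoc]
  rw [h3, h1] at h2
  refine wp_fl_ne_one hM p ?_ h2
  obtain ⟨m, rfl⟩ := Nat.exists_eq_succ_of_ne_zero hn.ne'
  simp [pw_succ]

theorem thmC (hM : Big M) (u v : M.Group) (hu : IsOfFinOrder u) (hv : IsOfFinOrder v) (huv : IsOfFinOrder (u * v))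
    (pu : par u = 1) (pv : par v = 1) (u1 : u ≠ 1) (v1 : v ≠ 1) (hinf : ¬ IsOfFinOrder (u * v⁻¹)) :
    ∃ (g : M.Group) (x y z : Fin 3), x ≠ y ∧ x ≠ z ∧ y ≠ z ∧ u = g * (sr x * sr y) * g⁻¹ ∧
      v = g * (sr y * sr z) * g⁻¹ := by
  classical
  have ex : ∃ n : ℕ, ∃ (g1 g2 : M.Group) (x1 y1 x2 y2 : Fin 3) (p q : ℕ), x1 ≠ y1 ∧ x2 ≠ y2 ∧
      (1 ≤ p ∧ 2 * p ≤ M x1 y1) ∧ (1 ≤ q ∧ 2 * q ≤ M x2 y2) ∧ u = g1 * (sr x1 * sr y1) ^ p * g1⁻¹ ∧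
      v = g2 * (sr x2 * sr y2) ^ q * g2⁻¹ ∧ len (g1⁻¹ * g2) = n := by
    obtain ⟨g1, x1, y1, p, h1, h2, h3⟩ := torsionN hM u hu pu u1
    obtain ⟨g2, x2, y2, q, h4, h5, h6⟩ := torsionN hM v hv pv v1
    exact ⟨_, g1, g2, x1, y1, x2, y2, p, q, h1, h4, h2, h5, h3, h6, rfl⟩
  have min := fun m hm => Nat.find_min (m := m) ex hm
  obtain ⟨g1, g2, x1, y1, x2, y2, p, q, hxy, hxy2, hp, hq, eu, ev, el⟩ := Nat.find_spec ex
  rw [← el] at min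
  have dx2 : ¬ Desc (g1⁻¹ * g2) x2 := fun hd => min _ hd
    ⟨g1, g2 * sr x2, x1, y1, y2, x2, p, q, hxy, hxy2.symm, hp, by rwa [M.symmetric], eu, by rw [ev, swapX],
      by rw [mul_assoc]⟩
  have dy2 : ¬ Desc (g1⁻¹ * g2) y2 := fun hd => min _ hd
    ⟨g1, g2 * sr y2, x1, y1, y2, x2, p, q, hxy, hxy2.symm, hp, by rwa [M.symmetric], eu, by rw [ev, swapY],
      by rw [mul_assoc]⟩
  have li : ∀ w : M.Group, len w⁻¹ = len w := fun w => M.toCoxeterSystem.length_inv w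
  have dx1 : ¬ Desc (g1⁻¹ * g2)⁻¹ x1 := fun hd => min (len ((g1⁻¹ * g2)⁻¹ * sr x1)) (by rw [← li (g1⁻¹ * g2)]; exact hd)
    ⟨g1 * sr x1, g2, y1, x1, x2, y2, p, q, hxy.symm, hxy2, by rwa [M.symmetric], hq, by rw [eu, swapX], ev,
      by rw [← li]; simp [mul_assoc]⟩
  have dy1 : ¬ Desc (g1⁻¹ * g2)⁻¹ y1 := fun hd => min (len ((g1⁻¹ * g2)⁻¹ * sr y1)) (by rw [← li (g1⁻¹ * g2)]; exact hd)
    ⟨g1 * sr y1, g2, y1, x1, x2, y2, p, q, hxy.symm, hxy2, by rwa [M.symmetric], hq, by rw [eu, swapY], ev,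
      by rw [← li]; simp [mul_assoc]⟩
  obtain ⟨z1, hxz, hyz⟩ := exists_third hxy
  obtain ⟨z2, hxz2, hyz2⟩ := exists_third hxy2
  have tor : IsOfFinOrder ((sr x1 * sr y1) ^ p * ((g1⁻¹ * g2) * (sr x2 * sr y2) ^ q * (g1⁻¹ * g2)⁻¹)) := by
    have := fin_conj g1⁻¹ _ huv
    rw [eu, ev] at this
    convert this using 1
    group
  obtain ⟨I1, I2⟩ := ineq hM hxy hxz hyz hxy2 hxz2 hyz2 (g1⁻¹ * g2) hp hq tor
  by_cases hg : g1⁻¹ * g2 = 1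
  swap
  · exfalso
    have hg' : (g1⁻¹ * g2)⁻¹ ≠ 1 := by rwa [Ne, inv_eq_one]
    obtain ⟨s, hs⟩ := exists_desc hg'
    rcases cases3 hxy hxz hyz s with rfl | rfl | rfl
    · exact dx1 hs
    · exact dy1 hs
    · linarith [H_ge hM hxy hxz hyz hxy2 hxz2 hyz2 _ dx2 dy2 hs]
  have e12 : g2 = g1 := by rw [inv_mul_eq_one] at hg; exact hg.symm
  subst e12
  by_cases hz : z1 = z2
  · exfalso
    apply hinf
    refine Commute.isOfFinOrder_mul ?_ hu hv.inv
    apply Commute.inv_right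
    have : Commute ((sr x1 * sr y1 : M.Group) ^ p) ((sr x2 * sr y2) ^ q) := by
      apply Commute.pow_pow
      subst hz
      have h3 : (x2 = x1 ∧ y2 = y1) ∨ (x2 = y1 ∧ y2 = x1) := by
        clear * - hxy hxz hyz hxy2 hxz2 hyz2
        revert x1 y1 x2 y2 z1; decide
      rcases h3 with ⟨rfl, rfl⟩ | ⟨rfl, rfl⟩
      · exact Commute.refl _
      · simp [Commute, SemiconjBy, mul_assoc]
    rw [eu, ev]
    exact this.map (MulAut.conj g2)
  have om_big : 3 + 2 * √3 ≤ rep hM (g2⁻¹ * g2) (om M x2 y2 z2) z1 := by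
    rw [hg, map_one (rep hM), Module.End.one_apply]
    have e := om_apply (M := M) hxy2 hxz2 hyz2
    have c1 := cc_ge hM hxy2
    have c2 := cc_ge hM hxz2
    have c3 := cc_ge hM hyz2
    have c0 : √3 * √3 = 3 := Real.mul_self_sqrt (by norm_num)
    have c5 := Real.sqrt_nonneg 3
    rcases cases3 hxy2 hxz2 hyz2 z1 with h | h | h
    · rw [h, e.2.1]; nlinarith
    · rw [h, e.2.2]; nlinarith
    · exact absurd h hz
  have s3 := sq3
  have hp1 : p = 1 := by
    by_contra h
    have := I2 (Or.inl (by omega))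
    nlinarith
  have hq1 : q = 1 := by
    by_contra h
    have := I2 (Or.inr (by omega))
    nlinarith
  subst hp1 hq1
  rw [pow_one] at eu ev
  rw [hg, pow_one, pow_one, one_mul, inv_one, mul_one] at tor
  have h4 : y1 = x2 ∨ (x1 = y2 ∧ y1 ≠ x2) ∨ y1 = y2 ∨ x1 = x2 := by
    clear * - hxy hxz hyz hxy2 hxz2 hyz2 hz
    revert x1 y1 x2 y2 z1 z2; decide
  rcases h4 with rfl | ⟨rfl, hne⟩ | rfl | rfl
  · refine ⟨g2, x1, y1, y2, hxy, ?_, hxy2, eu, ev⟩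
    rintro rfl
    apply hz
    clear * - hxy hxz hyz hxz2 hyz2
    revert x1 y1 z1 z2; decide
  · refine ⟨g2 * sr x1, y1, x1, x2, hxy.symm, hne, hxy2.symm, ?_, ?_⟩
    · rw [eu]; simp [mul_assoc]
    · rw [ev]; simp [mul_assoc]
  · exfalso
    have hne : x1 ≠ x2 := by
      rintro rfl
      apply hz
      clear * - hxy hxz hyz hxz2 hyz2
      revert x1 y1 z1 z2; decide
    apply inf_yxyz hM hxy hne hxy2.symm
    have := fin_conj (sr y1) _ tor
    convert this using 1
    simp [mul_assoc]
  · exfalso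
    have hne : y1 ≠ y2 := by
      rintro rfl
      apply hz
      clear * - hxy hxz hyz hxz2 hyz2
      revert x1 y1 z1 z2; decide
    apply inf_yxyz hM hxy.symm hne hxy2
    rwa [← mul_assoc] at tor

end Tri



namespace Tri
open CoxeterSystem
variable {M : CoxeterMatrix (Fin 3)}

theorem liftable3 {G : Type*} [Group G] (f : Fin 3 → G) (h2 : ∀ l, f l * f l = 1) (h01 : (f 0 * f 1) ^ M 0 1 = 1)
    (h12 : (f 1 * f 2) ^ M 1 2 = 1) (h02 : (f 0 * f 2) ^ M 0 2 = 1) : M.IsLiftable f := by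
  have sw : ∀ x y, (f x * f y) ^ M x y = 1 → (f y * f x) ^ M y x = 1 := by
    intro x y h
    have e : f y * f x = (f x * f y)⁻¹ := by
      rw [mul_inv_rev, inv_eq_of_mul_eq_one_left (h2 x), inv_eq_of_mul_eq_one_left (h2 y)]
    rw [e, inv_pow, M.symmetric y x, h, inv_one]
  intro x y
  fin_cases x <;> fin_cases y
  · simp [h2]
  · exact h01
  · exact h02
  · exact sw _ _ h01
  · simp [h2]
  · exact h12
  · exact sw _ _ h02
  · exact sw _ _ h12
  · simp [h2]

/-- the triangle group of a Coxeter matrix -/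
abbrev TG (M : CoxeterMatrix (Fin 3)) := TriangleGroup (M 0 1) (M 1 2) (M 0 2)

theorem tg_lift {G : Type*} [Group G] (u v : G) (h01 : u ^ M 0 1 = 1) (h12 : v ^ M 1 2 = 1)
    (h02 : (u * v) ^ M 0 2 = 1) : ∀ r ∈ triangleRels (M 0 1) (M 1 2) (M 0 2), FreeGroup.lift ![u, v] r = 1 := by
  intro r hr
  rcases hr with rfl | rfl | rfl <;> simp [h01, h12, h02]

/-- generators -/
def ta : TG M := PresentedGroup.of 0
/-- generators -/
def tb : TG M := PresentedGroup.of 1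

theorem ta_pow : (ta : TG M) ^ M 0 1 = 1 := by
  have : PresentedGroup.mk (triangleRels (M 0 1) (M 1 2) (M 0 2)) (FreeGroup.of 0 ^ M 0 1) = 1 :=
    (PresentedGroup.mk_eq_one_iff).2 (Subgroup.subset_normalClosure (by simp [triangleRels]))
  rwa [map_pow] at this

theorem tb_pow : (tb : TG M) ^ M 1 2 = 1 := by
  have : PresentedGroup.mk (triangleRels (M 0 1) (M 1 2) (M 0 2)) (FreeGroup.of 1 ^ M 1 2) = 1 :=
    (PresentedGroup.mk_eq_one_iff).2 (Subgroup.subset_normalClosure (by simp [triangleRels]))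
  rwa [map_pow] at this

theorem tab_pow : (ta * tb : TG M) ^ M 0 2 = 1 := by
  have : PresentedGroup.mk (triangleRels (M 0 1) (M 1 2) (M 0 2)) ((FreeGroup.of 0 * FreeGroup.of 1) ^ M 0 2) = 1 :=
    (PresentedGroup.mk_eq_one_iff).2 (Subgroup.subset_normalClosure (by simp [triangleRels]))
  rwa [map_pow, map_mul] at this

theorem tg_ext {G : Type*} [Group G] {f g : TG M →* G} (h1 : f ta = g ta) (h2 : f tb = g tb) : f = g := by
  apply PresentedGroup.ext
  intro x
  fin_cases x
  · exact h1
  · exact h2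

theorem tg_exists {G : Type*} [Group G] (u v : G) (h01 : u ^ M 0 1 = 1) (h12 : v ^ M 1 2 = 1)
    (h02 : (u * v) ^ M 0 2 = 1) : ∃ f : TG M →* G, f ta = u ∧ f tb = v :=
  ⟨PresentedGroup.toGroup (tg_lift u v h01 h12 h02), PresentedGroup.toGroup.of _, PresentedGroup.toGroup.of _⟩

theorem w_exists {G : Type*} [Group G] (f : Fin 3 → G) (h2 : ∀ l, f l * f l = 1) (h01 : (f 0 * f 1) ^ M 0 1 = 1)
    (h12 : (f 1 * f 2) ^ M 1 2 = 1) (h02 : (f 0 * f 2) ^ M 0 2 = 1) : ∃ F : M.Group →* G, ∀ l, F (sr l) = f l :=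
  ⟨M.toCoxeterSystem.lift ⟨f, liftable3 f h2 h01 h12 h02⟩,
    fun l => M.toCoxeterSystem.lift_apply_simple (liftable3 f h2 h01 h12 h02) l⟩

theorem phi_exists (M : CoxeterMatrix (Fin 3)) : ∃ f : TG M →* M.Group, f ta = sr 0 * sr 1 ∧ f tb = sr 1 * sr 2 := by
  apply tg_exists
  · exact xy_pow 0 1
  · exact xy_pow 1 2
  · have : (sr 0 * sr 1 * (sr 1 * sr 2) : M.Group) = sr 0 * sr 2 := by simp [mul_assoc]
    rw [this]
    exact xy_pow 0 2

theorem phi_inj (f : TG M →* M.Group) (ha : f ta = sr 0 * sr 1) (hb : f tb = sr 1 * sr 2) : Function.Injective f := by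
  obtain ⟨io, ia, ib⟩ : ∃ f : TG M →* TG M, f ta = ta⁻¹ ∧ f tb = tb⁻¹ := by
    apply tg_exists
    · rw [inv_pow, ta_pow, inv_one]
    · rw [inv_pow, tb_pow, inv_one]
    · have : (ta⁻¹ * tb⁻¹ : TG M) = ta⁻¹ * (ta * tb)⁻¹ * ta⁻¹⁻¹ := by group
      rw [this, conj_pow, inv_pow, tab_pow]
      simp
  have io2 : ∀ t, io (io t) = t := by
    have : io.comp io = MonoidHom.id _ := by
      apply tg_ext <;> simp [ia, ib]
    exact fun t => DFunLike.congr_fun this t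
  let I : Equiv.Perm (TG M) := ⟨io, io, io2, io2⟩
  let L : TG M →* Equiv.Perm (TG M) := MulAction.toPermHom (TG M) (TG M)
  have hI : I * I = 1 := Equiv.ext io2
  have hL : ∀ t, I * L t = L (io t) * I := by
    intro t
    apply Equiv.ext
    intro s
    simp [I, L]
  have eta : L ta * I * I = L ta := by rw [mul_assoc, hI, mul_one]
  have etb : I * (I * L tb) = L tb := by rw [← mul_assoc, hI, one_mul]
  have etab : L ta * I * (I * L tb) = L (ta * tb) := by rw [mul_assoc, etb, map_mul]
  obtain ⟨F, hF⟩ := w_exists (M := M) ![L ta * I, I, I * L tb] (by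
    intro l
    fin_cases l
    · show L ta * I * (L ta * I) = 1
      rw [mul_assoc, ← mul_assoc I, hL, ia, mul_assoc, hI, mul_one, ← map_mul]; simp
    · exact hI
    · show I * L tb * (I * L tb) = 1
      rw [← mul_assoc, hL, ib, mul_assoc _ I I, hI, mul_one, ← map_mul]; simp)
    (by show (L ta * I * I) ^ _ = 1; rw [eta, ← map_pow, ta_pow, map_one])
    (by show (I * (I * L tb)) ^ _ = 1; rw [etb, ← map_pow, tb_pow, map_one])
    (by show (L ta * I * (I * L tb)) ^ _ = 1; rw [etab, ← map_pow, tab_pow, map_one])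
  have key : F.comp f = L := by
    apply tg_ext
    · rw [MonoidHom.comp_apply, ha, map_mul, hF, hF]; exact eta
    · rw [MonoidHom.comp_apply, hb, map_mul, hF, hF]; exact etb
  have Linj : Function.Injective L := by
    intro s t h
    have := DFunLike.congr_fun h 1
    simpa [L] using this
  apply Function.Injective.of_comp (f := F)
  rw [← MonoidHom.coe_comp, key]
  exact Linj

theorem conj_prod {G : Type*} [Group G] (C : G) (D : ℕ → G) (l : List ℕ) :
    C⁻¹ * (l.map fun m => C * D m).prod * C = (l.map fun m => D m * C).prod := by
  induction l with
  | nil => simp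
  | cons a l ih => simp only [List.map_cons, List.prod_cons, ← ih]; group

theorem sr_ne (hM : Big M) {x y : Fin 3} (hxy : x ≠ y) : (sr x * sr y : M.Group) ≠ 1 := by
  intro h
  have e : (sr x : M.Group) = sr y := by
    have := eq_inv_of_mul_eq_one_left h
    simpa using this
  have e2 := congrArg (fun w => rep hM w (al x) x) e
  simp only [rep_sr, sg_al, cc_diag, cc_symm] at e2
  simp [al_ne hxy] at e2

theorem eX_eq : (eX : M.Group) = sr 1 * sr 0 * sr 1 * sr 2 := by
  simp [eX, ev, Gap.w, Gap.u, mul_assoc]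
theorem eY_eq : (eY : M.Group) = sr 1 * sr 0 * sr 1 * sr 0 * sr 1 * sr 2 := by
  simp [eY, ev, Gap.w, Gap.u, mul_assoc]

theorem final (hM : Big M) (d : ℕ) :
      Malcharacteristic (Subgroup.closure
        {PresentedGroup.mk (triangleRels (M 0 1) (M 1 2) (M 0 2)) (wordX (d + 8)),
         PresentedGroup.mk (triangleRels (M 0 1) (M 1 2) (M 0 2)) (wordY (d + 8))}) ∧
      Nonempty (↥(Subgroup.closure
        {PresentedGroup.mk (triangleRels (M 0 1) (M 1 2) (M 0 2)) (wordX (d + 8)),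
         PresentedGroup.mk (triangleRels (M 0 1) (M 1 2) (M 0 2)) (wordY (d + 8))}) ≃* FreeGroup (Fin 2)) := by
  obtain ⟨f, ha, hb⟩ := phi_exists M
  have finj := phi_inj f ha hb
  set mk := PresentedGroup.mk (triangleRels (M 0 1) (M 1 2) (M 0 2)) with hmk
  have mka : mk fa = ta := rfl
  have mkb : mk fb = tb := rfl
  set F : FreeGroup (Fin 2) →* TG M := FreeGroup.lift ![mk (wordX (d + 8)), mk (wordY (d + 8))] with hF
  have hcl : Subgroup.closure {mk (wordX (d + 8)), mk (wordY (d + 8))} = F.range := by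
    rw [hF, FreeGroup.range_lift_eq_closure]
    simp [Matrix.range_cons, Set.pair_comm]
  rw [hcl]
  set et : M.Group := (eX ^ 3)⁻¹ * sr 1 with het
  have cX : MulAut.conj (sr 1 : M.Group) (f (mk (fa * fb⁻¹))) = eX := by
    rw [map_mul, map_inv, mka, mkb, map_mul, map_inv, ha, hb, eX_eq]
    simp [mul_assoc]
  have cY : MulAut.conj (sr 1 : M.Group) (f (mk (fa ^ 2 * fb⁻¹))) = eY := by
    rw [map_mul, map_inv, map_pow, mka, mkb, map_mul, map_inv, map_pow, ha, hb, eY_eq]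
    simp [mul_assoc, pow_two]
  have hat_gen : ∀ b : ℕ, et * f (mk (((List.range (d + 8)).map fun m =>
      (fa * fb⁻¹) ^ 3 * (fa ^ 2 * fb⁻¹) ^ (m + b)).prod)) * et⁻¹ =
      ((List.range (d + 8)).map fun m => eY ^ (m + b) * eX ^ 3).prod := by
    intro b
    rw [← conj_prod]
    have : (((List.range (d + 8)).map fun m => eX ^ 3 * eY ^ (m + b)).prod : M.Group) =
        MulAut.conj (sr 1 : M.Group) (f (mk (((List.range (d + 8)).map fun m =>
      (fa * fb⁻¹) ^ 3 * (fa ^ 2 * fb⁻¹) ^ (m + b)).prod))) := by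
      rw [map_list_prod, map_list_prod, map_list_prod, List.map_map, List.map_map, List.map_map]
      congr 1
      apply List.map_congr_left
      intro m _
      rw [← cX, ← cY]
      simp only [Function.comp_apply, map_mul, map_pow]
    rw [this, het, MulAut.conj_apply]
    group
  have hPh : ∀ w, et * f (F w) * et⁻¹ = Ph d w := by
    have : ((MulAut.conj et).toMonoidHom.comp f).comp F = Ph d := by
      apply FreeGroup.ext_hom
      intro l
      fin_cases l
      · simpa [hF, Ph, hat, lo, wordX] using hat_gen 3
      · have := hat_gen (d + 11)
        simpa [hF, Ph, hat, lo, wordY, add_assoc] using this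
    exact fun w => DFunLike.congr_fun this w
  have Finj : Function.Injective F := by
    have := Ph_inj hM d
    intro s t h
    apply this
    rw [← hPh, ← hPh, h]
  refine ⟨?_, ⟨(MonoidHom.ofInjective Finj).symm⟩⟩
  rintro δ ⟨x, ⟨f1, rfl⟩, hx1, ⟨f2, hf2⟩⟩
  have hf1 : f1 ≠ 1 := by rintro rfl; exact hx1 (map_one F)
  have hf2' : f2 ≠ 1 := by
    rintro rfl
    rw [map_one] at hf2
    exact hx1 (by simpa using hf2.symm)
  have m01 := hM 0 1 (by decide)
  have m12 := hM 1 2 (by decide)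
  have m02 := hM 0 2 (by decide)
  have hpar : ∀ t, par (f t) = 1 := by
    have : (par (M := M)).comp f = 1 := by
      apply tg_ext
      · rw [MonoidHom.comp_apply, ha, par_xy]; rfl
      · rw [MonoidHom.comp_apply, hb, par_xy]; rfl
    exact fun t => DFunLike.congr_fun this t
  let fd : TG M →* M.Group := f.comp δ.toMonoidHom
  have fdinj : Function.Injective fd := finj.comp δ.injective
  have o01 : fd ta ^ M 0 1 = 1 := by rw [← map_pow, ta_pow, map_one]
  have o12 : fd tb ^ M 1 2 = 1 := by rw [← map_pow, tb_pow, map_one]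
  have o02 : (fd ta * fd tb) ^ M 0 2 = 1 := by rw [← map_mul, ← map_pow, tab_pow, map_one]
  obtain ⟨g, x, y, z, hxy, hxz, hyz, eu, ev⟩ := thmC hM (fd ta) (fd tb)
    (isOfFinOrder_iff_pow_eq_one.2 ⟨_, by omega, o01⟩) (isOfFinOrder_iff_pow_eq_one.2 ⟨_, by omega, o12⟩)
    (isOfFinOrder_iff_pow_eq_one.2 ⟨_, by omega, o02⟩) (hpar _) (hpar _)
    (by
      intro h
      have h2 := fdinj (h.trans (map_one fd).symm)
      rw [h2, map_one] at ha
      exact sr_ne hM (by decide) ha.symm)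
    (by
      intro h
      have h2 := fdinj (h.trans (map_one fd).symm)
      rw [h2, map_one] at hb
      exact sr_ne hM (by decide) hb.symm)
    (by
      rw [← map_inv, ← map_mul, fdinj.isOfFinOrder_iff, ← finj.isOfFinOrder_iff]
      intro h
      have h1 := fin_conj (sr 1) _ h
      refine inf_yxyz hM (x := 0) (y := 1) (z := 2) (by decide) (by decide) (by decide) ?_
      convert h1 using 1
      rw [map_mul, map_inv, ha, hb]
      simp [mul_assoc])
  obtain ⟨p, rfl, rfl, rfl⟩ := exists_perm hxy hxz hyz
  have cu : ∀ (w : M.Group) (n : ℕ), (g * w * g⁻¹) ^ n = 1 → w ^ n = 1 := by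
    intro w n h
    rwa [conj_pow, conj_eq_one_iff] at h
  obtain ⟨Pi, hPi⟩ := w_exists (M := M) (fun l => (sr (p l) : M.Group)) (fun l => sr_mul_self _)
    (cu _ _ (by rw [← eu]; exact o01)) (cu _ _ (by rw [← ev]; exact o12))
    (cu _ _ (by
      rw [eu, ev] at o02
      convert o02 using 2
      simp [mul_assoc]))
  have hfd : ∀ t, fd t = g * Pi (f t) * g⁻¹ := by
    have : fd = ((MulAut.conj g).toMonoidHom.comp Pi).comp f := by
      apply tg_ext
      · rw [eu]; simp [ha, hPi]
      · rw [ev]; simp [hb, hPi]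
    exact fun t => DFunLike.congr_fun this t
  obtain ⟨rfl, f3, hf3⟩ := main5 hM d p Pi hPi (et * g * (Pi et)⁻¹) f1 f2 hf1 hf2' (by
    have h1 : Ph d f2 = et * (g * Pi (f (F f1)) * g⁻¹) * et⁻¹ := by
      rw [← hPh, hf2, ← hfd]; rfl
    rw [h1, ← hPh f1]
    simp only [map_mul, map_inv]
    group)
  have hPid : Pi = MonoidHom.id _ := M.toCoxeterSystem.ext_simple hPi
  subst hPid
  have hg : g = f (F f3) := by
    rw [← hPh] at hf3
    simpa using hf3.symm
  refine ⟨(F f3)⁻¹, ⟨f3⁻¹, map_inv _ _⟩, fun h => finj ?_⟩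
  have := hfd h
  rw [hg] at this
  simpa [fd] using this

theorem exists_M (i j k : ℕ) (hi : 6 ≤ i) (hj : 6 ≤ j) (hk : 6 ≤ k) :
    ∃ M : CoxeterMatrix (Fin 3), Big M ∧ M 0 1 = i ∧ M 1 2 = j ∧ M 0 2 = k := by
  refine ⟨⟨!![1, i, k; i, 1, j; k, j, 1], ?_, ?_, ?_⟩, ?_, rfl, rfl, rfl⟩
  · ext a b; fin_cases a <;> fin_cases b <;> rfl
  · intro a; fin_cases a <;> rfl
  · intro a b h; fin_cases a <;> fin_cases b <;> simp at h ⊢ <;> omega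
  · intro a b h; fin_cases a <;> fin_cases b <;> first | exact absurd rfl h | assumption

end Tri

theorem lem_malchar_triangle (i j k : ℕ) (hi : 6 ≤ i) (hj : 6 ≤ j) (hk : 6 ≤ k) :
    ∃ ρ₀ : ℕ, max i (max j k) ≤ ρ₀ ∧ ∀ ρ : ℕ, ρ₀ ≤ ρ →
      Malcharacteristic (Subgroup.closure
        {PresentedGroup.mk (triangleRels i j k) (wordX ρ),
         PresentedGroup.mk (triangleRels i j k) (wordY ρ)}) ∧
      Nonempty (↥(Subgroup.closure
        {PresentedGroup.mk (triangleRels i j k) (wordX ρ),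
         PresentedGroup.mk (triangleRels i j k) (wordY ρ)}) ≃* FreeGroup (Fin 2)) := by
  obtain ⟨M, hM, rfl, rfl, rfl⟩ := Tri.exists_M i j k hi hj hk
  refine ⟨max (M 0 1) (max (M 1 2) (M 0 2)) + 8, by omega, fun ρ hρ => ?_⟩
  obtain ⟨d, rfl⟩ : ∃ d, ρ = d + 8 := ⟨ρ - 8, by omega⟩
  exact Tri.final hM d
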